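/- (Theorem 1.1(ii), N = 4.) Let ε = i be a primitive fourth root of unity. For every r ≥ 1 and all ε₁,…,ε_r ∈ μ₄ with ε_r ≠ 1, there exist rational numbers a, b such that ζ(1,…,1; ε₁,…,ε_r) − a · ζ(1,…,1; 1,…,1,i) − b · ζ(1,…,1; 1,…,1,−i) lies in D_{r−1} Z_r(4). In other words, the depth-graded space of unit cyclotomic multiple zeta values of weight r for μ₄ is spanned by the images of ζ(1,…,1; 1,…,1,i) and ζ(1,…,1; 1,…,1,−i). -/

import Mathlib

open Filter Topology

/-- Partial sum of the series defining a cyclotomic multiple zeta value. -/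
noncomputable def cmzvPartial (r : ℕ) (k : Fin r → ℕ) (ε : Fin r → ℂ) (M : ℕ) : ℂ :=
  ∑ n ∈ (Fintype.piFinset fun _ : Fin r => Finset.Icc 1 M).filter
      (fun n => ∀ i j : Fin r, i < j → n i < n j),
    ∏ i, ε i ^ n i / (n i : ℂ) ^ k i

/-- `z` is a cyclotomic multiple zeta value for `μ_N` of weight `K` and depth `d`. -/
def IsCMZV (N K d : ℕ) (z : ℂ) : Prop :=
  ∃ _hd : 1 ≤ d, ∃ (k : Fin d → ℕ) (ε : Fin d → ℂ),
    (∀ i, 1 ≤ k i) ∧ (∀ i, ε i ^ N = 1) ∧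
    ¬(k ⟨d - 1, by omega⟩ = 1 ∧ ε ⟨d - 1, by omega⟩ = 1) ∧
    (∑ i, k i) = K ∧
    Tendsto (cmzvPartial d k ε) atTop (𝓝 z)

/-- `D_s Z_K(N)`: the `ℚ`-span of cyclotomic multiple zeta values for `μ_N` of weight `K`
and depth at most `s`. -/
noncomputable def depthFilteredCMZV (N K s : ℕ) : Submodule ℚ ℂ :=
  Submodule.span ℚ {z : ℂ | ∃ d ≤ s, IsCMZV N K d z}

open Filter Topology

namespace MU4

/-- Letters: `z` is the pole at `0`, the others are the poles at `1,-1,i,-i`. -/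
inductive Ltr
  | z | p | q | b | c
  deriving DecidableEq

/-- The complex number attached to a letter. -/
noncomputable def Ltr.v : Ltr → ℂ
  | .z => 0
  | .p => 1
  | .q => -1
  | .b => Complex.I
  | .c => -Complex.I

lemma Ltr.norm_v {x : Ltr} (h : x ≠ .z) : ‖x.v‖ = 1 := by
  cases x <;> simp_all [Ltr.v]

lemma Ltr.v_ne {x : Ltr} (h : x ≠ .z) : x.v ≠ 0 := by
  have := Ltr.norm_v h
  intro h0
  rw [h0] at this
  simp at this

/-- Taylor coefficients of the iterated integral (the head is the outermost letter). -/
noncomputable def cf : List Ltr → ℕ → ℂ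
  | [], n => if n = 0 then 1 else 0
  | x :: w, n => if x = .z then cf w n / n
      else -(∑ m ∈ Finset.range n, cf w m * x.v ^ m) / (x.v ^ n * n)

lemma cf_cons_zero (x : Ltr) (w : List Ltr) : cf (x :: w) 0 = 0 := by
  simp [cf]

lemma cf_z (w : List Ltr) (n : ℕ) : cf (.z :: w) n = cf w n / n := by simp [cf]

lemma cf_nz {x : Ltr} (h : x ≠ .z) (w : List Ltr) (n : ℕ) :
    cf (x :: w) n = -(∑ m ∈ Finset.range n, cf w m * x.v ^ m) / (x.v ^ n * n) := by
  simp [cf, h]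

lemma norm_cf_nz_le {x : Ltr} (h : x ≠ .z) (w : List Ltr) (n : ℕ) :
    ‖cf (x :: w) n‖ ≤ (∑ m ∈ Finset.range n, ‖cf w m‖) / n := by
  rw [cf_nz h, norm_div, norm_neg, norm_mul, norm_pow, Ltr.norm_v h, one_pow, one_mul]
  simp only [Complex.norm_natCast]
  gcongr
  refine (norm_sum_le _ _).trans (Finset.sum_le_sum fun m _ => ?_)
  rw [norm_mul, norm_pow, Ltr.norm_v h]; simp

lemma norm_cf_le (w : List Ltr) : ∀ n, ‖cf w n‖ ≤ 1 := by
  induction w with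
  | nil => intro n; unfold cf; split_ifs <;> simp
  | cons x w ih =>
    intro n
    by_cases h : x = .z
    · subst h
      rw [cf_z, norm_div, Complex.norm_natCast]
      rcases Nat.eq_zero_or_pos n with rfl | hn
      · simp
      · have : (1:ℝ) ≤ n := by exact_mod_cast hn
        rw [div_le_one (by linarith)]
        exact (ih n).trans this
    · refine (norm_cf_nz_le h w n).trans ?_
      have : ∑ m ∈ Finset.range n, ‖cf w m‖ ≤ n := by
        refine (Finset.sum_le_sum fun m _ => ih m).trans ?_
        simp
      exact div_le_one_of_le₀ this (by positivity)

/-- The multiple polylogarithm attached to a word. -/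
noncomputable def Lf (w : List Ltr) (t : ℝ) : ℂ := ∑' n, cf w n * (t : ℂ) ^ n

lemma Lf_nil (t : ℝ) : Lf [] t = 1 := by
  unfold Lf
  rw [tsum_eq_single 0]
  · simp [cf]
  · intro n hn; simp [cf, hn]

lemma summable_Lf (w : List Ltr) {t : ℝ} (ht : |t| < 1) :
    Summable fun n => cf w n * (t : ℂ) ^ n := by
  refine Summable.of_norm_bounded (g := fun n => |t| ^ n)
    (summable_geometric_of_lt_one (abs_nonneg _) ht) fun n => ?_
  rw [norm_mul, norm_pow, Complex.norm_real, Real.norm_eq_abs]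
  exact mul_le_of_le_one_left (by positivity) (norm_cf_le w n)

lemma summable_Lf' (w : List Ltr) {t : ℝ} (ht : |t| < 1) :
    Summable fun n : ℕ => (n : ℂ) * cf w n * (t : ℂ) ^ n := by
  have := summable_pow_mul_geometric_of_norm_lt_one (R := ℝ) 1 (r := |t|) (by simpa using ht)
  refine Summable.of_norm_bounded this fun n => ?_
  rw [norm_mul, norm_mul, norm_pow, Complex.norm_real, Real.norm_eq_abs, Complex.norm_natCast,
    pow_one]
  have := norm_cf_le w n
  have h2 : (0:ℝ) ≤ n := by positivity
  nlinarith [pow_nonneg (abs_nonneg t) n, mul_le_mul_of_nonneg_left this h2]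

lemma hasDerivAt_Lf_aux (w : List Ltr) {t : ℝ} (ht : |t| < 1) :
    HasDerivAt (Lf w) (∑' n : ℕ, cf w n * ((n : ℂ) * (t : ℂ) ^ (n - 1))) t := by
  obtain ⟨R, hR1, hR2⟩ := exists_between ht
  have hR0 : 0 ≤ R := (abs_nonneg t).trans hR1.le
  have hu : Summable fun n : ℕ => (n : ℝ) * R ^ (n - 1) := by
    have := summable_pow_mul_geometric_of_norm_lt_one (R := ℝ) 1 (r := R)
      (by rwa [Real.norm_eq_abs, abs_of_nonneg hR0])
    rw [← summable_nat_add_iff 1]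
    have h1 := (summable_pow_mul_geometric_of_norm_lt_one (R := ℝ) 1 (r := R)
      (by rwa [Real.norm_eq_abs, abs_of_nonneg hR0])).add
      (summable_geometric_of_lt_one hR0 hR2)
    refine h1.congr fun n => ?_
    simp; ring
  refine hasDerivAt_tsum_of_isPreconnected (t := Set.Ioo (-R) R) (y₀ := 0) hu isOpen_Ioo
    isPreconnected_Ioo (g := fun n (s : ℝ) => cf w n * (s : ℂ) ^ n)
    (g' := fun n (s : ℝ) => cf w n * ((n : ℂ) * (s : ℂ) ^ (n - 1))) ?_ ?_ ?_ ?_ ?_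
  · intro n y _
    have := ((hasDerivAt_id y).ofReal_comp.pow n).const_mul (cf w n)
    simpa using this
  · intro n y hy
    have hy' : |y| ≤ R := (abs_lt.mpr hy).le
    rw [norm_mul, norm_mul, norm_pow, Complex.norm_real, Real.norm_eq_abs, Complex.norm_natCast]
    calc _ ≤ 1 * ((n:ℝ) * R ^ (n-1)) := by
          gcongr
          exact norm_cf_le w n
      _ = _ := one_mul _
  · constructor <;> linarith [abs_nonneg t]
  · exact summable_Lf w (t := 0) (by simp)
  · exact abs_lt.mp hR1

lemma hasDerivAt_Lf (x : Ltr) (w : List Ltr) (hx : x = .z → w ≠ []) {t : ℝ} (ht0 : 0 < t)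
    (ht : t < 1) : HasDerivAt (Lf (x :: w)) (Lf w t / ((t : ℂ) - x.v)) t := by
  have hta : |t| < 1 := by rwa [abs_of_pos ht0]
  have htx : (t : ℂ) - x.v ≠ 0 := by
    rw [sub_ne_zero]
    intro h
    by_cases hz : x = .z
    · subst hz; simp [Ltr.v] at h; linarith
    · have := Ltr.norm_v hz
      rw [← h, Complex.norm_real, Real.norm_eq_abs, abs_of_pos ht0] at this
      linarith
  have htc : (t : ℂ) ≠ 0 := by exact_mod_cast ht0.ne'
  convert! hasDerivAt_Lf_aux (x :: w) hta using 1
  rw [div_eq_iff htx]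
  set S := ∑' n : ℕ, cf (x :: w) n * ((n : ℂ) * (t : ℂ) ^ (n - 1)) with hS
  have hs1 := summable_Lf' (x :: w) hta
  have h1 : (t : ℂ) * S = ∑' n : ℕ, (n : ℂ) * cf (x :: w) n * (t : ℂ) ^ n := by
    rw [hS, ← tsum_mul_left]
    refine tsum_congr fun n => ?_
    rcases n with _ | n
    · simp
    · simp [pow_succ]; ring
  have h2 : (t : ℂ) * S = t * ∑' n : ℕ, ((n + 1 : ℕ) : ℂ) * cf (x :: w) (n + 1) * (t : ℂ) ^ n := by
    rw [h1, hs1.tsum_eq_zero_add, ← tsum_mul_left]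
    simp only [Nat.cast_zero, zero_mul, zero_add]
    refine tsum_congr fun n => ?_
    rw [pow_succ]; ring
  have h3 : S = ∑' n : ℕ, ((n + 1 : ℕ) : ℂ) * cf (x :: w) (n + 1) * (t : ℂ) ^ n :=
    mul_left_cancel₀ htc h2
  have hs3 : Summable fun n : ℕ => ((n + 1 : ℕ) : ℂ) * cf (x :: w) (n + 1) * (t : ℂ) ^ n := by
    have := ((summable_nat_add_iff 1).mpr hs1).mul_left ((t : ℂ)⁻¹)
    refine this.congr fun n => ?_
    rw [pow_succ]; field_simp
  have h4 : S * ((t : ℂ) - x.v) = (t : ℂ) * S - x.v * S := by ring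
  rw [h4, h1]
  rw [h3]
  rw [← tsum_mul_left, ← hs1.tsum_sub (hs3.mul_left _)]
  refine tsum_congr fun n => ?_
  by_cases hz : x = .z
  · subst hz
    simp only [Ltr.v, cf_z]
    rcases n with _ | n
    · have : cf w 0 = 0 := by
        rcases w with _ | ⟨y, w⟩
        · exact absurd rfl (hx rfl)
        · exact cf_cons_zero _ _
      simp [this]
    · field_simp
      simp
  · have hv := Ltr.v_ne hz
    rw [cf_nz hz, cf_nz hz, Finset.sum_range_succ]
    have : ((n + 1 : ℕ) : ℂ) ≠ 0 := by exact_mod_cast Nat.succ_ne_zero n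
    rcases n with _ | n
    · simp; field_simp
    · have h6 : ((n + 1 : ℕ) : ℂ) ≠ 0 := by exact_mod_cast Nat.succ_ne_zero n
      rw [pow_succ (x.v) (n+1)]
      field_simp
      ring

lemma norm_Lf_le (x : Ltr) (w : List Ltr) {t : ℝ} (ht0 : 0 ≤ t) (ht : t ≤ 1 / 2) :
    ‖Lf (x :: w) t‖ ≤ 2 * t := by
  have hta : |t| < 1 := by rw [abs_of_nonneg ht0]; linarith
  have hs := summable_Lf (x :: w) hta
  unfold Lf
  rw [hs.tsum_eq_zero_add, cf_cons_zero, zero_mul, zero_add]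
  have hg : HasSum (fun n : ℕ => t * t ^ n) (t * (1 - t)⁻¹) :=
    (hasSum_geometric_of_lt_one ht0 (by linarith)).mul_left t
  refine (tsum_of_norm_bounded hg fun n => ?_).trans ?_
  · rw [norm_mul, norm_pow, Complex.norm_real, Real.norm_eq_abs, abs_of_nonneg ht0, pow_succ']
    exact mul_le_of_le_one_left (by positivity) (norm_cf_le _ _)
  · have : (1 - t)⁻¹ ≤ 2 := by
      rw [inv_le_comm₀ (by linarith) (by norm_num)]; linarith
    nlinarith

lemma Lf_tendsto_zero (x : Ltr) (w : List Ltr) : Tendsto (Lf (x :: w)) (𝓝[>] 0) (𝓝 0) := by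
  have : Tendsto (fun t : ℝ => 2 * t) (𝓝[>] 0) (𝓝 0) := by
    have : Tendsto (fun t : ℝ => 2 * t) (𝓝 0) (𝓝 (2 * 0)) := by
      exact (continuous_const.mul continuous_id).tendsto 0
    rw [mul_zero] at this
    exact this.mono_left nhdsWithin_le_nhds
  refine squeeze_zero_norm' ?_ this
  filter_upwards [Ioc_mem_nhdsGT (show (0:ℝ) < 1/2 by norm_num)] with t ht
  exact norm_Lf_le x w ht.1.le ht.2

/-- The innermost letter is not `z`. -/
def Good : List Ltr → Prop
  | [] => True
  | x :: w => (x = .z → w ≠ []) ∧ Good w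

/-- The outermost letter is not `p`. -/
def Adm (w : List Ltr) : Prop := ∀ w', w ≠ .p :: w'

lemma sum_sqrt_bound {g : ℕ → ℝ} {C : ℝ} (hC : 0 ≤ C) (h0 : g 0 ≤ 1)
    (hg : ∀ n, 1 ≤ n → g n ≤ C / √n) (n : ℕ) :
    ∑ m ∈ Finset.range n, g m ≤ (1 + 3 * C) * √n := by
  induction n with
  | zero => simp
  | succ n ih =>
    rw [Finset.sum_range_succ]
    rcases Nat.eq_zero_or_pos n with rfl | hn
    · simp; linarith
    · have h1 := hg n hn
      have hn' : (1:ℝ) ≤ n := by exact_mod_cast hn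
      have hs : 0 < √(n:ℝ) := Real.sqrt_pos.mpr (by linarith)
      have e1 : √(n:ℝ) * √(n:ℝ) = n := Real.mul_self_sqrt (by linarith)
      have e2 : √((n+1 : ℕ):ℝ) * √((n+1 : ℕ):ℝ) = n + 1 := by
        rw [Real.mul_self_sqrt (by positivity)]; push_cast; ring
      set a := √(n:ℝ)
      set b := √((n+1 : ℕ):ℝ)
      have hb : 0 ≤ b := Real.sqrt_nonneg _
      have hab : a ≤ b := by nlinarith
      have hb2 : b ≤ 2 * a := by nlinarith
      have key : C / a ≤ 3 * C * (b - a) := by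
        rw [div_le_iff₀ hs]
        have : 1 ≤ 3 * (b - a) * a := by
          have h7 : (b - a) * (b + a) = 1 := by linarith [e1, e2]
          nlinarith
        nlinarith
      nlinarith

lemma cf_decay (w : List Ltr) : ∃ C, 0 ≤ C ∧ ∀ n, 1 ≤ n → ‖cf w n‖ ≤ C / √n := by
  induction w with
  | nil =>
    refine ⟨0, le_rfl, fun n hn => ?_⟩
    have : n ≠ 0 := by omega
    simp [cf, this]
  | cons x w ih =>
    obtain ⟨C, hC, h⟩ := ih
    refine ⟨1 + 3 * C, by positivity, fun n hn => ?_⟩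
    have hn' : (1:ℝ) ≤ n := by exact_mod_cast hn
    have hs : 0 < √(n:ℝ) := Real.sqrt_pos.mpr (by linarith)
    by_cases hz : x = .z
    · subst hz
      rw [cf_z, norm_div, Complex.norm_natCast]
      have h1 : ‖cf w n‖ / n ≤ ‖cf w n‖ := div_le_self (norm_nonneg _) hn'
      have h2 := h n hn
      have h3 : C / √n ≤ (1 + 3 * C) / √n := by gcongr; linarith
      linarith
    · refine (norm_cf_nz_le hz w n).trans ?_
      have h1 := sum_sqrt_bound hC (norm_cf_le w 0) h n
      rw [div_le_div_iff₀ (by linarith) hs]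
      have e1 : √(n:ℝ) * √(n:ℝ) = n := Real.mul_self_sqrt (by linarith)
      calc _ ≤ ((1 + 3 * C) * √n) * √n := by gcongr
        _ = _ := by rw [mul_assoc, e1]

lemma summable_sqrt_mul : Summable fun n : ℕ => 1 / (√(n:ℝ) * n) := by
  have := Real.summable_one_div_nat_rpow.mpr (show (1:ℝ) < 3 / 2 by norm_num)
  refine this.congr fun n => ?_
  congr 1
  rcases Nat.eq_zero_or_pos n with rfl | hn
  · simp
  · have hn' : (0:ℝ) < n := by exact_mod_cast hn
    rw [Real.sqrt_eq_rpow, show (3/2:ℝ) = 1/2 + 1 by norm_num, Real.rpow_add hn', Real.rpow_one]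

lemma cf_tendsto (w : List Ltr) : Tendsto (cf w) atTop (𝓝 0) := by
  obtain ⟨C, hC, h⟩ := cf_decay w
  have h2 : Tendsto (fun n : ℕ => C / √(n:ℝ)) atTop (𝓝 0) :=
    (Real.tendsto_sqrt_atTop.comp tendsto_natCast_atTop_atTop).const_div_atTop C
  refine squeeze_zero_norm' ?_ h2
  filter_upwards [eventually_ge_atTop 1] with n hn using h n hn

lemma summable_cf_div (w : List Ltr) : Summable fun n : ℕ => cf w n / n := by
  obtain ⟨C, hC, h⟩ := cf_decay w
  refine Summable.of_norm_bounded (summable_sqrt_mul.mul_left C) fun n => ?_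
  rcases Nat.eq_zero_or_pos n with rfl | hn
  · simp
  · rw [norm_div, Complex.norm_natCast]
    have := h n hn
    calc _ ≤ C / √n / n := by gcongr
      _ = _ := by rw [div_div]; ring

lemma exists_val (w : List Ltr) (ha : Adm w) :
    ∃ l, Tendsto (fun n => ∑ i ∈ Finset.range n, cf w i) atTop (𝓝 l) := by
  rcases w with _ | ⟨x, w⟩
  · refine ⟨1, ?_⟩
    have : HasSum (cf []) 1 := by
      convert! hasSum_ite_eq 0 (1:ℂ) using 1
      
    exact this.tendsto_sum_nat
  · by_cases hz : x = .z
    · subst hz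
      refine ⟨∑' n : ℕ, cf w n / n, ?_⟩
      have := (summable_cf_div w).hasSum.tendsto_sum_nat
      simpa only [cf_z] using this
    · have hx1 : x.v ≠ 1 := by
        have : x ≠ .p := by rintro rfl; exact ha w rfl
        cases x <;> simp_all [Ltr.v, Complex.ext_iff]
        norm_num
      have hv := Ltr.v_ne hz
      set d : ℕ → ℂ := cf (x :: w) with hd
      have hrec : ∀ n, d (n+1) - d n / x.v = -(d n + cf w n) / (x.v * (n+1 : ℕ)) := by
        intro n
        have h1 : ((n + 1 : ℕ) : ℂ) ≠ 0 := by exact_mod_cast Nat.succ_ne_zero n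
        simp only [hd, cf_nz hz, Finset.sum_range_succ]
        rcases n with _ | n
        · simp
        · have h6 : ((n + 1 : ℕ) : ℂ) ≠ 0 := by exact_mod_cast Nat.succ_ne_zero n
          rw [pow_succ (x.v) (n+1)]
          field_simp
          push_cast
          ring
      have hsum : Summable fun n => d (n+1) - d n / x.v := by
        simp only [hrec]
        rw [← summable_nat_add_iff 1]
        obtain ⟨C1, hC1, h1⟩ := cf_decay (x :: w)
        obtain ⟨C2, hC2, h2⟩ := cf_decay w
        refine Summable.of_norm_bounded
          (((summable_nat_add_iff 1).mpr summable_sqrt_mul).mul_left (C1 + C2)) fun n => ?_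
        rw [norm_div, norm_mul, Ltr.norm_v hz, one_mul, Complex.norm_natCast, norm_neg]
        have hs : 0 < √((n+1 : ℕ):ℝ) := Real.sqrt_pos.mpr (by positivity)
        calc _ ≤ (C1 / √((n+1:ℕ):ℝ) + C2 / √((n+1:ℕ):ℝ)) / ((n+1+1 : ℕ):ℝ) := by
              gcongr
              exact (norm_add_le _ _).trans (add_le_add (h1 _ (by omega)) (h2 _ (by omega)))
          _ ≤ (C1 / √((n+1:ℕ):ℝ) + C2 / √((n+1:ℕ):ℝ)) / ((n+1 : ℕ):ℝ) := by
              gcongr; omega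
          _ = _ := by field_simp
      have ht := hsum.hasSum.tendsto_sum_nat
      have hd0 : d 0 = 0 := cf_cons_zero _ _
      have hpart : ∀ n, ∑ i ∈ Finset.range n, d i =
          ((∑ i ∈ Finset.range n, (d (i+1) - d i / x.v)) - d n) / (1 - x.v⁻¹) := by
        intro n
        have h1 : 1 - x.v⁻¹ ≠ 0 := by
          rw [sub_ne_zero]; intro h; apply hx1; field_simp at h; exact h
        rw [eq_div_iff h1, Finset.sum_sub_distrib]
        have h2 := Finset.sum_range_succ' d n
        rw [Finset.sum_range_succ, hd0, add_zero] at h2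
        rw [← h2, ← Finset.sum_div]
        field_simp
        ring
      have hfin := (ht.sub (cf_tendsto (x :: w))).div_const (1 - x.v⁻¹)
      exact ⟨_, hfin.congr fun n => (hpart n).symm⟩

/-- The value at `1`. -/
noncomputable def val (w : List Ltr) : ℂ :=
  limUnder atTop (fun n => ∑ i ∈ Finset.range n, cf w i)

lemma val_spec {w : List Ltr} (ha : Adm w) :
    Tendsto (fun n => ∑ i ∈ Finset.range n, cf w i) atTop (𝓝 (val w)) :=
  tendsto_nhds_limUnder (exists_val w ha)

lemma Lf_tendsto {w : List Ltr} (ha : Adm w) : Tendsto (Lf w) (𝓝[<] 1) (𝓝 (val w)) := by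
  have := Complex.tendsto_tsum_powerSeries_nhdsWithin_lt (val_spec ha)
  rw [tendsto_map'_iff] at this
  exact this

lemma val_nil : val [] = 1 := by
  have h1 := Lf_tendsto (w := []) (by intro w h; simp at h)
  have h2 : Tendsto (Lf []) (𝓝[<] 1) (𝓝 1) := by
    have : Lf [] = fun _ => 1 := funext Lf_nil
    rw [this]; exact tendsto_const_nhds
  exact tendsto_nhds_unique h1 h2

end MU4

open Filter Topology

namespace MU4

/-- The constant `iπ/2`. -/
noncomputable def dd : ℂ := Complex.I * Real.pi / 2

/-- Depth of a word. -/
def nz : List Ltr → ℕ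
  | [] => 0
  | x :: w => (if x = .z then 0 else 1) + nz w

lemma nz_le (w : List Ltr) : nz w ≤ w.length := by
  induction w with
  | nil => simp [nz]
  | cons x w ih => simp only [nz, List.length_cons]; split_ifs <;> omega

lemma nz_lt {w : List Ltr} (h : Ltr.z ∈ w) : nz w < w.length := by
  induction w with
  | nil => simp at h
  | cons x w ih =>
    simp only [nz, List.length_cons]
    have := nz_le w
    rcases List.mem_cons.mp h with h | h
    · simp [← h]; omega
    · have := ih h
      split_ifs <;> omega

lemma good_of_unit {w : List Ltr} (h : Ltr.z ∉ w) : Good w := by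
  induction w with
  | nil => trivial
  | cons x w ih =>
    simp only [List.mem_cons, not_or] at h
    exact ⟨fun hx => absurd hx.symm h.1, ih h.2⟩

lemma adm_nil : Adm [] := by intro w h; simp at h

lemma adm_cons {x : Ltr} {w : List Ltr} : Adm (x :: w) ↔ x ≠ .p := by
  constructor
  · intro h hx; subst hx; exact h w rfl
  · intro h w' hw; exact h (List.cons.inj hw).1

lemma adm_iff {w : List Ltr} : Adm w ↔ w.head? ≠ some .p := by
  cases w with
  | nil => simp [adm_nil]
  | cons x w => simp [adm_cons]

/-- Span of `dd ^ k * Lf w` with `C k w`. -/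
noncomputable def Sp (C : ℕ → List Ltr → Prop) : Submodule ℚ (ℝ → ℂ) :=
  Submodule.span ℚ {f | ∃ k w, C k w ∧ f = fun t => dd ^ k * Lf w t}

/-- Span of `dd ^ k * val w` with `C k w`. -/
noncomputable def SV (C : ℕ → List Ltr → Prop) : Submodule ℚ ℂ :=
  Submodule.span ℚ {v | ∃ k w, C k w ∧ v = dd ^ k * val w}

lemma Sp_mono {C C' : ℕ → List Ltr → Prop} (h : ∀ k w, C k w → C' k w) : Sp C ≤ Sp C' := by
  apply Submodule.span_mono
  rintro f ⟨k, w, hC, rfl⟩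
  exact ⟨k, w, h k w hC, rfl⟩

lemma Sp_mem {C : ℕ → List Ltr → Prop} {k : ℕ} {w : List Ltr} (h : C k w) :
    (fun t => dd ^ k * Lf w t) ∈ Sp C := Submodule.subset_span ⟨k, w, h, rfl⟩

lemma qsmul_eq (a : ℚ) (z : ℂ) : a • z = (a : ℂ) * z := by
  rw [Rat.smul_def]

lemma Sp_prim {C : ℕ → List Ltr → Prop} (y : Ltr) (hy : y = .z → ∀ k w, C k w → w ≠ [])
    {f : ℝ → ℂ} (hf : f ∈ Sp C) :
    ∃ g ∈ Sp (fun k w => ∃ w0, w = y :: w0 ∧ C k w0),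
      (∀ t ∈ Set.Ioo (0:ℝ) 1, HasDerivAt g (f t / ((t:ℂ) - y.v)) t) ∧
      ∃ A : ℝ, ∀ t ∈ Set.Ioc (0:ℝ) (1/2), ‖g t‖ ≤ A * t := by
  unfold Sp at hf
  induction hf using Submodule.span_induction with
  | mem f hf =>
    obtain ⟨k, w, hC, rfl⟩ := hf
    refine ⟨_, Sp_mem (k := k) (w := y :: w) ⟨w, rfl, hC⟩, fun t ht => ?_, 2 * ‖dd ^ k‖, fun t ht => ?_⟩
    · have := (hasDerivAt_Lf y w (fun h => hy h k w hC) ht.1 ht.2).const_mul (dd ^ k)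
      convert! this using 1
      ring
    · rw [norm_mul]
      have := norm_Lf_le y w ht.1.le ht.2
      calc _ ≤ ‖dd ^ k‖ * (2 * t) := by gcongr
        _ = _ := by ring
  | zero =>
    refine ⟨0, Submodule.zero_mem _, fun t _ => ?_, 0, fun t _ => by simp⟩
    have := hasDerivAt_const (𝕜 := ℝ) (F := ℂ) t 0
    convert! this using 1
    simp
  | add f1 f2 _ _ h1 h2 =>
    obtain ⟨g1, m1, d1, A1, b1⟩ := h1
    obtain ⟨g2, m2, d2, A2, b2⟩ := h2
    refine ⟨g1 + g2, Submodule.add_mem _ m1 m2, fun t ht => ?_, A1 + A2, fun t ht => ?_⟩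
    · convert! (d1 t ht).add (d2 t ht) using 1
      simp only [Pi.add_apply]; ring
    · refine (norm_add_le _ _).trans ?_
      have := b1 t ht
      have := b2 t ht
      linarith
  | smul a f _ h =>
    obtain ⟨g, m, d, A, b⟩ := h
    refine ⟨a • g, Submodule.smul_mem _ a m, fun t ht => ?_, |(a:ℝ)| * A, fun t ht => ?_⟩
    · have h1 := (d t ht).const_mul (a : ℂ)
      have e1 : a • g = fun s => (a:ℂ) * g s := by
        ext s; simp [qsmul_eq]
      rw [e1]
      convert! h1 using 1
      simp only [Pi.smul_apply, qsmul_eq]; ring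
    · simp only [Pi.smul_apply, qsmul_eq, norm_mul]
      have := b t ht
      have e : ‖(a:ℂ)‖ = |(a:ℝ)| := by
        rw [show ((a:ℂ)) = ((a:ℝ):ℂ) by simp, Complex.norm_real, Real.norm_eq_abs]
      rw [e, mul_assoc]
      gcongr

/-- Evaluation of a form, given as signed list of letters. -/
noncomputable def fev (F : List (ℚ × Ltr)) (v : ℂ) : ℂ :=
  (F.map fun a => (a.1 : ℂ) / (v - a.2.v)).sum

lemma Sp_form {C : ℕ → List Ltr → Prop} (F : List (ℚ × Ltr))
    (hy : ∀ a ∈ F, a.2 = .z → ∀ k w, C k w → w ≠ [])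
    {f : ℝ → ℂ} (hf : f ∈ Sp C) :
    ∃ g ∈ Sp (fun k w => ∃ a ∈ F, ∃ w0, w = a.2 :: w0 ∧ C k w0),
      (∀ t ∈ Set.Ioo (0:ℝ) 1, HasDerivAt g (fev F t * f t) t) ∧
      ∃ A : ℝ, ∀ t ∈ Set.Ioc (0:ℝ) (1/2), ‖g t‖ ≤ A * t := by
  induction F with
  | nil =>
    refine ⟨0, Submodule.zero_mem _, fun t _ => ?_, 0, fun t _ => by simp⟩
    have := hasDerivAt_const (𝕜 := ℝ) (F := ℂ) t 0
    convert! this using 1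
    simp [fev]
  | cons a F ih =>
    obtain ⟨g2, m2, d2, A2, b2⟩ := ih (fun x hx => hy x (List.mem_cons_of_mem _ hx))
    obtain ⟨g1, m1, d1, A1, b1⟩ := Sp_prim a.2 (hy a List.mem_cons_self)
      (Submodule.smul_mem _ a.1 hf)
    refine ⟨g1 + g2, Submodule.add_mem _ (Sp_mono ?_ m1) (Sp_mono ?_ m2), fun t ht => ?_,
      A1 + A2, fun t ht => ?_⟩
    · rintro k w ⟨w0, rfl, h⟩
      exact ⟨a, List.mem_cons_self, w0, rfl, h⟩
    · rintro k w ⟨a', ha', h⟩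
      exact ⟨a', List.mem_cons_of_mem _ ha', h⟩
    · convert! (d1 t ht).add (d2 t ht) using 1
      simp only [Pi.smul_apply, qsmul_eq, fev, List.map_cons, List.sum_cons]
      ring
    · refine (norm_add_le _ _).trans ?_
      have := b1 t ht
      have := b2 t ht
      linarith

lemma tendsto_of_bound {g : ℝ → ℂ} {A : ℝ} (h : ∀ t ∈ Set.Ioc (0:ℝ) (1/2), ‖g t‖ ≤ A * t) :
    Tendsto g (𝓝[>] 0) (𝓝 0) := by
  have h2 : Tendsto (fun t : ℝ => A * t) (𝓝[>] 0) (𝓝 0) := by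
    have : Tendsto (fun t : ℝ => A * t) (𝓝 0) (𝓝 (A * 0)) :=
      (continuous_const.mul continuous_id).tendsto 0
    rw [mul_zero] at this
    exact this.mono_left nhdsWithin_le_nhds
  refine squeeze_zero_norm' ?_ h2
  filter_upwards [Ioc_mem_nhdsGT (show (0:ℝ) < 1/2 by norm_num)] with t ht using h t ht

lemma Sp_lim {C : ℕ → List Ltr → Prop} (hC : ∀ k w, C k w → Adm w) {f : ℝ → ℂ}
    (hf : f ∈ Sp C) : ∃ l ∈ SV C, Tendsto f (𝓝[<] 1) (𝓝 l) := by
  unfold Sp at hf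
  induction hf using Submodule.span_induction with
  | mem f hf =>
    obtain ⟨k, w, h, rfl⟩ := hf
    exact ⟨dd ^ k * val w, Submodule.subset_span ⟨k, w, h, rfl⟩,
      (Lf_tendsto (hC k w h)).const_mul _⟩
  | zero => exact ⟨0, Submodule.zero_mem _, tendsto_const_nhds⟩
  | add f1 f2 _ _ h1 h2 =>
    obtain ⟨l1, m1, t1⟩ := h1
    obtain ⟨l2, m2, t2⟩ := h2
    exact ⟨_, Submodule.add_mem _ m1 m2, t1.add t2⟩
  | smul a f _ h =>
    obtain ⟨l, m, t⟩ := h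
    refine ⟨_, Submodule.smul_mem _ a m, ?_⟩
    have := t.const_mul (a : ℂ)
    rw [qsmul_eq]
    refine this.congr fun s => ?_
    simp [qsmul_eq]

lemma const_of_deriv {a b : ℝ} {h : ℝ → ℂ} (hd : ∀ t ∈ Set.Ioo a b, HasDerivAt h 0 t) :
    ∃ c, ∀ t ∈ Set.Ioo a b, h t = c := by
  obtain ⟨c, hc⟩ := isOpen_Ioo.exists_is_const_of_deriv_eq_zero isPreconnected_Ioo
    (f := h) (s := Set.Ioo a b)
    (fun t ht => (hd t ht).differentiableAt.differentiableWithinAt) (fun t ht => (hd t ht).deriv)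
  exact ⟨c, hc⟩

lemma eq_of_deriv {f g F : ℝ → ℂ} (hf : ∀ t ∈ Set.Ioo (0:ℝ) 1, HasDerivAt f (F t) t)
    (hg : ∀ t ∈ Set.Ioo (0:ℝ) 1, HasDerivAt g (F t) t) {l : ℂ}
    (hf0 : Tendsto f (𝓝[>] 0) (𝓝 l)) (hg0 : Tendsto g (𝓝[>] 0) (𝓝 l)) :
    ∀ t ∈ Set.Ioo (0:ℝ) 1, f t = g t := by
  obtain ⟨c, hc⟩ := const_of_deriv (a := 0) (b := 1) (h := fun t => f t - g t)
    (fun t ht => by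
      have h0 := (hf t ht).sub (hg t ht)
      rw [sub_self] at h0
      exact h0)
  have h1 : Tendsto (fun t => f t - g t) (𝓝[>] 0) (𝓝 (l - l)) := hf0.sub hg0
  have h2 : Tendsto (fun t => f t - g t) (𝓝[>] 0) (𝓝 c) := by
    refine tendsto_const_nhds.congr' ?_
    filter_upwards [Ioo_mem_nhdsGT (show (0:ℝ) < 1 by norm_num)] with t ht using (hc t ht).symm
  have : c = 0 := by rw [tendsto_nhds_unique h2 h1, sub_self]
  intro t ht
  have := hc t ht
  subst c
  exact sub_eq_zero.mp (by assumption)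

lemma tendsto_congr_Ioo {f g : ℝ → ℂ} (h : ∀ t ∈ Set.Ioo (0:ℝ) 1, f t = g t) {l : ℂ}
    (hf : Tendsto f (𝓝[<] 1) (𝓝 l)) : Tendsto g (𝓝[<] 1) (𝓝 l) := by
  refine hf.congr' ?_
  filter_upwards [Ioo_mem_nhdsLT (show (0:ℝ) < 1 by norm_num)] with t ht using h t ht

/-- The words occurring in the shuffle product. -/
def ShC (w w' : List Ltr) (k : ℕ) (v : List Ltr) : Prop :=
  k = 0 ∧ Good v ∧ v.length = w.length + w'.length ∧ nz v = nz w + nz w' ∧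
    (v.head? = w.head? ∨ v.head? = w'.head?)

lemma shuffle_aux (n : ℕ) : ∀ w w' : List Ltr, w.length + w'.length = n → Good w → Good w' →
    ∃ g ∈ Sp (ShC w w'), ∀ t ∈ Set.Ioo (0:ℝ) 1, Lf w t * Lf w' t = g t := by
  induction n with
  | zero =>
    intro w w' h hw hw'
    have h1 : w = [] := List.length_eq_zero_iff.mp (by omega)
    have h2 : w' = [] := List.length_eq_zero_iff.mp (by omega)
    subst h1 h2
    refine ⟨_, Sp_mem (k := 0) (w := []) ⟨rfl, trivial, rfl, rfl, Or.inl rfl⟩, fun t _ => ?_⟩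
    simp [Lf_nil]
  | succ n ih =>
    intro w w' h hw hw'
    rcases w with _ | ⟨x, w⟩
    · refine ⟨_, Sp_mem (k := 0) (w := w') ⟨rfl, hw', by simp, by simp [nz], Or.inr rfl⟩,
        fun t _ => ?_⟩
      simp [Lf_nil]
    rcases w' with _ | ⟨y, w'⟩
    · refine ⟨_, Sp_mem (k := 0) (w := x :: w) ⟨rfl, hw, by simp, by simp [nz], Or.inl rfl⟩,
        fun t _ => ?_⟩
      simp [Lf_nil]
    simp only [List.length_cons] at h
    obtain ⟨g1, m1, e1⟩ := ih w (y :: w') (by simp; omega) hw.2 hw'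
    obtain ⟨g2, m2, e2⟩ := ih (x :: w) w' (by simp; omega) hw hw'.2
    have ne1 : ∀ k v, ShC w (y :: w') k v → v ≠ [] := by
      rintro k v ⟨_, _, h, _⟩ rfl; simp at h
    have ne2 : ∀ k v, ShC (x :: w) w' k v → v ≠ [] := by
      rintro k v ⟨_, _, h, _⟩ rfl; simp at h; omega
    obtain ⟨G1, M1, D1, A1, B1⟩ := Sp_prim x (fun _ => ne1) m1
    obtain ⟨G2, M2, D2, A2, B2⟩ := Sp_prim y (fun _ => ne2) m2
    refine ⟨G1 + G2, Submodule.add_mem _ (Sp_mono ?_ M1) (Sp_mono ?_ M2), ?_⟩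
    · rintro k v ⟨v0, rfl, rfl, hg, hl, hn, hh⟩
      refine ⟨rfl, ⟨fun _ => ne1 0 v0 ⟨rfl, hg, hl, hn, hh⟩, hg⟩, ?_, ?_, Or.inl rfl⟩
      · simp at hl ⊢; omega
      · simp only [nz] at hn ⊢; omega
    · rintro k v ⟨v0, rfl, rfl, hg, hl, hn, hh⟩
      refine ⟨rfl, ⟨fun _ => ne2 0 v0 ⟨rfl, hg, hl, hn, hh⟩, hg⟩, ?_, ?_, Or.inr rfl⟩
      · simp at hl ⊢; omega
      · simp only [nz] at hn ⊢; omega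
    · refine eq_of_deriv (l := 0) (F := fun t => g1 t / ((t:ℂ) - x.v) + g2 t / ((t:ℂ) - y.v))
        (fun t ht => ?_) (fun t ht => (D1 t ht).add (D2 t ht)) ?_ ?_
      · convert! (hasDerivAt_Lf x w hw.1 ht.1 ht.2).mul (hasDerivAt_Lf y w' hw'.1 ht.1 ht.2) using 1
        rw [← e1 t ht, ← e2 t ht]; ring
      · simpa using (Lf_tendsto_zero x w).mul (Lf_tendsto_zero y w')
      · have := (tendsto_of_bound B1).add (tendsto_of_bound B2)
        rw [add_zero] at this
        exact this

/-- Weight `K` and depth at most `s` span. -/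
noncomputable def Zw (K s : ℕ) : Submodule ℚ ℂ :=
  Submodule.span ℚ {v | ∃ w, Good w ∧ Adm w ∧ w.length = K ∧ nz w ≤ s ∧ v = val w}

lemma val_mem_Zw {K s : ℕ} {w : List Ltr} (h1 : Good w) (h2 : Adm w) (h3 : w.length = K)
    (h4 : nz w ≤ s) : val w ∈ Zw K s := Submodule.subset_span ⟨w, h1, h2, h3, h4, rfl⟩

lemma Zw_mono {K s s' : ℕ} (h : s ≤ s') : Zw K s ≤ Zw K s' := by
  apply Submodule.span_mono
  rintro v ⟨w, h1, h2, h3, h4, rfl⟩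
  exact ⟨w, h1, h2, h3, h4.trans h, rfl⟩

lemma val_mul {w w' : List Ltr} (h1 : Good w) (h1' : Good w') (h2 : Adm w) (h2' : Adm w') :
    val w * val w' ∈ Zw (w.length + w'.length) (nz w + nz w') := by
  obtain ⟨g, m, e⟩ := shuffle_aux _ w w' rfl h1 h1'
  have hadm : ∀ k v, ShC w w' k v → Adm v := by
    rintro k v ⟨_, _, _, _, h⟩
    rw [adm_iff] at *
    rcases h with h | h <;> rw [h] <;> assumption
  obtain ⟨l, ml, tl⟩ := Sp_lim hadm m
  have t2 := tendsto_congr_Ioo e ((Lf_tendsto h2).mul (Lf_tendsto h2'))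
  rw [tendsto_nhds_unique t2 tl]
  refine Submodule.span_mono ?_ ml
  rintro v ⟨k, u, hu, rfl⟩
  have ha := hadm k u hu
  obtain ⟨rfl, hg, hl, hn, _⟩ := hu
  exact ⟨u, hg, ha, hl, hn.le, by simp⟩

lemma Zw_mul {K s K' s' : ℕ} {a b : ℂ} (ha : a ∈ Zw K s) (hb : b ∈ Zw K' s') :
    a * b ∈ Zw (K + K') (s + s') := by
  unfold Zw at ha
  induction ha using Submodule.span_induction with
  | mem a ha =>
    obtain ⟨w, h1, h2, rfl, h4, rfl⟩ := ha
    unfold Zw at hb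
    induction hb using Submodule.span_induction with
    | mem b hb =>
      obtain ⟨w', h1', h2', rfl, h4', rfl⟩ := hb
      exact Zw_mono (by omega) (val_mul h1 h1' h2 h2')
    | zero => simp
    | add b1 b2 _ _ i1 i2 => rw [mul_add]; exact Submodule.add_mem _ i1 i2
    | smul q b _ i => rw [mul_smul_comm]; exact Submodule.smul_mem _ _ i
  | zero => simp
  | add b1 b2 _ _ i1 i2 => rw [add_mul]; exact Submodule.add_mem _ i1 i2
  | smul q b _ i => rw [smul_mul_assoc]; exact Submodule.smul_mem _ _ i

lemma one_mem_Zw (s : ℕ) : (1:ℂ) ∈ Zw 0 s := by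
  rw [← val_nil]
  exact val_mem_Zw trivial adm_nil rfl (by simp [nz])

/-- Insertions of a letter into a word. -/
def ins (x : Ltr) : List Ltr → List (List Ltr)
  | [] => [[x]]
  | y :: w => (x :: y :: w) :: (ins x w).map (y :: ·)

lemma Lf_sum_deriv (l : List (List Ltr)) (y : Ltr) (hy : y ≠ .z) {t : ℝ} (ht : t ∈ Set.Ioo (0:ℝ) 1) :
    HasDerivAt (fun t => ((l.map (y :: ·)).map fun w => Lf w t).sum)
      ((l.map fun w => Lf w t).sum / ((t:ℂ) - y.v)) t := by
  induction l with
  | nil => simpa using hasDerivAt_const (𝕜 := ℝ) (F := ℂ) t 0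
  | cons w l ih =>
    simp only [List.map_cons, List.sum_cons]
    convert! (hasDerivAt_Lf y w (fun h => absurd h hy) ht.1 ht.2).add ih using 1
    ring

lemma Lf_sum_zero (l : List (List Ltr)) (h : ∀ w ∈ l, w ≠ []) :
    Tendsto (fun t => (l.map fun w => Lf w t).sum) (𝓝[>] 0) (𝓝 0) := by
  induction l with
  | nil => simp
  | cons w l ih =>
    simp only [List.map_cons, List.sum_cons]
    rcases w with _ | ⟨x, w⟩
    · exact absurd rfl (h _ List.mem_cons_self)
    have := (Lf_tendsto_zero x w).add (ih fun w hw => h w (List.mem_cons_of_mem _ hw))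
    rwa [add_zero] at this

lemma ins_ne (x : Ltr) (w : List Ltr) : ∀ v ∈ ins x w, v ≠ [] := by
  cases w with
  | nil => simp [ins]
  | cons y w => simp [ins]

lemma Lf_ins (x : Ltr) (hx : x ≠ .z) (w : List Ltr) (hw : Ltr.z ∉ w) :
    ∀ t ∈ Set.Ioo (0:ℝ) 1, Lf [x] t * Lf w t = ((ins x w).map fun v => Lf v t).sum := by
  induction w with
  | nil => intro t _; simp [ins, Lf_nil]
  | cons y w ih =>
    simp only [List.mem_cons, not_or] at hw
    have hy : y ≠ .z := fun h => hw.1 h.symm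
    have ih := ih hw.2
    refine eq_of_deriv (l := 0) (F := fun t => Lf (y :: w) t / ((t:ℂ) - x.v) +
      ((ins x w).map fun v => Lf v t).sum / ((t:ℂ) - y.v)) (fun t ht => ?_) (fun t ht => ?_) ?_ ?_
    · convert! (hasDerivAt_Lf x [] (fun h => absurd h hx) ht.1 ht.2).mul
        (hasDerivAt_Lf y w (fun h => absurd h hy) ht.1 ht.2) using 1
      rw [← ih t ht, Lf_nil]; ring
    · simp only [ins, List.map_cons, List.sum_cons]
      exact (hasDerivAt_Lf x (y :: w) (fun h => absurd h hx) ht.1 ht.2).add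
        (Lf_sum_deriv _ y hy ht)
    · simpa using (Lf_tendsto_zero x []).mul (Lf_tendsto_zero y w)
    · exact Lf_sum_zero _ (ins_ne x (y :: w))

lemma Lf_sum_tendsto (l : List (List Ltr)) (h : ∀ w ∈ l, Adm w) :
    Tendsto (fun t => (l.map fun w => Lf w t).sum) (𝓝[<] 1) (𝓝 (l.map val).sum) := by
  induction l with
  | nil => simp
  | cons w l ih =>
    simp only [List.map_cons, List.sum_cons]
    exact (Lf_tendsto (h w List.mem_cons_self)).add (ih fun w hw => h w (List.mem_cons_of_mem _ hw))

lemma ins_adm {x : Ltr} (hx : x ≠ .p) {w : List Ltr} (hw : Adm w) : ∀ v ∈ ins x w, Adm v := by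
  cases w with
  | nil => simp [ins, adm_cons, hx]
  | cons y w =>
    have := adm_cons.mp hw
    simp [ins, adm_cons, hx, this]

lemma val_ins {x : Ltr} (hx : x ≠ .z) (hp : x ≠ .p) {w : List Ltr} (hw : Ltr.z ∉ w) (ha : Adm w) :
    val [x] * val w = ((ins x w).map val).sum := by
  have t1 := (Lf_tendsto (adm_cons.mpr hp : Adm [x])).mul (Lf_tendsto ha)
  exact tendsto_nhds_unique (tendsto_congr_Ioo (Lf_ins x hx w hw) t1)
    (Lf_sum_tendsto _ (ins_adm hp ha))

lemma ins_replicate (x : Ltr) (n : ℕ) (w : List Ltr) : ((ins x (List.replicate n x ++ w)).map val).sum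
    = n * val (List.replicate (n+1) x ++ w)
      + (((ins x w).map (List.replicate n x ++ ·)).map val).sum := by
  have key : ∀ (f : List Ltr → ℂ) (n : ℕ), ((ins x (List.replicate n x ++ w)).map f).sum
    = n * f (List.replicate (n+1) x ++ w)
      + (((ins x w).map (List.replicate n x ++ ·)).map f).sum := by
    intro f n
    induction n generalizing f with
    | zero => simp
    | succ n ih =>
      simp only [List.replicate_succ, List.cons_append, ins, List.map_cons, List.sum_cons,
        List.map_map]
      have := ih (f ∘ (x :: ·))
      simp only [List.replicate_succ, List.cons_append, List.map_map] at this
      rw [this]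
      simp only [Function.comp_def]
      push_cast
      ring
  exact key val n

lemma val_pow {x : Ltr} (hx : x ≠ .z) (hp : x ≠ .p) (n : ℕ) :
    val [x] ^ n = n.factorial * val (List.replicate n x) := by
  induction n with
  | zero => simp [val_nil]
  | succ n ih =>
    have ha : Adm (List.replicate n x) := by
      cases n with
      | zero => exact adm_nil
      | succ n => exact adm_cons.mpr hp
    have h1 := val_ins hx hp (w := List.replicate n x)
      (by intro h; exact hx (List.eq_of_mem_replicate h).symm) ha
    have h2 := ins_replicate x n []
    simp only [List.append_nil] at h2
    rw [h2] at h1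
    simp only [ins, List.map_cons, List.map_nil, List.sum_cons, List.sum_nil] at h1
    rw [← List.replicate_succ'] at h1
    rw [pow_succ', ih, Nat.factorial_succ]
    push_cast
    linear_combination (n.factorial : ℂ) * h1

end MU4

open Filter Topology

namespace MU4

lemma val_b_sub_c : val [.b] - val [.c] = dd := by
  have h : ∀ t ∈ Set.Ioo (0:ℝ) 1, Lf [.b] t - Lf [.c] t = 2 * Complex.I * (Real.arctan t : ℂ) := by
    refine eq_of_deriv (l := 0) (F := fun t => 2 * Complex.I * ((1 / (1 + t ^ 2) : ℝ) : ℂ))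
      (fun t ht => ?_) (fun t ht => ?_) ?_ ?_
    · convert! (hasDerivAt_Lf .b [] (by simp) ht.1 ht.2).sub
        (hasDerivAt_Lf .c [] (by simp) ht.1 ht.2) using 1
      simp only [Lf_nil, Ltr.v]
      have h1 : (t:ℂ) - Complex.I ≠ 0 := by
        intro h; have := congrArg Complex.im h; simp at this
      have h2 : (t:ℂ) - -Complex.I ≠ 0 := by
        intro h; have := congrArg Complex.im h; simp at this
      have h3 : (1:ℂ) + t ^ 2 ≠ 0 := by
        have : (1:ℂ) + t ^ 2 = ((1 + t ^ 2 : ℝ) : ℂ) := by push_cast; ring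
        rw [this]; exact_mod_cast (by positivity : (1 + t^2 : ℝ) ≠ 0)
      push_cast
      rw [div_sub_div _ _ h1 h2, mul_one_div, div_eq_div_iff h3 (mul_ne_zero h1 h2)]
      linear_combination (2 * Complex.I) * (-Complex.I_sq)
    · exact ((Real.hasDerivAt_arctan t).ofReal_comp).const_mul (2 * Complex.I)
    · simpa using (Lf_tendsto_zero .b []).sub (Lf_tendsto_zero .c [])
    · have h1 : Continuous fun t : ℝ => 2 * Complex.I * (Real.arctan t : ℂ) := by fun_prop
      have := (h1.tendsto 0).mono_left (nhdsWithin_le_nhds (s := Set.Ioi 0))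
      simpa using this
  have t1 := (Lf_tendsto (adm_cons.mpr (by simp) : Adm [.b])).sub
    (Lf_tendsto (adm_cons.mpr (by simp) : Adm [.c]))
  have h1 : Continuous fun t : ℝ => 2 * Complex.I * (Real.arctan t : ℂ) := by fun_prop
  have t2 := (h1.tendsto 1).mono_left (nhdsWithin_le_nhds (s := Set.Iio 1))
  rw [tendsto_nhds_unique (tendsto_congr_Ioo h t1) t2, Real.arctan_one, dd]
  push_cast
  ring

lemma val_zp : val [.z, .p] = -((Real.pi ^ 2 / 6 : ℝ) : ℂ) := by
  have h := hasSum_zeta_two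
  have h2 : HasSum (fun n : ℕ => -(((1 / (n:ℝ) ^ 2 : ℝ)) : ℂ)) (-((Real.pi ^ 2 / 6 : ℝ) : ℂ)) :=
    (Complex.hasSum_ofReal.mpr h).neg
  have h3 : cf [.z, .p] = fun n : ℕ => -(((1 / (n:ℝ) ^ 2 : ℝ)) : ℂ) := by
    ext n
    rw [cf_z, cf_nz (by simp)]
    rcases n with _ | n
    · simp
    · have : ∑ m ∈ Finset.range (n+1), cf [] m * Ltr.p.v ^ m = 1 := by
        rw [Finset.sum_range_succ']
        simp [cf]
      rw [this]
      simp only [Ltr.v]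
      push_cast
      field_simp
      simp
  have := h2.tendsto_sum_nat
  rw [← h3] at this
  exact tendsto_nhds_unique (val_spec (adm_cons.mpr (by simp))) this

lemma dd_sq : dd ^ 2 = ((3 / 2 : ℚ) : ℂ) * val [.z, .p] := by
  rw [val_zp, dd]
  push_cast
  ring_nf
  rw [Complex.I_sq]
  ring

lemma dd_sq_mem : dd ^ 2 ∈ Zw 2 1 := by
  rw [dd_sq, ← qsmul_eq]
  refine Submodule.smul_mem _ _ (val_mem_Zw ?_ (adm_cons.mpr (by simp)) rfl (by simp [nz]))
  simp [Good]

lemma unit_val_mem {x : Ltr} (h : x ≠ .z) (hp : x ≠ .p) : val [x] ∈ Zw 1 1 := by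
  refine val_mem_Zw ?_ (adm_cons.mpr hp) rfl (by simp [nz, h])
  simp [Good, h]

lemma dd_mem : dd ∈ Zw 1 1 := by
  rw [← val_b_sub_c]
  exact Submodule.sub_mem _ (unit_val_mem (by simp) (by simp)) (unit_val_mem (by simp) (by simp))

lemma pow_mem_Zw {a : ℂ} (h : a ∈ Zw 1 1) (n : ℕ) : a ^ n ∈ Zw n n := by
  induction n with
  | zero => rw [pow_zero]; exact one_mem_Zw 0
  | succ n ih => rw [pow_succ]; exact Zw_mul ih h

lemma dd_pow_mem {n : ℕ} (h : 2 ≤ n) : dd ^ n ∈ Zw n (n - 1) := by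
  obtain ⟨m, rfl⟩ := Nat.exists_eq_add_of_le h
  rw [pow_add, show 2 + m - 1 = 1 + m by omega]
  exact Zw_mul dd_sq_mem (pow_mem_Zw dd_mem m)

/-- The number `val [b]`. -/
noncomputable def XX : ℂ := val [.b]

lemma XX_mem : XX ∈ Zw 1 1 := unit_val_mem (by simp) (by simp)

/-- The target module. -/
noncomputable def VV (r : ℕ) : Submodule ℚ ℂ :=
  Zw r (r - 1) ⊔ Submodule.span ℚ {XX ^ r, XX ^ (r - 1) * dd}

lemma Zw_le_VV (r : ℕ) : Zw r (r - 1) ≤ VV r := le_sup_left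

lemma XX_pow_VV (r : ℕ) : XX ^ r ∈ VV r :=
  Submodule.mem_sup_right (Submodule.subset_span (by simp))

lemma XX_dd_VV (r : ℕ) : XX ^ (r - 1) * dd ∈ VV r :=
  Submodule.mem_sup_right (Submodule.subset_span (by simp))

lemma mem_VV {r : ℕ} {v : ℂ} : v ∈ VV r ↔
    ∃ e ∈ Zw r (r-1), ∃ a b : ℚ, v = e + (a * XX ^ r + b * (XX ^ (r-1) * dd)) := by
  unfold VV
  rw [Submodule.mem_sup]
  constructor
  · rintro ⟨e, he, y, hy, rfl⟩
    obtain ⟨a, b, rfl⟩ := Submodule.mem_span_pair.mp hy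
    exact ⟨e, he, a, b, by simp only [qsmul_eq]⟩
  · rintro ⟨e, he, a, b, rfl⟩
    exact ⟨e, he, _, Submodule.mem_span_pair.mpr ⟨a, b, rfl⟩, by simp only [qsmul_eq]⟩

lemma VV_le_Zw {r : ℕ} (hr : 1 ≤ r) : VV r ≤ Zw r r := by
  unfold VV
  refine sup_le (Zw_mono (by omega)) ?_
  rw [Submodule.span_le]
  rintro v (rfl | rfl)
  · exact pow_mem_Zw XX_mem r
  · obtain ⟨m, rfl⟩ := Nat.exists_eq_add_of_le' hr
    exact Zw_mul (pow_mem_Zw XX_mem _) dd_mem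

lemma VV_mul {m n : ℕ} (hm : 1 ≤ m) (hn : 1 ≤ n) {u v : ℂ} (hu : u ∈ VV m) (hv : v ∈ VV n) :
    u * v ∈ VV (m + n) := by
  have hu' := VV_le_Zw hm hu
  obtain ⟨e', he', a', b', rfl⟩ := mem_VV.mp hv
  obtain ⟨e, he, a, b, rfl⟩ := mem_VV.mp hu
  obtain ⟨m, rfl⟩ := Nat.exists_eq_add_of_le' hm
  obtain ⟨n, rfl⟩ := Nat.exists_eq_add_of_le' hn
  simp only [Nat.add_sub_cancel] at *
  have k1 : (e + (a * XX ^ (m+1) + b * (XX ^ m * dd))) * e' ∈ Zw (m+1+(n+1)) (m+1+(n+1)-1) := by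
    have := Zw_mul hu' he'
    rwa [show m + 1 + n = m+1+(n+1)-1 by omega] at this
  have p2 : (a' * XX ^ (n+1) + b' * (XX ^ n * dd)) ∈ Zw (n+1) (n+1) := by
    rw [← qsmul_eq, ← qsmul_eq]
    exact Submodule.add_mem _ (Submodule.smul_mem _ _ (pow_mem_Zw XX_mem _))
      (Submodule.smul_mem _ _ (Zw_mul (pow_mem_Zw XX_mem _) dd_mem))
  have k2 : e * (a' * XX ^ (n+1) + b' * (XX ^ n * dd)) ∈ Zw (m+1+(n+1)) (m+1+(n+1)-1) := by
    have := Zw_mul he p2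
    rwa [show m + (n+1) = m+1+(n+1)-1 by omega] at this
  have k3 : XX ^ m * XX ^ n * dd ^ 2 ∈ Zw (m+1+(n+1)) (m+1+(n+1)-1) := by
    have := Zw_mul (Zw_mul (pow_mem_Zw XX_mem m) (pow_mem_Zw XX_mem n)) dd_sq_mem
    rwa [show m + n + 2 = m+1+(n+1) by omega, show m + n + 1 = m+1+(n+1)-1 by omega] at this
  refine mem_VV.mpr ⟨(e + (a * XX ^ (m+1) + b * (XX ^ m * dd))) * e' +
    e * (a' * XX ^ (n+1) + b' * (XX ^ n * dd)) + (b * b' : ℚ) • (XX ^ m * XX ^ n * dd ^ 2),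
    Submodule.add_mem _ (Submodule.add_mem _ k1 k2) (Submodule.smul_mem _ _ k3),
    a * a', a * b' + b * a', ?_⟩
  rw [qsmul_eq, show m + 1 + (n+1) - 1 = m + n + 1 by omega]
  push_cast
  ring

/-- Expansion of a word under `t ↦ t ^ 2`. -/
def ex : List Ltr → List (List Ltr)
  | [] => [[]]
  | .p :: w => (ex w).map (.p :: ·) ++ (ex w).map (.q :: ·)
  | _ :: w => (ex w).map (.b :: ·) ++ (ex w).map (.c :: ·)

lemma Lf_ex (w : List Ltr) (hw : ∀ x ∈ w, x = .p ∨ x = .q) :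
    ∀ t ∈ Set.Ioo (0:ℝ) 1, Lf w (t ^ 2) = ((ex w).map fun v => Lf v t).sum := by
  induction w with
  | nil => intro t _; simp [ex, Lf_nil]
  | cons x w ih =>
    have ih := ih fun y hy => hw y (List.mem_cons_of_mem _ hy)
    have hx := hw x List.mem_cons_self
    have hxz : x ≠ .z := by rcases hx with rfl | rfl <;> simp
    have sq : ∀ t ∈ Set.Ioo (0:ℝ) 1, t ^ 2 ∈ Set.Ioo (0:ℝ) 1 := by
      intro t ht; constructor <;> nlinarith [ht.1, ht.2]
    have ineI : ∀ t : ℝ, (t:ℂ) - Complex.I ≠ 0 := by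
      intro t h; have := congrArg Complex.im h; simp at this
    have ineI' : ∀ t : ℝ, (t:ℂ) + Complex.I ≠ 0 := by
      intro t h; have := congrArg Complex.im h; simp at this
    refine eq_of_deriv (l := 0) (F := fun t => Lf w (t ^ 2) / (((t ^ 2 : ℝ) : ℂ) - x.v) * (2 * t))
      (fun t ht => ?_) (fun t ht => ?_) ?_ ?_
    · have h1 := hasDerivAt_Lf x w (fun h => absurd h hxz) (sq t ht).1 (sq t ht).2
      have h2 : HasDerivAt (fun t : ℝ => t ^ 2) (2 * t) t := by simpa using hasDerivAt_pow 2 t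
      have := HasDerivAt.scomp (h := fun t : ℝ => t ^ 2) t h1 h2
      convert! this using 1
      simp [mul_comm]
    · have ne1 : (t:ℂ) - 1 ≠ 0 := by
        rw [sub_ne_zero]; exact_mod_cast ht.2.ne
      have ne2 : (t:ℂ) + 1 ≠ 0 := by
        exact_mod_cast (by linarith [ht.1] : t + 1 ≠ 0)
      rcases hx with rfl | rfl
      · simp only [ex, List.map_append, List.sum_append]
        convert! (Lf_sum_deriv (ex w) .p (by simp) ht).add (Lf_sum_deriv (ex w) .q (by simp) ht)
          using 1
        rw [← ih t ht]
        simp only [Ltr.v, sub_neg_eq_add]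
        push_cast
        rw [show (t:ℂ)^2 - 1 = (t-1)*(t+1) by ring]
        field_simp
        ring
      · simp only [ex, List.map_append, List.sum_append]
        convert! (Lf_sum_deriv (ex w) .b (by simp) ht).add (Lf_sum_deriv (ex w) .c (by simp) ht)
          using 1
        rw [← ih t ht]
        simp only [Ltr.v, sub_neg_eq_add]
        push_cast
        have := ineI t
        have := ineI' t
        rw [show (t:ℂ)^2 + 1 = (t-Complex.I)*(t+Complex.I) by
          linear_combination Complex.I_sq]
        field_simp
        ring
    · have h2 : Tendsto (fun t : ℝ => t ^ 2) (𝓝[>] 0) (𝓝[>] 0) := by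
        refine tendsto_nhdsWithin_iff.mpr ⟨?_, ?_⟩
        · have : Continuous fun t : ℝ => t ^ 2 := by fun_prop
          have := (this.tendsto 0).mono_left (nhdsWithin_le_nhds (s := Set.Ioi 0))
          simpa using this
        · filter_upwards [self_mem_nhdsWithin] with t ht
          have : 0 < t := ht
          simp; positivity
      exact (Lf_tendsto_zero x w).comp h2
    · apply Lf_sum_zero
      rcases hx with rfl | rfl <;> simp [ex] <;> grind

lemma val_ex (w : List Ltr) (hw : ∀ x ∈ w, x = .p ∨ x = .q) :
    val (.q :: w) = ((ex (.q :: w)).map val).sum := by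
  have h := Lf_ex (.q :: w) (by simpa using hw)
  have h2 : Tendsto (fun t : ℝ => t ^ 2) (𝓝[<] 1) (𝓝[<] 1) := by
    refine tendsto_nhdsWithin_iff.mpr ⟨?_, ?_⟩
    · have : Continuous fun t : ℝ => t ^ 2 := by fun_prop
      have := (this.tendsto 1).mono_left (nhdsWithin_le_nhds (s := Set.Iio 1))
      simpa using this
    · filter_upwards [Ioo_mem_nhdsLT (show (0:ℝ) < 1 by norm_num)] with t ht
      simp only [Set.mem_Iio]
      nlinarith [ht.1, ht.2]
  have t1 := (Lf_tendsto (adm_cons.mpr (by simp) : Adm (.q :: w))).comp h2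
  refine tendsto_nhds_unique (tendsto_congr_Ioo h t1) (Lf_sum_tendsto _ ?_)
  intro v hv
  simp only [ex, List.mem_append, List.mem_map] at hv
  rcases hv with ⟨u, _, rfl⟩ | ⟨u, _, rfl⟩ <;> exact adm_cons.mpr (by simp)

lemma val_q : val [.q] = 2 * XX - dd := by
  have := val_ex [] (by simp)
  simp only [ex, List.map_cons, List.map_nil, List.singleton_append, List.sum_cons, List.sum_nil] at this
  rw [this, ← val_b_sub_c, XX]
  ring

end MU4

open Filter Topology

namespace MU4

/-- Nested sums attached to a list of exponents and roots of unity (head is outermost). -/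
noncomputable def SS : List (ℕ × ℂ) → ℕ → ℂ
  | [], _ => 1
  | a :: l, M => ∑ n ∈ Finset.Icc 1 M, a.2 ^ n / (n : ℂ) ^ a.1 * SS l (n - 1)

/-- Conversion of words into indices. -/
noncomputable def conv : List Ltr → ℕ → ℂ → List (ℕ × ℂ)
  | [], _, _ => []
  | x :: w, k, y => if x = .z then conv w (k + 1) y else (k + 1, y / x.v) :: conv w 0 x.v

lemma sum_range_Icc (f : ℕ → ℂ) (h0 : f 0 = 0) (M : ℕ) :
    ∑ m ∈ Finset.range (M + 1), f m = ∑ m ∈ Finset.Icc 1 M, f m := by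
  rw [Finset.sum_range_succ', h0, add_zero]
  rw [Finset.sum_bij (fun i _ => i + 1)]
  · intro a ha; simp at ha ⊢; omega
  · intro a _ b _ h; omega
  · intro b hb
    simp at hb
    exact ⟨b - 1, by simp; omega, by omega⟩
  · intros; rfl

lemma SS_conv (w : List Ltr) : ∀ (k : ℕ) (y : ℂ) (M : ℕ), Good w → (w = [] → k = 0) →
    ∑ m ∈ Finset.range (M + 1), cf w m * y ^ m / (m : ℂ) ^ k = (-1) ^ nz w * SS (conv w k y) M := by
  induction w with
  | nil =>
    intro k y M _ hk
    rw [hk rfl, Finset.sum_range_succ']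
    simp [cf, conv, SS, nz]
  | cons x w ih =>
    intro k y M hg _
    by_cases hz : x = .z
    · subst hz
      simp only [conv, nz, if_true, zero_add]
      rw [← ih (k + 1) y M hg.2 (fun h => absurd h (hg.1 rfl))]
      refine Finset.sum_congr rfl fun m _ => ?_
      rw [cf_z, pow_succ]
      rw [div_mul_eq_mul_div, div_div, mul_comm (m:ℂ)]
    · simp only [conv, nz, if_neg hz, SS]
      rw [sum_range_Icc _ (by simp [cf_cons_zero]), Finset.mul_sum]
      refine Finset.sum_congr rfl fun m hm => ?_
      have hm1 : 1 ≤ m := (Finset.mem_Icc.mp hm).1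
      have := ih 0 x.v (m - 1) hg.2 (fun _ => rfl)
      rw [Nat.sub_add_cancel hm1] at this
      simp only [pow_zero, div_one] at this
      rw [cf_nz hz, this, pow_add, pow_one, pow_succ, div_pow]
      have hmc : (m:ℂ) ≠ 0 := by exact_mod_cast (by omega : m ≠ 0)
      have := Ltr.v_ne hz
      field_simp

lemma cmzv_zero (k : Fin 0 → ℕ) (ε : Fin 0 → ℂ) (M : ℕ) : cmzvPartial 0 k ε M = 1 := by
  unfold cmzvPartial
  rw [Finset.filter_true_of_mem (fun n _ i => Fin.elim0 i)]
  simp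

lemma cmzv_succ (r : ℕ) (k : Fin (r + 1) → ℕ) (ε : Fin (r + 1) → ℂ) (M : ℕ) :
    cmzvPartial (r + 1) k ε M = ∑ n ∈ Finset.Icc 1 M,
      ε (Fin.last r) ^ n / (n : ℂ) ^ k (Fin.last r) *
        cmzvPartial r (fun i => k i.castSucc) (fun i => ε i.castSucc) (n - 1) := by
  unfold cmzvPartial
  simp_rw [Finset.mul_sum]
  rw [Finset.sum_sigma']
  refine Finset.sum_bij' (fun n _ => ⟨n (Fin.last r), fun i => n i.castSucc⟩)
    (fun p _ => Fin.snoc (α := fun _ => ℕ) p.2 p.1) ?_ ?_ ?_ ?_ ?_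
  · intro n hn
    simp only [Finset.mem_filter, Fintype.mem_piFinset, Finset.mem_Icc, Finset.mem_sigma] at hn ⊢
    refine ⟨hn.1 _, fun i => ⟨(hn.1 _).1, ?_⟩, fun i j hij => hn.2 _ _ (by simpa using hij)⟩
    have := hn.2 i.castSucc (Fin.last r) (Fin.castSucc_lt_last i)
    omega
  · rintro ⟨m, n⟩ hn
    simp only [Finset.mem_filter, Fintype.mem_piFinset, Finset.mem_Icc, Finset.mem_sigma] at hn ⊢
    refine ⟨fun i => ?_, fun i j hij => ?_⟩
    · refine Fin.lastCases ?_ (fun i => ?_) i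
      · simpa using hn.1
      · have := hn.2.1 i
        simp; omega
    · induction j using Fin.lastCases with
      | last =>
        induction i using Fin.lastCases with
        | last => simp at hij
        | cast i =>
          have := hn.2.1 i
          simp; omega
      | cast j =>
        induction i using Fin.lastCases with
        | last => exact absurd hij (by simp [Fin.le_last, not_lt])
        | cast i =>
          simp
          exact hn.2.2 i j (by simpa using hij)
  · intro n hn
    ext i
    refine Fin.lastCases ?_ (fun i => ?_) i <;> simp
  · rintro ⟨m, n⟩ hn
    simp
  · intro n hn
    rw [Fin.prod_univ_castSucc, mul_comm]

/-- Exponents of a list, innermost first. -/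
def kk (l : List (ℕ × ℂ)) (i : Fin l.length) : ℕ := (l.get i.rev).1
/-- Roots of unity of a list, innermost first. -/
def ee (l : List (ℕ × ℂ)) (i : Fin l.length) : ℂ := (l.get i.rev).2

lemma SS_eq (l : List (ℕ × ℂ)) : ∀ M, cmzvPartial l.length (kk l) (ee l) M = SS l M := by
  induction l with
  | nil => intro M; exact cmzv_zero _ _ _
  | cons a l ih =>
    intro M
    refine (cmzv_succ l.length _ _ M).trans ?_
    simp only [SS]
    refine Finset.sum_congr rfl fun n _ => ?_
    rw [← ih]
    congr 1
    · simp [kk, ee]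
    · congr 1
      · ext i; simp [kk, Fin.rev_castSucc]
      · ext i; simp [ee, Fin.rev_castSucc]

lemma v_pow_four {x : Ltr} (h : x ≠ .z) : x.v ^ 4 = 1 := by
  cases x <;> simp_all [Ltr.v]
  all_goals norm_num [Even.neg_pow]

lemma conv_length (w : List Ltr) : ∀ k y, (conv w k y).length = nz w := by
  induction w with
  | nil => intros; rfl
  | cons x w ih =>
    intro k y
    simp only [conv, nz]
    split_ifs <;> simp [ih]
    omega

lemma conv_mem (w : List Ltr) : ∀ k y, y ^ 4 = 1 → ∀ a ∈ conv w k y, 1 ≤ a.1 ∧ a.2 ^ 4 = 1 := by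
  induction w with
  | nil => intro k y _ a ha; simp [conv] at ha
  | cons x w ih =>
    intro k y hy a ha
    by_cases hz : x = .z
    · simp only [conv, if_pos hz] at ha
      exact ih _ _ hy a ha
    · simp only [conv, if_neg hz, List.mem_cons] at ha
      rcases ha with rfl | ha
      · refine ⟨by simp, ?_⟩
        simp only [div_pow, hy, v_pow_four hz]; simp
      · exact ih _ _ (v_pow_four hz) a ha

lemma conv_sum (w : List Ltr) : ∀ k y, Good w → (w = [] → k = 0) →
    ((conv w k y).map Prod.fst).sum = w.length + k := by
  induction w with
  | nil => intro k y _ h; simp [conv, h rfl]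
  | cons x w ih =>
    intro k y hg _
    by_cases hz : x = .z
    · simp only [conv, if_pos hz]
      rw [ih _ _ hg.2 (fun h => absurd h (hg.1 hz))]
      simp; omega
    · simp only [conv, if_neg hz, List.map_cons, List.sum_cons]
      rw [ih _ _ hg.2 (fun _ => rfl)]
      simp; omega

lemma conv_head (w : List Ltr) : ∀ k y a l, conv w k y = a :: l → k + 1 ≤ a.1 := by
  induction w with
  | nil => intro k y a l h; simp [conv] at h
  | cons x w ih =>
    intro k y a l h
    by_cases hz : x = .z
    · simp only [conv, if_pos hz] at h
      have := ih _ _ _ _ h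
      omega
    · simp only [conv, if_neg hz] at h
      rw [← (List.cons.inj h).1]

lemma nz_pos {w : List Ltr} (hg : Good w) (h : w ≠ []) : 1 ≤ nz w := by
  induction w with
  | nil => exact absurd rfl h
  | cons x w ih =>
    simp only [nz]
    split_ifs with hz
    · have := ih hg.2 (hg.1 hz); omega
    · omega

lemma sum_kk (l : List (ℕ × ℂ)) : ∑ i, kk l i = (l.map Prod.fst).sum := by
  unfold kk
  refine (Equiv.sum_comp Fin.revPerm (fun i => (l.get i).1)).trans ?_
  rw [← List.sum_ofFn]
  congr 1
  conv_rhs => rw [← List.ofFn_get l]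
  rw [List.map_ofFn]
  rfl

lemma val_isCMZV {w : List Ltr} (hg : Good w) (ha : Adm w) (hne : w ≠ []) :
    IsCMZV 4 w.length (nz w) ((-1) ^ nz w * val w) := by
  have hl := conv_length w 0 1
  have hpos := nz_pos hg hne
  suffices ∀ l : List (ℕ × ℂ), l = conv w 0 1 → IsCMZV 4 w.length l.length ((-1) ^ nz w * val w) by
    have := this _ rfl
    rwa [hl] at this
  intro l hlc
  have hl1 : 1 ≤ l.length := by rw [hlc]; omega
  refine ⟨hl1, kk l, ee l, fun i => ?_, fun i => ?_, ?_, ?_, ?_⟩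
  · exact (conv_mem w 0 1 (by simp) _ (hlc ▸ List.get_mem l _)).1
  · exact (conv_mem w 0 1 (by simp) _ (hlc ▸ List.get_mem l _)).2
  · rcases l with _ | ⟨a, l⟩
    · simp at hl1
    have e : (Fin.rev (⟨(a :: l).length - 1, by omega⟩ : Fin (a :: l).length)) = ⟨0, by simp⟩ := by
      ext; simp [Fin.val_rev]
    simp only [kk, ee]
    rw [e]
    rintro ⟨h1, h2⟩
    simp at h1 h2
    rcases w with _ | ⟨x, w⟩
    · exact hne rfl
    by_cases hz : x = .z
    · simp only [conv, if_pos hz] at hlc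
      have := conv_head _ _ _ _ _ hlc.symm
      omega
    · simp only [conv, if_neg hz] at hlc
      rw [(List.cons.inj hlc).1] at h2
      have hxp := adm_cons.mp ha
      cases x <;> simp_all [Ltr.v, Complex.ext_iff]
      norm_num at h2
  · rw [sum_kk, hlc, conv_sum w 0 1 hg (fun _ => rfl), add_zero]
  · have h1 : ∀ M, cmzvPartial l.length (kk l) (ee l) M =
        (-1) ^ nz w * ∑ m ∈ Finset.range (M + 1), cf w m := by
      intro M
      rw [SS_eq, hlc]
      have := SS_conv w 0 1 M hg (fun _ => rfl)
      simp only [one_pow, mul_one, pow_zero, div_one] at this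
      rw [this, ← mul_assoc, ← mul_pow]; simp
    have h2 := ((val_spec ha).comp (tendsto_add_atTop_nat 1)).const_mul ((-1:ℂ) ^ nz w)
    exact h2.congr fun M => (h1 M).symm

lemma Zw_le_depth {K s : ℕ} (hK : 1 ≤ K) : Zw K s ≤ depthFilteredCMZV 4 K s := by
  unfold Zw
  rw [Submodule.span_le]
  rintro v ⟨w, hg, ha, rfl, hs, rfl⟩
  have hne : w ≠ [] := by rintro rfl; simp at hK
  have h := val_isCMZV hg ha hne
  have hm : (-1) ^ nz w * val w ∈ depthFilteredCMZV 4 w.length s :=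
    Submodule.subset_span ⟨nz w, hs, h⟩
  have := Submodule.smul_mem _ ((-1 : ℚ) ^ nz w) hm
  rw [qsmul_eq] at this
  push_cast at this
  rw [← mul_assoc, ← mul_pow] at this
  simpa using this

lemma letter_of_pow {y : ℂ} (h : y ^ 4 = 1) : ∃ x : Ltr, x ≠ .z ∧ x.v = y := by
  have h2 : (y - 1) * (y + 1) * ((y - Complex.I) * (y + Complex.I)) = 0 := by
    linear_combination h - (y ^ 2 - 1) * Complex.I_sq
  rcases mul_eq_zero.mp h2 with h | h <;> rcases mul_eq_zero.mp h with h | h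
  · exact ⟨.p, by simp, by simp only [Ltr.v]; linear_combination -h⟩
  · exact ⟨.q, by simp, by simp only [Ltr.v]; linear_combination -h⟩
  · exact ⟨.b, by simp, by simp only [Ltr.v]; linear_combination -h⟩
  · exact ⟨.c, by simp, by simp only [Ltr.v]; linear_combination -h⟩

lemma exists_word (r : ℕ) : ∀ (ε : Fin r → ℂ) (y : ℂ), (∀ i, ε i ^ 4 = 1) → y ^ 4 = 1 →
    ∃ w : List Ltr, Ltr.z ∉ w ∧ w.length = r ∧
      (∀ M, cmzvPartial r (fun _ => 1) ε M = SS (conv w 0 y) M) ∧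
      (∀ h : r ≠ 0, ∀ x w', w = x :: w' → x.v = y / ε ⟨r - 1, by omega⟩) := by
  induction r with
  | zero =>
    intro ε y _ _
    exact ⟨[], by simp, rfl, fun M => cmzv_zero _ _ _, fun h => absurd rfl h⟩
  | succ r ih =>
    intro ε y hε hy
    have h4 : (y / ε (Fin.last r)) ^ 4 = 1 := by rw [div_pow, hε, hy]; simp
    obtain ⟨x, hx, hxv⟩ := letter_of_pow h4
    obtain ⟨w, h1, h2, h3, _⟩ := ih (fun i => ε i.castSucc) (y / ε (Fin.last r))
      (fun i => hε _) h4
    refine ⟨x :: w, ?_, by simp [h2], fun M => ?_, fun h x' w' hw => ?_⟩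
    · simp only [List.mem_cons, not_or]; exact ⟨hx.symm, h1⟩
    · rw [cmzv_succ]
      simp only [conv, if_neg hx, SS]
      refine Finset.sum_congr rfl fun n _ => ?_
      rw [h3, hxv]
      congr 2
      have e0 : ε (Fin.last r) ≠ 0 := by
        intro h; have := hε (Fin.last r); rw [h] at this; simp at this
      have y0 : y ≠ 0 := by rintro rfl; simp at hy
      field_simp
    · rw [← (List.cons.inj hw).1, hxv]; rfl

lemma nz_unit {w : List Ltr} (h : Ltr.z ∉ w) : nz w = w.length := by
  induction w with
  | nil => rfl
  | cons x w ih =>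
    simp only [List.mem_cons, not_or] at h
    simp [nz, ih h.2, Ne.symm h.1]; omega

lemma tendsto_unit {r : ℕ} {ε : Fin r → ℂ} {w : List Ltr} (h1 : Ltr.z ∉ w)
    (h3 : ∀ M, cmzvPartial r (fun _ => 1) ε M = SS (conv w 0 1) M) (ha : Adm w) :
    Tendsto (cmzvPartial r (fun _ => 1) ε) atTop (𝓝 ((-1) ^ w.length * val w)) := by
  have h4 : ∀ M, cmzvPartial r (fun _ => 1) ε M =
      (-1) ^ w.length * ∑ m ∈ Finset.range (M + 1), cf w m := by
    intro M
    rw [h3]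
    have := SS_conv w 0 1 M (good_of_unit h1) (fun _ => rfl)
    simp only [one_pow, mul_one, pow_zero, div_one] at this
    rw [this, nz_unit h1, ← mul_assoc, ← mul_pow]; simp
  have h2 := ((val_spec ha).comp (tendsto_add_atTop_nat 1)).const_mul ((-1:ℂ) ^ w.length)
  exact h2.congr fun M => (h4 M).symm

lemma unit_value {r : ℕ} (hr : 1 ≤ r) {ε : Fin r → ℂ} (hε : ∀ i, ε i ^ 4 = 1)
    (hlast : ε ⟨r - 1, by omega⟩ ≠ 1) {z : ℂ}
    (hz : Tendsto (cmzvPartial r (fun _ => 1) ε) atTop (𝓝 z)) :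
    ∃ w : List Ltr, Ltr.z ∉ w ∧ w.length = r ∧ Adm w ∧ z = (-1) ^ r * val w := by
  obtain ⟨w, h1, h2, h3, h4⟩ := exists_word r ε 1 hε (by simp)
  have ha : Adm w := by
    rintro w' rfl
    have := h4 (by omega) _ _ rfl
    simp only [Ltr.v] at this
    apply hlast
    have e0 : ε ⟨r - 1, by omega⟩ ≠ 0 := by
      intro h; have := hε ⟨r - 1, by omega⟩; rw [h] at this; simp at this
    field_simp at this
    exact this
  refine ⟨w, h1, h2, ha, ?_⟩
  rw [← h2]
  exact tendsto_nhds_unique hz (tendsto_unit h1 h3 ha)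

lemma cmzv_ones (x : Ltr) (hx : x ≠ .z) (r : ℕ) : ∀ M, cmzvPartial r (fun _ => 1) (fun _ => 1) M =
    SS (conv (List.replicate r x) 0 x.v) M := by
  induction r with
  | zero => intro M; exact cmzv_zero _ _ _
  | succ r ih =>
    intro M
    rw [cmzv_succ]
    simp only [List.replicate_succ, conv, if_neg hx, SS]
    refine Finset.sum_congr rfl fun n _ => ?_
    rw [ih, div_self (Ltr.v_ne hx)]

lemma special_value (x : Ltr) (hx : x ≠ .z) (hp : x ≠ .p) {r : ℕ} (hr : 1 ≤ r) {y : ℂ}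
    (hy : y = 1 / x.v) {z : ℂ}
    (hz : Tendsto (cmzvPartial r (fun _ => 1)
        (fun i => if (i : ℕ) = r - 1 then y else 1)) atTop (𝓝 z)) :
    z = (-1) ^ r * val (List.replicate r x) := by
  obtain ⟨r, rfl⟩ := Nat.exists_eq_add_of_le' hr
  have := tendsto_unit (r := r + 1) (ε := fun i => if (i : ℕ) = r + 1 - 1 then y else 1)
    (w := List.replicate (r+1) x) (by intro h; exact hx (List.eq_of_mem_replicate h).symm)
    (fun M => ?_) (adm_cons.mpr hp)
  · rw [List.length_replicate] at this
    exact tendsto_nhds_unique hz this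
  · rw [cmzv_succ]
    simp only [List.replicate_succ, conv, if_neg hx, SS]
    refine Finset.sum_congr rfl fun n _ => ?_
    rw [← cmzv_ones x hx]
    have : ∀ i : Fin r, (i : ℕ) ≠ r := fun i => by have := i.2; omega
    simp [this, hy]

end MU4

open Filter Topology

namespace MU4

lemma exists_rec {α β : Type} (P : List α → β → Prop) (Q : α → List α → β → β → Prop) (b0 : β)
    (h0 : P [] b0) (step : ∀ y R f, P R f → ∃ g, P (y :: R) g ∧ Q y R f g) :
    ∃ H : List α → β, H [] = b0 ∧ (∀ R, P R (H R)) ∧ ∀ y R, Q y R (H R) (H (y :: R)) := by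
  let H' : (R : List α) → {f : β // P R f} := fun R =>
    List.rec (motive := fun R => {f : β // P R f}) ⟨b0, h0⟩
      (fun y R f => ⟨(step y R f.1 f.2).choose, (step y R f.1 f.2).choose_spec.1⟩) R
  refine ⟨fun R => (H' R).1, rfl, fun R => (H' R).2, fun y R => ?_⟩
  exact (step y R (H' R).1 (H' R).2).choose_spec.2

lemma one_sub_mul_Lf (w : List Ltr) :
    Tendsto (fun t : ℝ => (1 - (t:ℂ)) * Lf w t) (𝓝[<] 1) (𝓝 0) := by
  let a : ℕ → ℂ := fun n => cf w n - (if n = 0 then 0 else cf w (n - 1))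
  have hpart : ∀ n, ∑ i ∈ Finset.range (n + 1), a i = cf w n := by
    intro n
    induction n with
    | zero => simp [a]
    | succ n ih => rw [Finset.sum_range_succ, ih]; simp [a]
  have hlim : Tendsto (fun n => ∑ i ∈ Finset.range n, a i) atTop (𝓝 0) := by
    rw [← tendsto_add_atTop_iff_nat 1]
    simp only [hpart]
    exact cf_tendsto w
  have := Complex.tendsto_tsum_powerSeries_nhdsWithin_lt hlim
  rw [tendsto_map'_iff] at this
  refine tendsto_congr_Ioo (fun t ht => ?_) this
  have hta : |t| < 1 := by rw [abs_of_pos ht.1]; exact ht.2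
  have hs := summable_Lf w hta
  have hs2 : Summable fun n => (if n = 0 then 0 else cf w (n - 1)) * (t:ℂ) ^ n := by
    rw [← summable_nat_add_iff 1]
    refine (hs.mul_left (t:ℂ)).congr fun n => ?_
    simp [pow_succ]; ring
  simp only [Function.comp, a]
  simp_rw [sub_mul]
  rw [hs.tsum_sub hs2, hs2.tsum_eq_zero_add]
  simp only [if_true, zero_mul, zero_add, Nat.add_eq_zero_iff, one_ne_zero, and_false, if_false,
    Nat.add_sub_cancel]
  have : ∑' n, cf w n * (t:ℂ) ^ (n+1) = t * Lf w t := by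
    unfold Lf
    rw [← tsum_mul_left]
    refine tsum_congr fun n => ?_
    rw [pow_succ]; ring
  rw [this]
  unfold Lf
  ring

/-- The forms for `x = (1-t)/(1+t)`. -/
def XF : Ltr → List (ℚ × Ltr)
  | .z => [(1, .z)]
  | .p => [(1, .z), (-1, .q)]
  | .q => [(-1, .q)]
  | .b => [(1, .c), (-1, .q)]
  | .c => [(1, .b), (-1, .q)]

lemma XF_z {y : Ltr} (h1 : y ≠ .p) (h2 : y ≠ .z) : ∀ a ∈ XF y, a.2 ≠ .z := by
  cases y <;> simp_all [XF]

/-- The forms in the variable `t`, where `z` is `p - q`. -/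
noncomputable def tau : Ltr → ℝ → ℂ
  | .z, t => 1 / ((t:ℂ) - 1) - 1 / ((t:ℂ) + 1)
  | x, t => 1 / ((t:ℂ) - x.v)

lemma tau_nz {x : Ltr} (h : x ≠ .z) (t : ℝ) : tau x t = 1 / ((t:ℂ) - x.v) := by
  cases x <;> simp_all [tau]

/-- Validity condition (innermost letter of the reversed word). -/
def Vld : List Ltr → Prop
  | [] => True
  | y :: R => (R = [] → y ≠ .p ∧ y ≠ .z) ∧ Vld R

/-- Condition for words occurring in the dual expansion. -/
def CB (R : List Ltr) (k : ℕ) (w : List Ltr) : Prop :=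
  k = 0 ∧ Good w ∧ w.length = R.length ∧ Ltr.p ∉ w ∧ (Ltr.z ∈ R → Ltr.z ∈ w)

lemma exists_HB : ∃ H : List Ltr → ℝ → ℂ, H [] = (fun _ => 1) ∧
    (∀ R, Vld R → H R ∈ Sp (CB R)) ∧
    ∀ y R, Vld (y :: R) → (∀ t ∈ Set.Ioo (0:ℝ) 1, HasDerivAt (H (y :: R)) (-(fev (XF y) t * H R t)) t) ∧
      ∃ A : ℝ, ∀ t ∈ Set.Ioc (0:ℝ) (1/2), ‖H (y :: R) t‖ ≤ A * t := by
  refine exists_rec (fun R f => Vld R → f ∈ Sp (CB R)) (fun y R f g => Vld (y :: R) →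
    (∀ t ∈ Set.Ioo (0:ℝ) 1, HasDerivAt g (-(fev (XF y) t * f t)) t) ∧
      ∃ A : ℝ, ∀ t ∈ Set.Ioc (0:ℝ) (1/2), ‖g t‖ ≤ A * t) _ ?_ ?_
  · intro _
    have := Sp_mem (C := CB []) (k := 0) (w := []) (by simp [CB, Good])
    simpa [Lf_nil] using this
  · intro y R f hf
    by_cases hv : Vld (y :: R)
    swap
    · exact ⟨0, fun h => absurd h hv, fun h => absurd h hv⟩
    have hf := hf hv.2
    obtain ⟨g, m, d, A, b⟩ := Sp_form (XF y) (by
      rintro a ha haz k w ⟨_, _, hl, _⟩ rfl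
      have hR : R = [] := List.length_eq_zero_iff.mp hl.symm
      exact XF_z (hv.1 hR).1 (hv.1 hR).2 a ha haz) hf
    refine ⟨-g, fun _ => Submodule.neg_mem _ (Sp_mono ?_ m), fun _ => ⟨fun t ht => (d t ht).neg,
      A, fun t ht => ?_⟩⟩
    · rintro k w ⟨a, ha, w0, rfl, hk, hg, hl, hp, hz⟩
      refine ⟨hk, ⟨fun haz => ?_, hg⟩, by simp [hl], ?_, ?_⟩
      · rintro rfl
        have hR : R = [] := List.length_eq_zero_iff.mp hl.symm
        exact XF_z (hv.1 hR).1 (hv.1 hR).2 a ha haz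
      · cases y <;> simp_all [XF] <;> aesop
      · intro h
        rcases List.mem_cons.mp h with h | h
        · subst h
          simp_all [XF]
        · exact List.mem_cons_of_mem _ (hz h)
    · simpa using b t ht

/-- Replace the letter `z`. -/
def sbz (y : Ltr) (w : List Ltr) : List Ltr := w.map fun x => if x = .z then y else x

lemma sbz_of_not_mem {y : Ltr} {w : List Ltr} (h : Ltr.z ∉ w) : sbz y w = w := by
  unfold sbz
  conv_rhs => rw [← List.map_id w]
  refine List.map_congr_left fun x hx => ?_
  rw [if_neg]; · rfl
  rintro rfl; exact h hx

lemma sbz_cons {y x : Ltr} {w : List Ltr} (h : x ≠ .z) : sbz y (x :: w) = x :: sbz y w := by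
  simp [sbz, h]

open Classical in
/-- Iterated integrals for words with at most one `z`, read as `y1 - y2`. -/
noncomputable def TT (y1 y2 : Ltr) (w : List Ltr) (t : ℝ) : ℂ :=
  if Ltr.z ∈ w then Lf (sbz y1 w) t - Lf (sbz y2 w) t else Lf w t

/-- At most one `z`. -/
def One : List Ltr → Prop
  | [] => True
  | x :: w => (x = .z → Ltr.z ∉ w) ∧ One w

lemma TT_deriv_z {y1 y2 : Ltr} (h1 : y1 ≠ .z) (h2 : y2 ≠ .z) {w : List Ltr} (h : Ltr.z ∉ w) {t : ℝ}
    (ht : t ∈ Set.Ioo (0:ℝ) 1) : HasDerivAt (TT y1 y2 (.z :: w))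
      ((1 / ((t:ℂ) - y1.v) - 1 / ((t:ℂ) - y2.v)) * TT y1 y2 w t) t := by
  have e : TT y1 y2 (.z :: w) = fun t => Lf (y1 :: w) t - Lf (y2 :: w) t := by
    ext t
    have : ∀ y, sbz y (.z :: w) = y :: w := fun y => by
      have := sbz_of_not_mem (y := y) h
      unfold sbz at *
      simp [this]
    simp [TT, this]
  rw [e]
  convert! (hasDerivAt_Lf y1 w (fun h => absurd h h1) ht.1 ht.2).sub
    (hasDerivAt_Lf y2 w (fun h => absurd h h2) ht.1 ht.2) using 1
  simp only [TT, if_neg h]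
  ring

lemma TT_deriv {y1 y2 : Ltr} {x : Ltr} (hx : x ≠ .z) (w : List Ltr) {t : ℝ}
    (ht : t ∈ Set.Ioo (0:ℝ) 1) : HasDerivAt (TT y1 y2 (x :: w))
      (1 / ((t:ℂ) - x.v) * TT y1 y2 w t) t := by
  by_cases h : Ltr.z ∈ w
  · have e : TT y1 y2 (x :: w) = fun t => Lf (x :: sbz y1 w) t - Lf (x :: sbz y2 w) t := by
      ext t
      simp [TT, h, sbz_cons hx]
    rw [e]
    convert! (hasDerivAt_Lf x (sbz y1 w) (fun h => absurd h hx) ht.1 ht.2).sub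
      (hasDerivAt_Lf x (sbz y2 w) (fun h => absurd h hx) ht.1 ht.2) using 1
    simp only [TT, if_pos h]
    ring
  · have h' : Ltr.z ∉ x :: w := by
      simp only [List.mem_cons, not_or]; exact ⟨hx.symm, h⟩
    have e : TT y1 y2 (x :: w) = Lf (x :: w) := by
      ext t
      simp only [TT, if_neg h']
    rw [e]
    convert! (hasDerivAt_Lf x w (fun h => absurd h hx) ht.1 ht.2) using 1
    simp only [TT, if_neg h]
    ring

lemma TT_zero (y1 y2 x : Ltr) (w : List Ltr) :
    Tendsto (TT y1 y2 (x :: w)) (𝓝[>] 0) (𝓝 0) := by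
  by_cases h : Ltr.z ∈ x :: w
  · have : ∀ y, ∃ y' w', sbz y (x :: w) = y' :: w' := fun y => ⟨_, _, rfl⟩
    obtain ⟨a, w1, e1⟩ := this y1
    obtain ⟨a2, w2, e2⟩ := this y2
    have e : TT y1 y2 (x :: w) = fun t => Lf (a :: w1) t - Lf (a2 :: w2) t := by
      ext t
      simp only [TT, if_pos h, e1, e2]
    rw [e]
    simpa using (Lf_tendsto_zero a w1).sub (Lf_tendsto_zero a2 w2)
  · have e : TT y1 y2 (x :: w) = Lf (x :: w) := by
      ext t
      simp only [TT, if_neg h]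
    rw [e]
    exact Lf_tendsto_zero x w

lemma TT_one_sub (y1 y2 : Ltr) (w : List Ltr) :
    Tendsto (fun t : ℝ => (1 - (t:ℂ)) * TT y1 y2 w t) (𝓝[<] 1) (𝓝 0) := by
  by_cases h : Ltr.z ∈ w
  · simp only [TT, if_pos h, mul_sub]
    simpa using (one_sub_mul_Lf (sbz y1 w)).sub (one_sub_mul_Lf (sbz y2 w))
  · simp only [TT, if_neg h]
    exact one_sub_mul_Lf w

/-- The telescoping sum. -/
noncomputable def cs (G T : List Ltr → ℝ → ℂ) : List Ltr → List Ltr → ℝ → ℂ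
  | R, [], t => G R t * T [] t
  | R, x :: U, t => G R t * T (x :: U) t + cs G T (x :: R) U t

lemma cs_deriv (G T : List Ltr → ℝ → ℂ) (τ : Ltr → ℂ) (PG PT : List Ltr → Prop)
    (t : ℝ) (dG : List Ltr → ℂ) (hdG : ∀ R, PG R → HasDerivAt (G R) (dG R) t)
    (hdG' : ∀ y R, PG (y :: R) → dG (y :: R) = -(τ y * G R t))
    (hT0 : HasDerivAt (T []) 0 t)
    (hT : ∀ x U, PT (x :: U) → HasDerivAt (T (x :: U)) (τ x * T U t) t)
    (U : List Ltr) : ∀ R, PT U → (∀ x U, PT (x :: U) → PT U) →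
      (∀ V1 V2, U = V1 ++ V2 → PG (V1.reverse ++ R)) →
      HasDerivAt (cs G T R U) (dG R * T U t) t := by
  induction U with
  | nil =>
    intro R _ _ hP
    have := (hdG R (by simpa using hP [] [] rfl)).mul hT0
    simpa [cs] using! this
  | cons x U ih =>
    intro R hp hpp hP
    have h1 := hdG R (by simpa using hP [] _ rfl)
    have hPx : PG (x :: R) := by simpa using hP [x] U rfl
    have h3 := ih (x :: R) (hpp x U hp) hpp (fun V1 V2 h => by
      have := hP (x :: V1) V2 (by simp [h])
      simpa using this)
    convert! (h1.mul (hT x U hp)).add h3 using 1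
    rw [hdG' x R hPx]; ring

lemma cs_tendsto {G T : List Ltr → ℝ → ℂ} {l : Filter ℝ} (U : List Ltr) : ∀ R,
    (∀ V1 V2, V2 ≠ [] → U = V1 ++ V2 → Tendsto (fun t => G (V1.reverse ++ R) t * T V2 t) l (𝓝 0)) →
    ∀ a, Tendsto (fun t => G (U.reverse ++ R) t * T [] t) l (𝓝 a) → Tendsto (cs G T R U) l (𝓝 a) := by
  induction U with
  | nil => intro R _ a h; simpa [cs] using! h
  | cons x U ih =>
    intro R h a ha
    have h1 := h [] (x :: U) (by simp) rfl
    have h2 := ih (x :: R) (fun V1 V2 hne e => by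
      have := h (x :: V1) V2 hne (by simp [e])
      simpa using this) a (by simpa using ha)
    have := h1.add h2
    rw [zero_add] at this
    exact this

lemma cs_tendsto' {G T : List Ltr → ℝ → ℂ} {l : Filter ℝ} (U : List Ltr) : ∀ R,
    (∀ V1 V2, U = V1 ++ V2 → V1.reverse ++ R ≠ [] →
      Tendsto (fun t => G (V1.reverse ++ R) t * T V2 t) l (𝓝 0)) →
    ∀ a, (R = [] → Tendsto (fun t => G [] t * T U t) l (𝓝 a)) → (R ≠ [] → a = 0) →
      Tendsto (cs G T R U) l (𝓝 a) := by
  induction U with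
  | nil =>
    intro R h a h1 h2
    by_cases hR : R = []
    · subst hR; simpa [cs] using! h1 rfl
    · rw [h2 hR]
      have := h [] [] rfl (by simpa using hR)
      simpa [cs] using! this
  | cons x U ih =>
    intro R h a h1 h2
    have h3 := ih (x :: R) (fun V1 V2 e hne => by
      have := h (x :: V1) V2 (by simp [e]) (by simp)
      simpa using this) 0 (by simp) (by simp)
    have h4 : Tendsto (fun t => G R t * T (x :: U) t) l (𝓝 a) := by
      by_cases hR : R = []
      · subst hR; exact h1 rfl
      · rw [h2 hR]
        simpa using h [] _ rfl (by simpa using hR)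
    have := h4.add h3
    rw [add_zero] at this
    exact this

end MU4

open Filter Topology

namespace MU4

/-- The involution `(1-t)/(1+t)`. -/
noncomputable def mob (t : ℝ) : ℝ := (1 - t) / (1 + t)

lemma mob_mem {t : ℝ} (ht : t ∈ Set.Ioo (0:ℝ) 1) : mob t ∈ Set.Ioo (0:ℝ) 1 := by
  unfold mob
  have := ht.1; have := ht.2
  constructor
  · apply div_pos <;> linarith
  · rw [div_lt_one] <;> linarith

lemma mob_deriv {t : ℝ} (ht : t ∈ Set.Ioo (0:ℝ) 1) : HasDerivAt mob (-2 / (1 + t) ^ 2) t := by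
  have h1 : 1 + t ≠ 0 := by linarith [ht.1]
  have := ((hasDerivAt_id t).const_sub 1).div ((hasDerivAt_id t).const_add 1) h1
  convert! this using 1
  simp; field_simp; ring

lemma XF_tau (y : Ltr) {t : ℝ} (ht : t ∈ Set.Ioo (0:ℝ) 1) :
    fev (XF y) (mob t) * ((-2 / (1 + t) ^ 2 : ℝ) : ℂ) = tau y t := by
  have h0 := ht.1
  have h1 := ht.2
  have e1 : (t:ℂ) - 1 ≠ 0 := by rw [sub_ne_zero]; exact_mod_cast h1.ne
  have e1' : (1:ℂ) - t ≠ 0 := by rw [sub_ne_zero]; exact_mod_cast h1.ne'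
  have e2 : (t:ℂ) + 1 ≠ 0 := by exact_mod_cast (by linarith : t + 1 ≠ 0)
  have e2' : (1:ℂ) + t ≠ 0 := by exact_mod_cast (by linarith : 1 + t ≠ 0)
  have e3 : (t:ℂ) - Complex.I ≠ 0 := by
    intro h; have := congrArg Complex.im h; simp at this
  have e4 : (t:ℂ) + Complex.I ≠ 0 := by
    intro h; have := congrArg Complex.im h; simp at this
  have hm : ((mob t : ℝ) : ℂ) = (1 - t) / (1 + t) := by unfold mob; push_cast; rfl
  have k1 : (1:ℂ) - Complex.I ≠ 0 := by
    intro h; have := congrArg Complex.im h; simp at this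
  have k2 : (1:ℂ) + Complex.I ≠ 0 := by
    intro h; have := congrArg Complex.im h; simp at this
  have c3 : (1 - (t:ℂ)) / (1 + t) + Complex.I = -((1 - Complex.I) * ((t:ℂ) - Complex.I)) / (1 + t) := by
    field_simp
    linear_combination Complex.I_sq
  have c4 : (1 - (t:ℂ)) / (1 + t) - Complex.I = -((1 + Complex.I) * ((t:ℂ) + Complex.I)) / (1 + t) := by
    field_simp
    linear_combination Complex.I_sq
  have c2 : (1 - (t:ℂ)) / (1 + t) + 1 = 2 / (1 + t) := by
    field_simp
    ring
  cases y
  all_goals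
    simp only [fev, XF, tau, hm, List.map_cons, List.map_nil, List.sum_cons, List.sum_nil, Ltr.v,
      sub_neg_eq_add, sub_zero, c3, c4, c2]
    push_cast
  · field_simp
    ring
  · field_simp
    ring
  · field_simp
    ring
  · field_simp
    linear_combination (t + 1) * Complex.I_sq
  · field_simp
    linear_combination (t + 1) * Complex.I_sq

lemma Vld_append {A R : List Ltr} (h : Vld (A ++ R)) : Vld R := by
  induction A with
  | nil => exact h
  | cons a A ih => exact ih h.2

lemma Vld_single {h : Ltr} (h1 : h ≠ .p) (h2 : h ≠ .z) (L : List Ltr) : Vld (L ++ [h]) := by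
  induction L with
  | nil => exact ⟨fun _ => ⟨h1, h2⟩, trivial⟩
  | cons a A ih => exact ⟨fun h => by simp at h, ih⟩

lemma tendsto_mob_zero : Tendsto mob (𝓝[>] 0) (𝓝[<] 1) := by
  refine tendsto_nhdsWithin_iff.mpr ⟨?_, ?_⟩
  · have : ContinuousAt mob 0 := by
      unfold mob
      exact ContinuousAt.div (by fun_prop) (by fun_prop) (by norm_num)
    have := this.tendsto.mono_left (nhdsWithin_le_nhds (s := Set.Ioi 0))
    simpa [mob] using this
  · filter_upwards [Ioo_mem_nhdsGT (show (0:ℝ) < 1 by norm_num)] with t ht using (mob_mem ht).2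

lemma stepB (h : Ltr) (h1 : h ≠ .p) (h2 : h ≠ .z) (W : List Ltr) (hone : One W) (hz : Ltr.z ∈ W) :
    val (h :: sbz .p W) - val (h :: sbz .q W) ∈ Zw (W.length + 1) W.length := by
  obtain ⟨H, H0, Hm, Hd⟩ := exists_HB
  set U := h :: W with hU
  have hzU : Ltr.z ∈ U := List.mem_cons_of_mem _ hz
  have hv : Vld U.reverse := by
    rw [hU, List.reverse_cons]; exact Vld_single h1 h2 _
  have hv' : ∀ V1 V2, U = V1 ++ V2 → Vld V1.reverse := by
    intro V1 V2 e
    rw [e, List.reverse_append] at hv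
    exact Vld_append hv
  let G : List Ltr → ℝ → ℂ := fun R t => H R (mob t)
  let T := TT .p .q
  let dG : ℝ → List Ltr → ℂ := fun t R => match R with
    | [] => 0
    | y :: R => -(tau y t * H R (mob t))
  have hone' : One U := ⟨fun e => absurd e h2, hone⟩
  have hd : ∀ t ∈ Set.Ioo (0:ℝ) 1, HasDerivAt (cs G T [] U) 0 t := by
    intro t ht
    have := cs_deriv G T (fun y => tau y t) Vld One t (dG t) ?_ (fun y R _ => rfl) ?_ ?_ U []
      hone' (fun x U h => h.2) (fun V1 V2 e => by simpa using hv' V1 V2 e)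
    · simpa [dG] using this
    · intro R hR
      rcases R with _ | ⟨y, R⟩
      · simp only [G, H0, dG]; exact hasDerivAt_const _ _
      · have h3 := HasDerivAt.scomp (h := mob) t ((Hd y R hR).1 _ (mob_mem ht)) (mob_deriv ht)
        convert! h3 using 1
        simp only [dG]
        rw [← XF_tau y ht]
        rw [Complex.real_smul]; ring
    · have : T [] = fun _ => 1 := by ext t; simp [T, TT, Lf_nil]
      rw [this]; exact hasDerivAt_const _ _
    · intro x V hV
      by_cases hx : x = .z
      · subst hx
        have := TT_deriv_z (y1 := .p) (y2 := .q) (by simp) (by simp) (hV.1 rfl) ht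
        simpa [tau, Ltr.v, T] using this
      · have := TT_deriv (y1 := .p) (y2 := .q) hx V ht
        rw [tau_nz hx]
        exact this
  obtain ⟨c, hc⟩ := const_of_deriv hd
  have hRne : ∀ R, Vld R → R ≠ [] → ∃ A : ℝ, ∀ t ∈ Set.Ioc (0:ℝ) (1/2), ‖H R t‖ ≤ A * t := by
    intro R hR hne
    rcases R with _ | ⟨y, R⟩
    · exact absurd rfl hne
    · exact (Hd y R hR).2
  -- the limit at `1`
  have lim1 : Tendsto (cs G T [] U) (𝓝[<] 1) (𝓝 (val (h :: sbz .p W) - val (h :: sbz .q W))) := by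
    refine cs_tendsto' U [] (fun V1 V2 e hne => ?_) _ (fun _ => ?_) (fun h => absurd rfl h)
    · simp only [List.append_nil] at hne ⊢
      obtain ⟨A, hA⟩ := hRne V1.reverse (hv' V1 V2 e) hne
      have h3 := (TT_one_sub .p .q V2).norm.const_mul |A|
      simp only [norm_zero, mul_zero] at h3
      refine squeeze_zero_norm' ?_ h3
      filter_upwards [Ioo_mem_nhdsLT (show (1/2:ℝ) < 1 by norm_num)] with t ht
      have ht' : t ∈ Set.Ioo (0:ℝ) 1 := ⟨by linarith [ht.1], ht.2⟩
      have hm := mob_mem ht'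
      have hm1 : mob t ≤ 1 - t := by
        unfold mob; rw [div_le_iff₀ (by linarith [ht'.1])]; nlinarith [ht'.1, ht'.2]
      have hm2 : mob t ≤ 1 / 2 := by linarith [ht.1]
      have h4 := hA (mob t) ⟨hm.1, hm2⟩
      rw [norm_mul, norm_mul]
      have h5 : ‖(1 - (t:ℂ))‖ = 1 - t := by
        rw [show (1 - (t:ℂ)) = ((1 - t : ℝ) : ℂ) by push_cast; ring, Complex.norm_real,
          Real.norm_eq_abs, abs_of_pos (by linarith [ht.2])]
      rw [h5]
      calc ‖G V1.reverse t‖ * ‖T V2 t‖ ≤ (|A| * (1 - t)) * ‖T V2 t‖ := by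
            gcongr
            refine h4.trans ?_
            calc A * mob t ≤ |A| * mob t := by gcongr; exact hm.1.le; exact le_abs_self A
              _ ≤ |A| * (1 - t) := by gcongr
        _ = _ := by ring
    · have e : (fun t => G [] t * T U t) = fun t => Lf (h :: sbz .p W) t - Lf (h :: sbz .q W) t := by
        ext t
        simp only [G, H0, T, TT, if_pos hzU, one_mul]
        rw [hU, sbz_cons h2, sbz_cons h2]
      rw [e]
      exact (Lf_tendsto (adm_cons.mpr h1)).sub (Lf_tendsto (adm_cons.mpr h1))
  have hadm : ∀ R k w, CB R k w → Adm w := by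
    rintro R k w ⟨_, _, _, hp, _⟩ w' rfl
    simp at hp
  have hlimH : ∀ R, Vld R → ∃ l ∈ SV (CB R), Tendsto (G R) (𝓝[>] 0) (𝓝 l) := by
    intro R hR
    obtain ⟨l, hl, ht⟩ := Sp_lim (hadm R) (Hm R hR)
    exact ⟨l, hl, ht.comp tendsto_mob_zero⟩
  obtain ⟨l, hl, hlt⟩ := hlimH _ hv
  have lim0 : Tendsto (cs G T [] U) (𝓝[>] 0) (𝓝 l) := by
    refine cs_tendsto U [] (fun V1 V2 hne e => ?_) _ ?_
    · obtain ⟨l', _, h'⟩ := hlimH _ (hv' V1 V2 e)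
      rcases V2 with _ | ⟨x, V2⟩
      · exact absurd rfl hne
      have := h'.mul (TT_zero .p .q x V2)
      rw [mul_zero] at this
      simpa using this
    · have : T [] = fun _ => 1 := by ext t; simp [T, TT, Lf_nil]
      simpa [this] using hlt
  have e1 : c = val (h :: sbz .p W) - val (h :: sbz .q W) :=
    tendsto_nhds_unique (tendsto_congr_Ioo (fun t ht => (hc t ht).symm) tendsto_const_nhds) lim1
  have e2 : c = l := by
    refine tendsto_nhds_unique (tendsto_const_nhds.congr' ?_) lim0
    filter_upwards [Ioo_mem_nhdsGT (show (0:ℝ) < 1 by norm_num)] with t ht using (hc t ht).symm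
  rw [← e1, e2]
  refine Submodule.span_mono ?_ hl
  rintro v ⟨k, w, hC, rfl⟩
  have ha := hadm _ k w hC
  obtain ⟨rfl, hg, hlen, _, hz'⟩ := hC
  have hzw := nz_lt (hz' (by simpa using hzU))
  have hlen' : w.length = W.length + 1 := by rw [hlen]; simp [hU]
  exact ⟨w, hg, ha, hlen', by omega, by simp⟩

lemma stepB' (h : Ltr) (h1 : h ≠ .p) (h2 : h ≠ .z) (A B : List Ltr) (hA : Ltr.z ∉ A)
    (hB : Ltr.z ∉ B) : val (h :: (A ++ .p :: B)) - val (h :: (A ++ .q :: B)) ∈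
      Zw (A.length + B.length + 2) (A.length + B.length + 1) := by
  have hone : ∀ A, Ltr.z ∉ A → One (A ++ .z :: B) := by
    have hB' : ∀ B, Ltr.z ∉ B → One B := by
      intro B
      induction B with
      | nil => intro _; trivial
      | cons x B ih =>
        intro hB
        simp only [List.mem_cons, not_or] at hB
        exact ⟨fun _ => hB.2, ih hB.2⟩
    intro A hA
    induction A with
    | nil => exact ⟨fun _ => hB, hB' B hB⟩
    | cons x A ih =>
      simp only [List.mem_cons, not_or] at hA
      exact ⟨fun e => absurd e.symm hA.1, ih hA.2⟩
  have := stepB h h1 h2 (A ++ .z :: B) (hone A hA) (by simp)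
  have e : ∀ y, sbz y (A ++ .z :: B) = A ++ y :: B := by
    intro y
    have e1 := sbz_of_not_mem (y := y) hA
    have e2 := sbz_of_not_mem (y := y) hB
    unfold sbz at *
    simp [e1, e2]
  rw [e, e] at this
  simp only [List.length_append, List.length_cons] at this
  exact this

end MU4

open Filter Topology

namespace MU4

/-- The disc used for the analytic continuation. -/
def BB : Set ℂ := Metric.ball ⟨1, 1/2⟩ (√5 / 2)

lemma mem_BB {v : ℂ} : v ∈ BB ↔ v.re ^ 2 + v.im ^ 2 < 2 * v.re + v.im := by
  unfold BB
  rw [Metric.mem_ball, dist_eq_norm]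
  have h5 : (√5 / 2) ^ 2 = (5:ℝ) / 4 := by
    rw [div_pow, Real.sq_sqrt (by norm_num)]; norm_num
  rw [← abs_of_nonneg (norm_nonneg (v - _)), ← abs_of_nonneg (by positivity : 0 ≤ √5 / 2),
    ← sq_lt_sq, h5, ← Complex.normSq_eq_norm_sq, Complex.normSq_apply]
  simp only [Complex.sub_re, Complex.sub_im]
  constructor <;> intro h <;> nlinarith

lemma isOpen_BB : IsOpen BB := Metric.isOpen_ball

lemma one_mem_BB : (1:ℂ) ∈ BB := by rw [mem_BB]; norm_num

lemma letter_not_mem {x : Ltr} (h : x ≠ .p) : x.v ∉ BB := by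
  rw [mem_BB]
  cases x <;> simp_all [Ltr.v]
  norm_num

/-- Whether the form has a pole at the origin. -/
def dl : Ltr → List (ℚ × Ltr)
  | .z => [(1, .z)]
  | .b => [(1, .z)]
  | _ => []

/-- Regular parts of the forms in the variable `v = (i-t)/(i+t)`. -/
def VF0 : Ltr → List (ℚ × Ltr)
  | .z => []
  | .b => [(-1, .q)]
  | .c => [(-1, .q)]
  | .p => [(1, .b), (-1, .q)]
  | .q => [(1, .c), (-1, .q)]

/-- Regular parts of the forms pulled back by `ρ ↦ iρ`. -/
def FF0 : Ltr → List (ℚ × Ltr)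
  | .z => []
  | .b => [(-1, .b)]
  | .c => [(-1, .b)]
  | .p => [(1, .p), (-1, .b)]
  | .q => [(1, .q), (-1, .b)]

/-- The form attached to a letter. -/
noncomputable def om (x : Ltr) (v : ℂ) : ℂ := fev (dl x ++ VF0 x) v

lemma fev_append (F G : List (ℚ × Ltr)) (v : ℂ) : fev (F ++ G) v = fev F v + fev G v := by
  simp [fev]

lemma fev_diff (F : List (ℚ × Ltr)) (h : ∀ a ∈ F, a.2 ≠ .p) : DifferentiableOn ℂ (fev F) BB := by
  induction F with
  | nil =>
    have : fev [] = fun _ => 0 := by ext; simp [fev]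
    rw [this]; exact differentiableOn_const _
  | cons a F ih =>
    have : fev (a :: F) = fun v => (a.1 : ℂ) / (v - a.2.v) + fev F v := by ext; simp [fev]
    rw [this]
    refine DifferentiableOn.add (DifferentiableOn.div (by fun_prop) (by fun_prop) ?_)
      (ih fun b hb => h b (List.mem_cons_of_mem _ hb))
    intro v hv h0
    rw [sub_eq_zero] at h0
    exact letter_not_mem (h a List.mem_cons_self) (h0 ▸ hv)

lemma om_diff (x : Ltr) : DifferentiableOn ℂ (om x) BB := by
  apply fev_diff
  cases x <;> simp [dl, VF0]

lemma exists_E : ∃ E : List Ltr → ℂ → ℂ, E [] = (fun _ => 1) ∧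
    (∀ R, DifferentiableOn ℂ (E R) BB) ∧
    ∀ y R, E (y :: R) 1 = 0 ∧ ∀ v ∈ BB, HasDerivAt (E (y :: R)) (om y v * E R v) v := by
  refine exists_rec (fun _ f => DifferentiableOn ℂ f BB) (fun y R f g => g 1 = 0 ∧
    ∀ v ∈ BB, HasDerivAt g (om y v * f v) v) _ (differentiableOn_const _) ?_
  intro y R f hf
  have h1 : DifferentiableOn ℂ (fun v => om y v * f v) BB := (om_diff y).mul hf
  obtain ⟨g, hg1, hg2⟩ := Complex.IsExactOn.with_val_at (DifferentiableOn.isExactOn_ball h1) 1 0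
  exact ⟨g, fun v hv => (hg2 v hv).differentiableAt.differentiableWithinAt, hg1, hg2⟩

/-- Deconcatenation product. -/
def JJ (f : List Ltr → ℂ) : (List Ltr → ℂ) → List Ltr → ℂ
  | g, [] => f [] * g []
  | g, x :: W => f (x :: W) * g [] + JJ f (fun U => g (x :: U)) W

lemma JJ_append (f : List Ltr → ℂ) (y : Ltr) (W : List Ltr) : ∀ g,
    JJ f g (W ++ [y]) = JJ (fun U => f (U ++ [y])) g W + f [] * g (W ++ [y]) := by
  induction W with
  | nil => intro g; simp [JJ]
  | cons x W ih => intro g; simp only [List.cons_append, JJ, ih]; ring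

lemma JJ_deriv (f g : ℝ → List Ltr → ℂ) (f' : List Ltr → ℂ) (s : ℝ)
    (hf : ∀ U, HasDerivAt (fun s => f s U) (f' U) s) (W : List Ltr) : ∀ (g : ℝ → List Ltr → ℂ)
    (g' : List Ltr → ℂ) (_ : ∀ U, HasDerivAt (fun s => g s U) (g' U) s),
    HasDerivAt (fun s => JJ (f s) (g s) W) (JJ f' (g s) W + JJ (f s) g' W) s := by
  induction W with
  | nil => intro g g' hg; exact (hf []).mul (hg [])
  | cons x W ih =>
    intro g g' hg
    simp only [JJ]
    convert! ((hf (x :: W)).mul (hg [])).add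
      (ih (fun s U => g s (x :: U)) (fun U => g' (x :: U)) (fun U => hg (x :: U))) using 1
    ring

lemma JJ_smul_left (c : ℂ) (f : List Ltr → ℂ) (W : List Ltr) : ∀ g,
    JJ (fun U => c * f U) g W = c * JJ f g W := by
  induction W with
  | nil => intro g; simp [JJ, mul_assoc]
  | cons x W ih => intro g; simp only [JJ, ih]; ring

lemma JJ_smul_right (c : ℂ) (f : List Ltr → ℂ) (W : List Ltr) : ∀ g,
    JJ f (fun U => c * g U) W = c * JJ f g W := by
  induction W with
  | nil => intro g; simp [JJ]; ring
  | cons x W ih => intro g; simp only [JJ, ih]; ring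

/-- Structure of the family of iterated primitives. -/
structure IsE (E : List Ltr → ℂ → ℂ) : Prop where
  nil : E [] = fun _ => 1
  diff : ∀ R, DifferentiableOn ℂ (E R) BB
  base : ∀ y R, E (y :: R) 1 = 0
  deriv : ∀ y R, ∀ v ∈ BB, HasDerivAt (E (y :: R)) (om y v * E R v) v

/-- Iterated integral from `p` to `q`. -/
noncomputable def JE (E : List Ltr → ℂ → ℂ) (W : List Ltr) (p q : ℂ) : ℂ :=
  JJ (fun U => (-1) ^ U.length * E U.reverse p) (fun U => E U q) W

/-- Derivative data for `E`. -/
noncomputable def dE (E : List Ltr → ℂ → ℂ) (v : ℂ) : List Ltr → ℂ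
  | [] => 0
  | y :: R => om y v * E R v

lemma IsE.hasDeriv {E : List Ltr → ℂ → ℂ} (hE : IsE E) (R : List Ltr) {v : ℂ} (hv : v ∈ BB) :
    HasDerivAt (E R) (dE E v R) v := by
  cases R with
  | nil => rw [hE.nil]; exact hasDerivAt_const _ _
  | cons y R => exact hE.deriv y R v hv

lemma IsE.comp {E : List Ltr → ℂ → ℂ} (hE : IsE E) (R : List Ltr) {p : ℝ → ℂ} {p' : ℂ} {s : ℝ}
    (hp : HasDerivAt p p' s) (hv : p s ∈ BB) :
    HasDerivAt (fun s => E R (p s)) (dE E (p s) R * p') s :=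
  (hE.hasDeriv R hv).comp s hp

lemma JE_deriv {E : List Ltr → ℂ → ℂ} (hE : IsE E) {p q : ℝ → ℂ} {p' q' : ℂ} {s : ℝ}
    (hp : HasDerivAt p p' s) (hq : HasDerivAt q q' s) (hpB : p s ∈ BB) (hqB : q s ∈ BB)
    {x y : Ltr} {W0 W1 : List Ltr} (hW : x :: W0 = W1 ++ [y]) :
    HasDerivAt (fun s => JE E (x :: W0) (p s) (q s))
      (om x (q s) * q' * JE E W0 (p s) (q s) - om y (p s) * p' * JE E W1 (p s) (q s)) s := by
  have h := JJ_deriv (fun s U => (-1) ^ U.length * E U.reverse (p s)) (fun s U => E U (q s))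
    (fun U => (-1) ^ U.length * (dE E (p s) U.reverse * p')) s
    (fun U => (hE.comp U.reverse hp hpB).const_mul _) (x :: W0) (fun s U => E U (q s))
    (fun U => dE E (q s) U * q') (fun U => hE.comp U hq hqB)
  convert! h using 1
  have e1 : JJ (fun U => (-1) ^ U.length * (dE E (p s) U.reverse * p')) (fun U => E U (q s)) (x :: W0)
      = - (om y (p s) * p') * JE E W1 (p s) (q s) := by
    rw [hW, JJ_append]
    simp only [List.reverse_nil, dE, List.reverse_append, List.reverse_cons, List.nil_append,
      List.singleton_append, List.length_append, List.length_cons, List.length_nil, zero_mul,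
      mul_zero, add_zero, zero_add, pow_succ]
    unfold JE
    rw [← JJ_smul_left]
    congr 1
    ext U
    ring
  have e2 : JJ (fun U => (-1) ^ U.length * E U.reverse (p s)) (fun U => dE E (q s) U * q') (x :: W0)
      = (om x (q s) * q') * JE E W0 (p s) (q s) := by
    simp only [JJ, dE, zero_mul, mul_zero, zero_add]
    unfold JE
    rw [← JJ_smul_right]
    congr 1
    ext U
    ring
  rw [e1, e2]
  ring

lemma JE_nil {E : List Ltr → ℂ → ℂ} (hE : IsE E) (p q : ℂ) : JE E [] p q = 1 := by
  simp [JE, JJ, hE.nil]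

lemma JJ_zero (f : List Ltr → ℂ) (W : List Ltr) : ∀ g, (∀ V1 V2, W = V1 ++ V2 → f V2 * g V1 = 0) →
    JJ f g W = 0 := by
  induction W with
  | nil => intro g h; exact h [] [] rfl
  | cons x W ih =>
    intro g h
    simp only [JJ]
    rw [h [] (x :: W) rfl, ih _ (fun V1 V2 e => h (x :: V1) V2 (by simp [e])), add_zero]

lemma real_mem_BB {s : ℝ} (h : s ∈ Set.Ioo (0:ℝ) 2) : (s:ℂ) ∈ BB := by
  rw [mem_BB]; simp; nlinarith [h.1, h.2]

lemma JE_diag {E : List Ltr → ℂ → ℂ} (hE : IsE E) (n : ℕ) : ∀ W : List Ltr, W.length = n → W ≠ [] →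
    ∀ s ∈ Set.Ioo (0:ℝ) 2, JE E W s s = 0 := by
  induction n with
  | zero => intro W h h'; exact absurd (List.length_eq_zero_iff.mp h) h'
  | succ n ih =>
    intro W hl hne
    obtain ⟨x, W0, rfl⟩ := List.exists_cons_of_ne_nil hne
    obtain ⟨W1, y, hy⟩ : ∃ W1 y, x :: W0 = W1 ++ [y] :=
      ⟨(x :: W0).dropLast, (x :: W0).getLast hne, (List.dropLast_append_getLast hne).symm⟩
    have hl0 : W0.length = n := by simpa using hl
    have hl1 : W1.length = n := by
      have := congrArg List.length hy
      simp at this; omega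
    have hd : ∀ s ∈ Set.Ioo (0:ℝ) 2, HasDerivAt (fun s : ℝ => JE E (x :: W0) s s) 0 s := by
      intro s hs
      have hc : HasDerivAt (fun s : ℝ => (s:ℂ)) 1 s := Complex.ofRealCLM.hasDerivAt
      have := JE_deriv hE hc hc (real_mem_BB hs) (real_mem_BB hs) hy
      convert! this using 1
      rcases Nat.eq_zero_or_pos n with h0 | h0
      · subst h0
        have e0 := List.length_eq_zero_iff.mp hl0
        have e1 := List.length_eq_zero_iff.mp hl1
        subst e0 e1
        simp at hy
        subst hy
        simp
      · rw [ih W0 hl0 (by rintro rfl; simp at hl0; omega) s hs,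
          ih W1 hl1 (by rintro rfl; simp at hl1; omega) s hs]
        simp
    obtain ⟨c, hc⟩ := const_of_deriv hd
    have h1 := hc 1 (by norm_num)
    have h2 : JE E (x :: W0) ((1:ℝ):ℂ) ((1:ℝ):ℂ) = 0 := by
      unfold JE
      apply JJ_zero
      intro V1 V2 e
      rcases V1 with _ | ⟨a, V1⟩
      · obtain ⟨a, U, hU⟩ := List.exists_cons_of_ne_nil (l := V2.reverse) (by
          intro h; simp at h; subst h; simp at e)
        rw [hU]; simp [hE.base]
      · simp [hE.base]
    intro s hs
    rw [hc s hs, ← h1, h2]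

end MU4

open Filter Topology

namespace MU4

/-- The Cayley transform. -/
noncomputable def cay (t : ℝ) : ℂ := (Complex.I - t) / (Complex.I + t)

lemma It_ne (t : ℝ) : Complex.I + (t:ℂ) ≠ 0 := by
  intro h; have := congrArg Complex.im h; simp at this

lemma It_ne' (t : ℝ) : Complex.I - (t:ℂ) ≠ 0 := by
  intro h; have := congrArg Complex.im h; simp at this

lemma cay_deriv (t : ℝ) : HasDerivAt cay (-2 * Complex.I / (Complex.I + t) ^ 2) t := by
  have hc : HasDerivAt (fun s : ℝ => (s:ℂ)) 1 t := Complex.ofRealCLM.hasDerivAt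
  have := (hc.const_sub Complex.I).div (hc.const_add Complex.I) (It_ne t)
  convert! this using 1
  field_simp
  ring

lemma cay_eq (t : ℝ) : cay t = ⟨(1 - t ^ 2) / (1 + t ^ 2), 2 * t / (1 + t ^ 2)⟩ := by
  have h : (1 + (t:ℂ) ^ 2) ≠ 0 := by
    have : 1 + t ^ 2 ≠ 0 := by positivity
    exact_mod_cast this
  have e : (⟨(1 - t ^ 2) / (1 + t ^ 2), 2 * t / (1 + t ^ 2)⟩ : ℂ)
      = (1 - (t:ℂ) ^ 2) / (1 + (t:ℂ) ^ 2) + 2 * t / (1 + (t:ℂ) ^ 2) * Complex.I := by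
    rw [Complex.mk_eq_add_mul_I]; push_cast; rfl
  rw [e, cay]
  have h2 := It_ne t
  field_simp
  linear_combination (-2 * t) * Complex.I_sq

lemma cay_zero : cay 0 = 1 := by
  simp [cay]

lemma cay_norm (t : ℝ) : ‖cay t‖ = 1 := by
  have h : (1 + t ^ 2) ≠ 0 := by positivity
  rw [cay_eq, Complex.norm_def, Complex.normSq_apply]
  have : (1 - t ^ 2) / (1 + t ^ 2) * ((1 - t ^ 2) / (1 + t ^ 2)) + 2 * t / (1 + t ^ 2) * (2 * t / (1 + t ^ 2)) = 1 := by
    field_simp; ring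
  simp only [this]; simp

lemma cay_re {t : ℝ} (h0 : 0 ≤ t) (h1 : t < 1) : 0 < (cay t).re := by
  rw [cay_eq]; dsimp only; apply div_pos <;> nlinarith

lemma cay_im {t : ℝ} (h0 : 0 ≤ t) : 0 ≤ (cay t).im := by
  rw [cay_eq]; dsimp only; positivity

lemma sector_mem_BB {u : ℂ} (hn : ‖u‖ = 1) (hr : 0 ≤ u.re) (hi : 0 ≤ u.im) {ρ : ℝ} (h0 : 0 < ρ)
    (h1 : ρ < 1) : (ρ:ℂ) * u ∈ BB := by
  have h : u.re ^ 2 + u.im ^ 2 = 1 := by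
    have := Complex.sq_norm u
    rw [hn, Complex.normSq_apply] at this; nlinarith
  rw [mem_BB]
  simp only [Complex.mul_re, Complex.mul_im, Complex.ofReal_re, Complex.ofReal_im, zero_mul,
    sub_zero, add_zero]
  have h2 : 1 ≤ 2 * u.re + u.im := by nlinarith
  nlinarith [mul_pos h0 (by linarith : 0 < 1 - ρ)]

lemma cay_mem_BB {t : ℝ} (h0 : 0 ≤ t) (h1 : t < 1) : cay t ∈ BB := by
  have h : (cay t).re ^ 2 + (cay t).im ^ 2 = 1 := by
    have := Complex.sq_norm (cay t)
    rw [cay_norm, Complex.normSq_apply] at this; nlinarith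
  rw [mem_BB, h]
  nlinarith [cay_re h0 h1, cay_im h0]

lemma om_cay (x : Ltr) {t : ℝ} (ht : t ∈ Set.Ioo (0:ℝ) 1) :
    om x (cay t) * (-2 * Complex.I / (Complex.I + t) ^ 2) =
      if x = .z then 1 / ((t:ℂ) - Complex.I) - 1 / ((t:ℂ) + Complex.I) else 1 / ((t:ℂ) - x.v) := by
  have h0 := ht.1
  have h1 := ht.2
  have e1 : (t:ℂ) - 1 ≠ 0 := by rw [sub_ne_zero]; exact_mod_cast h1.ne
  have e1' : (1:ℂ) - t ≠ 0 := by rw [sub_ne_zero]; exact_mod_cast h1.ne'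
  have e2 : (t:ℂ) + 1 ≠ 0 := by exact_mod_cast (by linarith : t + 1 ≠ 0)
  have e2' : (1:ℂ) + t ≠ 0 := by exact_mod_cast (by linarith : 1 + t ≠ 0)
  have e3 : (t:ℂ) - Complex.I ≠ 0 := by
    intro h; have := congrArg Complex.im h; simp at this
  have e4 : (t:ℂ) + Complex.I ≠ 0 := by
    intro h; have := congrArg Complex.im h; simp at this
  have e5 := It_ne t
  have e6 := It_ne' t
  have k1 : (1:ℂ) - Complex.I ≠ 0 := by
    intro h; have := congrArg Complex.im h; simp at this
  have k2 : (1:ℂ) + Complex.I ≠ 0 := by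
    intro h; have := congrArg Complex.im h; simp at this
  have c1 : cay t + 1 = 2 * Complex.I / (Complex.I + t) := by unfold cay; field_simp; ring
  have c2 : cay t - Complex.I = (1 + Complex.I) * (1 - t) / (Complex.I + t) := by
    unfold cay; field_simp; linear_combination -Complex.I_sq
  have c3 : cay t + Complex.I = -(1 - Complex.I) * (1 + t) / (Complex.I + t) := by
    unfold cay; field_simp; linear_combination Complex.I_sq
  have hI := Complex.I_ne_zero
  cases x
  all_goals
    simp only [om, fev, dl, VF0, List.map_cons, List.map_nil, List.sum_cons, List.sum_nil, Ltr.v,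
      sub_neg_eq_add, sub_zero, List.nil_append, List.cons_append, c1, c2, c3, if_true,
      reduceCtorEq, if_false]
    push_cast
  · unfold cay; field_simp; ring
  · field_simp
    linear_combination (-(1 - t) * (Complex.I + t)) * Complex.I_sq
  · field_simp
    linear_combination ((1 + t) * (Complex.I + t)) * Complex.I_sq
  · unfold cay; field_simp; ring
  · field_simp
    ring

lemma E_cay {E : List Ltr → ℂ → ℂ} (hE : IsE E) (W : List Ltr) : One W →
    ∀ t ∈ Set.Ioo (0:ℝ) 1, E W (cay t) = TT .b .c W t := by
  induction W with
  | nil => intro _ t ht; simp [hE.nil, TT, Lf_nil]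
  | cons x W ih =>
    intro hW t ht
    refine eq_of_deriv (f := fun t => E (x :: W) (cay t)) (g := TT .b .c (x :: W)) (F := fun t => (if x = .z then 1 / ((t:ℂ) - Complex.I) - 1 / ((t:ℂ) + Complex.I)
      else 1 / ((t:ℂ) - x.v)) * TT .b .c W t) (l := 0) ?_ ?_ ?_ ?_ t ht
    · intro t ht
      have := hE.comp (x :: W) (cay_deriv t) (cay_mem_BB ht.1.le ht.2)
      convert! this using 1
      rw [← om_cay x ht, ← ih hW.2 t ht, dE]
      ring
    · intro t ht
      by_cases hx : x = .z
      · subst hx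
        simpa [Ltr.v] using TT_deriv_z (y1 := .b) (y2 := .c) (by simp) (by simp) (hW.1 rfl) ht
      · simpa [hx] using TT_deriv (y1 := .b) (y2 := .c) hx W ht
    · have hc : ContinuousAt (fun t => E (x :: W) (cay t)) 0 :=
        (hE.comp (x :: W) (cay_deriv 0) (cay_mem_BB le_rfl one_pos)).continuousAt
      have := hc.tendsto
      rw [cay_zero, hE.base] at this
      exact this.mono_left nhdsWithin_le_nhds
    · exact TT_zero _ _ _ _

end MU4

open Filter Topology

namespace MU4

/-- The constant `1` when the form has a pole at the origin, else `0`. -/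
noncomputable def de (x : Ltr) : ℂ := if x = .z ∨ x = .b then 1 else 0

lemma dl_ev (x : Ltr) (v : ℂ) : fev (dl x) v = de x / v := by
  cases x <;> simp [dl, de, fev, Ltr.v]

lemma norm_sub_v_ge {x : Ltr} (hx : x ≠ .z) {v : ℂ} (hv : ‖v‖ ≤ 1 / 2) : 1 / 2 ≤ ‖v - x.v‖ := by
  have := norm_sub_norm_le x.v v
  rw [Ltr.norm_v hx, norm_sub_rev] at this
  linarith

lemma norm_inv_sub_v {x : Ltr} (hx : x ≠ .z) {v : ℂ} (hv : ‖v‖ ≤ 1 / 2) (c : ℂ) :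
    ‖c / (v - x.v)‖ ≤ 2 * ‖c‖ := by
  have := norm_sub_v_ge hx hv
  rw [norm_div, div_le_iff₀ (by linarith)]
  nlinarith [norm_nonneg c]

lemma VF0_bound (x : Ltr) {v : ℂ} (hv : ‖v‖ ≤ 1 / 2) : ‖fev (VF0 x) v‖ ≤ 4 := by
  have h1 : ‖(1:ℂ) / (v - Ltr.b.v)‖ ≤ 2 := by simpa using norm_inv_sub_v (x := .b) (by simp) hv 1
  have h2 : ‖(1:ℂ) / (v - Ltr.c.v)‖ ≤ 2 := by simpa using norm_inv_sub_v (x := .c) (by simp) hv 1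
  have h3 : ‖(-1:ℂ) / (v - Ltr.q.v)‖ ≤ 2 := by
    simpa using norm_inv_sub_v (x := .q) (by simp) hv (-1)
  cases x <;> simp only [fev, VF0, List.map_cons, List.map_nil, List.sum_cons, List.sum_nil, add_zero]
  · simp
  · push_cast; exact (norm_add_le _ _).trans (by linarith)
  · push_cast; exact (norm_add_le _ _).trans (by linarith)
  · push_cast; linarith
  · push_cast; linarith

lemma om_bound (x : Ltr) {v : ℂ} (hv : ‖v‖ ≤ 1 / 2) (h0 : v ≠ 0) :
    ‖v * om x v - de x‖ ≤ 4 * ‖v‖ := by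
  have : v * om x v - de x = v * fev (VF0 x) v := by
    rw [om, fev_append, dl_ev]; field_simp; ring
  rw [this, norm_mul]
  have := VF0_bound x hv
  nlinarith [norm_nonneg v]

/-- Limit of the iterated integral along a small arc. -/
noncomputable def kap : List Ltr → ℝ → ℂ
  | [], _ => 1
  | x :: W, θ => de x * (kap W θ * (Complex.I * θ) / (W.length + 1))

lemma kap_eq (W : List Ltr) (θ : ℝ) :
    kap W θ = (W.map de).prod * (Complex.I * θ) ^ W.length / (W.length.factorial : ℂ) := by
  induction W with
  | nil => simp [kap]
  | cons x W ih =>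
    have h1 : (W.length.factorial : ℂ) ≠ 0 := by exact_mod_cast Nat.factorial_ne_zero _
    have h2 : (W.length + 1 : ℂ) ≠ 0 := Nat.cast_add_one_ne_zero W.length
    rw [kap, ih, List.length_cons, List.map_cons, List.prod_cons, pow_succ, Nat.factorial_succ]
    push_cast
    field_simp

lemma kap_deriv (x : Ltr) (W : List Ltr) (θ : ℝ) :
    HasDerivAt (kap (x :: W)) (Complex.I * de x * kap W θ) θ := by
  have hc : HasDerivAt (fun s : ℝ => (s:ℂ)) 1 θ := Complex.ofRealCLM.hasDerivAt
  have h := ((hc.const_mul Complex.I).pow (W.length + 1)).const_mul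
    (((x :: W).map de).prod / ((W.length + 1).factorial : ℂ))
  have e : kap (x :: W) = fun θ : ℝ => ((x :: W).map de).prod / ((W.length + 1).factorial : ℂ)
      * (Complex.I * θ) ^ (W.length + 1) := by
    ext θ; rw [kap_eq, List.length_cons]; ring
  rw [e, kap_eq]
  convert! h using 1
  have h1 : (W.length.factorial : ℂ) ≠ 0 := by exact_mod_cast Nat.factorial_ne_zero _
  have h2 : (W.length + 1 : ℂ) ≠ 0 := Nat.cast_add_one_ne_zero W.length
  rw [Nat.factorial_succ, List.map_cons, List.prod_cons]
  push_cast
  field_simp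

lemma kap_zero (x : Ltr) (W : List Ltr) : kap (x :: W) 0 = 0 := by simp [kap]

lemma norm_kap (W : List Ltr) : ∀ θ ∈ Set.Icc (0:ℝ) (Real.pi / 2), ‖kap W θ‖ ≤ 2 ^ W.length := by
  induction W with
  | nil => intro θ _; simp [kap]
  | cons x W ih =>
    intro θ hθ
    have h1 : ‖de x‖ ≤ 1 := by unfold de; split_ifs <;> simp
    have h2 : θ ≤ 2 := by linarith [hθ.2, Real.pi_le_four]
    rw [kap, norm_mul, norm_div, norm_mul, norm_mul, Complex.norm_I, one_mul, Complex.norm_real,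
      Real.norm_of_nonneg hθ.1]
    have h3 : ‖(W.length + 1 : ℂ)‖ = W.length + 1 := by
      have := Complex.norm_natCast (W.length + 1); push_cast at this; exact this
    rw [h3]
    have h4 := ih θ hθ
    have h5 : ‖kap W θ‖ * θ / (W.length + 1) ≤ 2 ^ W.length * 2 := by
      rw [div_le_iff₀ (by positivity)]
      have : ‖kap W θ‖ * θ ≤ 2 ^ W.length * 2 := by gcongr; exact hθ.1
      have h0 : (0:ℝ) ≤ 2 ^ W.length * 2 := by positivity
      nlinarith [(Nat.cast_nonneg W.length : (0:ℝ) ≤ _)]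
    have h6 : 0 ≤ ‖kap W θ‖ * θ / (W.length + 1) := by have := hθ.1; positivity
    rw [List.length_cons, pow_succ]
    nlinarith [norm_nonneg (de x)]

/-- The point on the unit arc. -/
noncomputable def arc (θ : ℝ) : ℂ := Complex.exp (Complex.I * θ)

lemma arc_eq (θ : ℝ) : arc θ = ⟨Real.cos θ, Real.sin θ⟩ := by
  unfold arc; rw [mul_comm]; apply Complex.ext
  · simp [Complex.exp_ofReal_mul_I_re]
  · simp [Complex.exp_ofReal_mul_I_im]

lemma arc_norm (θ : ℝ) : ‖arc θ‖ = 1 := by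
  unfold arc; rw [mul_comm]; exact Complex.norm_exp_ofReal_mul_I θ

lemma arc_mem {θ : ℝ} (hθ : θ ∈ Set.Icc (0:ℝ) (Real.pi / 2)) {ρ : ℝ} (h0 : 0 < ρ)
    (h1 : ρ < 1) : (ρ:ℂ) * arc θ ∈ BB := by
  apply sector_mem_BB (arc_norm θ) _ _ h0 h1
  · rw [arc_eq]; exact Real.cos_nonneg_of_mem_Icc ⟨by linarith [hθ.1, Real.pi_pos], hθ.2⟩
  · rw [arc_eq]; exact Real.sin_nonneg_of_nonneg_of_le_pi hθ.1 (by linarith [hθ.2, Real.pi_pos])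

lemma arc_deriv (ρ θ : ℝ) : HasDerivAt (fun θ => (ρ:ℂ) * arc θ) (Complex.I * (ρ * arc θ)) θ := by
  have hc : HasDerivAt (fun s : ℝ => (s:ℂ)) 1 θ := Complex.ofRealCLM.hasDerivAt
  have := ((hc.const_mul Complex.I).cexp).const_mul (ρ:ℂ)
  convert! this using 1
  unfold arc; ring

lemma JE_arc {E : List Ltr → ℂ → ℂ} (hE : IsE E) (W : List Ltr) : ∃ C : ℝ, 0 ≤ C ∧
    ∀ ρ ∈ Set.Ioc (0:ℝ) (1 / 2), ∀ θ ∈ Set.Icc (0:ℝ) (Real.pi / 2),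
      ‖JE E W ρ (ρ * arc θ) - kap W θ‖ ≤ C * ρ := by
  induction W with
  | nil => exact ⟨0, le_rfl, fun ρ _ θ _ => by simp [JE_nil hE, kap]⟩
  | cons x W ih =>
    obtain ⟨C, hC0, hC⟩ := ih
    set D : ℝ := 4 * (C + 2 ^ W.length) + C with hD
    have hD0 : 0 ≤ D := by positivity
    refine ⟨D * 2, by positivity, fun ρ hρ θ hθ => ?_⟩
    have hρ1 : ρ < 1 := by linarith [hρ.2]
    obtain ⟨W1, y, hy⟩ : ∃ W1 y, x :: W = W1 ++ [y] :=
      ⟨(x :: W).dropLast, (x :: W).getLast (by simp), (List.dropLast_append_getLast (by simp)).symm⟩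
    have hd : ∀ s ∈ Set.Icc (0:ℝ) (Real.pi / 2), HasDerivAt
        (fun θ : ℝ => JE E (x :: W) ρ (ρ * arc θ) - kap (x :: W) θ)
        (om x (ρ * arc s) * (Complex.I * (ρ * arc s)) * JE E W ρ (ρ * arc s)
          - Complex.I * de x * kap W s) s := by
      intro s hs
      have := (JE_deriv hE (hasDerivAt_const s (ρ:ℂ)) (arc_deriv ρ s)
        (real_mem_BB ⟨hρ.1, by linarith⟩) (arc_mem hs hρ.1 hρ1) hy).sub (kap_deriv x W s)
      convert! this using 1
      ring
    have hb : ∀ s ∈ Set.Ico (0:ℝ) (Real.pi / 2),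
        ‖om x (ρ * arc s) * (Complex.I * (ρ * arc s)) * JE E W ρ (ρ * arc s)
          - Complex.I * de x * kap W s‖ ≤ D * ρ := by
      intro s hs
      have hs' : s ∈ Set.Icc (0:ℝ) (Real.pi / 2) := ⟨hs.1, hs.2.le⟩
      set v : ℂ := ρ * arc s with hv
      have hvn : ‖v‖ = ρ := by
        rw [hv, norm_mul, arc_norm, mul_one, Complex.norm_real, Real.norm_of_nonneg hρ.1.le]
      have hv0 : v ≠ 0 := by rw [← norm_pos_iff, hvn]; exact hρ.1
      have h1 := om_bound x (v := v) (by rw [hvn]; exact hρ.2) hv0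
      rw [hvn] at h1
      have h2 := hC ρ hρ s hs'
      have h3 := norm_kap W s hs'
      rw [← hv] at h2
      have h4 : ‖JE E W ρ v‖ ≤ C + 2 ^ W.length := by
        have := norm_add_le (JE E W ρ v - kap W s) (kap W s)
        rw [sub_add_cancel] at this
        nlinarith [hρ.1, hρ.2]
      have h5 : ‖de x‖ ≤ 1 := by unfold de; split_ifs <;> simp
      have e : om x v * (Complex.I * v) * JE E W ρ v - Complex.I * de x * kap W s
        = Complex.I * ((v * om x v - de x) * JE E W ρ v + de x * (JE E W ρ v - kap W s)) := by ring
      rw [e, norm_mul, Complex.norm_I, one_mul]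
      refine (norm_add_le _ _).trans ?_
      rw [norm_mul, norm_mul]
      have h6 : ‖v * om x v - de x‖ * ‖JE E W ρ v‖ ≤ 4 * ρ * (C + 2 ^ W.length) := by
        gcongr; linarith [hρ.1]
      have h7 : ‖de x‖ * ‖JE E W ρ v - kap W s‖ ≤ 1 * (C * ρ) := by gcongr
      rw [hD]; linarith
    have := norm_image_sub_le_of_norm_deriv_le_segment' (fun s hs => (hd s hs).hasDerivWithinAt)
      hb θ hθ
    have e0 : JE E (x :: W) ρ (ρ * arc 0) - kap (x :: W) 0 = 0 := by
      have : arc 0 = 1 := by simp [arc]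
      rw [this, mul_one, kap_zero, sub_zero]
      exact JE_diag hE _ _ rfl (by simp) ρ ⟨hρ.1, by linarith⟩
    rw [e0, sub_zero, sub_zero] at this
    refine this.trans ?_
    have : θ ≤ 2 := by linarith [hθ.2, Real.pi_le_four]
    have h8 : 0 ≤ D * ρ := mul_nonneg hD0 hρ.1.le
    nlinarith

/-- The constant term. -/
noncomputable def kp (W : List Ltr) : ℂ := kap W (Real.pi / 2)

lemma JE_I_tendsto {E : List Ltr → ℂ → ℂ} (hE : IsE E) (W : List Ltr) :
    Tendsto (fun ρ : ℝ => JE E W ρ (Complex.I * ρ)) (𝓝[>] 0) (𝓝 (kp W)) := by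
  obtain ⟨C, hC0, hC⟩ := JE_arc hE W
  rw [tendsto_iff_norm_sub_tendsto_zero]
  have hl : Tendsto (fun ρ : ℝ => C * ρ) (𝓝[>] 0) (𝓝 0) := by
    have : Tendsto (fun ρ : ℝ => C * ρ) (𝓝 0) (𝓝 (C * 0)) := (continuous_const.mul continuous_id).tendsto 0
    rw [mul_zero] at this
    exact this.mono_left nhdsWithin_le_nhds
  refine tendsto_of_tendsto_of_tendsto_of_le_of_le' tendsto_const_nhds hl
    (Eventually.of_forall fun _ => norm_nonneg _) ?_
  filter_upwards [Ioc_mem_nhdsGT (by norm_num : (0:ℝ) < 1 / 2)] with ρ hρ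
  have h := hC ρ hρ (Real.pi / 2) ⟨by positivity, le_rfl⟩
  have : arc (Real.pi / 2) = Complex.I := by
    rw [arc_eq]; simp [Complex.ext_iff]
  rw [this, mul_comm (ρ:ℂ)] at h
  exact h

end MU4

open Filter Topology

namespace MU4

lemma kp_eq (W : List Ltr) : kp W = (W.map de).prod * dd ^ W.length / (W.length.factorial : ℂ) := by
  rw [kp, kap_eq, dd]; push_cast; ring

lemma de_prod_rat (W : List Ltr) : ∃ a : ℚ, (W.map de).prod = (a:ℂ) := by
  induction W with
  | nil => exact ⟨1, by simp⟩
  | cons x W ih =>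
    obtain ⟨a, ha⟩ := ih
    by_cases h : x = .z ∨ x = .b
    · exact ⟨a, by simp [ha, de, h]⟩
    · exact ⟨0, by simp [de, h]⟩

lemma kp_rat (W : List Ltr) : ∃ a : ℚ, kp W = (a:ℂ) * dd ^ W.length := by
  obtain ⟨a, ha⟩ := de_prod_rat W
  exact ⟨a / W.length.factorial, by rw [kp_eq, ha]; push_cast; ring⟩

lemma kp_cancel {x y : Ltr} {W0 W1 : List Ltr} (h : x :: W0 = W1 ++ [y]) :
    de x * kp W0 = de y * kp W1 := by
  have hl : W0.length = W1.length := by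
    have := congrArg List.length h
    simpa using this
  have hp := congrArg (fun l => (List.map de l).prod) h
  simp at hp
  rw [kp_eq, kp_eq, hl]
  linear_combination (dd ^ W1.length / (W1.length.factorial : ℂ)) * hp

lemma om_I (x : Ltr) {ρ : ℝ} (h : ρ ∈ Set.Ioo (0:ℝ) 1) :
    om x (Complex.I * ρ) * Complex.I = de x / ρ + fev (FF0 x) ρ := by
  have h0 : (ρ:ℂ) ≠ 0 := by exact_mod_cast h.1.ne'
  have e1 : (ρ:ℂ) - 1 ≠ 0 := by rw [sub_ne_zero]; exact_mod_cast h.2.ne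
  have e2 : (ρ:ℂ) + 1 ≠ 0 := by exact_mod_cast (by linarith [h.1] : ρ + 1 ≠ 0)
  have e3 : (ρ:ℂ) - Complex.I ≠ 0 := by
    intro h; have := congrArg Complex.im h; simp at this
  have hI := Complex.I_ne_zero
  have c1 : Complex.I * ρ + 1 = Complex.I * (ρ - Complex.I) := by linear_combination Complex.I_sq
  have c2 : Complex.I * ρ - Complex.I = Complex.I * (ρ - 1) := by ring
  have c3 : Complex.I * ρ + Complex.I = Complex.I * (ρ + 1) := by ring
  cases x
  all_goals
    simp only [om, fev, dl, VF0, FF0, List.map_cons, List.map_nil, List.sum_cons, List.sum_nil, Ltr.v,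
      sub_neg_eq_add, sub_zero, List.nil_append, List.cons_append, c1, c2, c3, de, reduceCtorEq,
      or_false, false_or, or_true, true_or, if_true, if_false]
    push_cast
    field_simp
    try ring

/-- The class of terms occurring in the evaluation. -/
def CA (W : List Ltr) (k : ℕ) (w : List Ltr) : Prop :=
  w ≠ [] ∧ Good w ∧ k + w.length = W.length ∧ (Ltr.z ∈ W → 1 ≤ k ∨ Ltr.z ∈ w) ∧
    (W.head? ≠ some .p → w.head? ≠ some .p)

lemma FF0_nz (x : Ltr) : ∀ a ∈ FF0 x, a.2 ≠ .z := by cases x <;> simp [FF0]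

lemma VF0_nz (x : Ltr) : ∀ a ∈ VF0 x, a.2 ≠ .z := by cases x <;> simp [VF0]

lemma FF_p (x : Ltr) (h : x ≠ .p) : ∀ a ∈ dl x ++ FF0 x, a.2 ≠ .p := by
  cases x <;> simp_all [FF0, dl]

lemma VF_p (x : Ltr) : ∀ a ∈ dl x ++ VF0 x, a.2 ≠ .p := by
  cases x <;> simp_all [VF0, dl]

lemma I_mem_BB {ρ : ℝ} (h : ρ ∈ Set.Ioo (0:ℝ) 1) : Complex.I * (ρ:ℂ) ∈ BB := by
  rw [mul_comm]
  exact sector_mem_BB (by simp) (by simp) (by simp) h.1 h.2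

lemma kp_Sp (W : List Ltr) : (fun _ => kp W) ∈ Sp (fun k w => k = W.length ∧ w = []) := by
  obtain ⟨a, ha⟩ := kp_rat W
  have := (Sp (fun k w => k = W.length ∧ w = [])).smul_mem a (Sp_mem (k := W.length) (w := []) ⟨rfl, rfl⟩)
  convert this using 1
  ext t
  simp [ha, Lf_nil, qsmul_eq]

lemma lim_zero_of_bound {g : ℝ → ℂ} (h : ∃ A : ℝ, ∀ t ∈ Set.Ioc (0:ℝ) (1/2), ‖g t‖ ≤ A * t) :
    Tendsto g (𝓝[>] 0) (𝓝 0) := by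
  obtain ⟨A, hA⟩ := h
  rw [tendsto_zero_iff_norm_tendsto_zero]
  have hl : Tendsto (fun ρ : ℝ => A * ρ) (𝓝[>] 0) (𝓝 0) := by
    have : Tendsto (fun ρ : ℝ => A * ρ) (𝓝 0) (𝓝 (A * 0)) := (continuous_const.mul continuous_id).tendsto 0
    rw [mul_zero] at this
    exact this.mono_left nhdsWithin_le_nhds
  refine tendsto_of_tendsto_of_tendsto_of_le_of_le' tendsto_const_nhds hl
    (Eventually.of_forall fun _ => norm_nonneg _) ?_
  filter_upwards [Ioc_mem_nhdsGT (by norm_num : (0:ℝ) < 1 / 2)] with ρ hρ using hA ρ hρ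

lemma JE_I {E : List Ltr → ℂ → ℂ} (hE : IsE E) (n : ℕ) : ∀ W : List Ltr, W.length = n →
    ∃ g ∈ Sp (CA W), ∀ ρ ∈ Set.Ioo (0:ℝ) 1, JE E W ρ (Complex.I * ρ) = kp W + g ρ := by
  induction n with
  | zero =>
    intro W hW
    obtain rfl := List.length_eq_zero_iff.mp hW
    exact ⟨0, Submodule.zero_mem _, fun ρ _ => by simp [JE_nil hE, kp, kap]⟩
  | succ n ih =>
    intro W hl
    have hne : W ≠ [] := by rintro rfl; simp at hl
    obtain ⟨x, W0, rfl⟩ := List.exists_cons_of_ne_nil hne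
    obtain ⟨W1, y, hy⟩ : ∃ W1 y, x :: W0 = W1 ++ [y] :=
      ⟨(x :: W0).dropLast, (x :: W0).getLast hne, (List.dropLast_append_getLast hne).symm⟩
    have hl0 : W0.length = n := by simpa using hl
    have hl1 : W1.length = n := by
      have := congrArg List.length hy
      simp at this; omega
    obtain ⟨g0, hg0, he0⟩ := ih W0 hl0
    obtain ⟨g1, hg1, he1⟩ := ih W1 hl1
    obtain ⟨a1, ha1, hd1, hb1⟩ := Sp_form (dl x ++ FF0 x) (fun _ _ _ k w hC => hC.1) hg0
    obtain ⟨a2, ha2, hd2, hb2⟩ := Sp_form (FF0 x) (fun a ha h => absurd h (FF0_nz x a ha)) (kp_Sp W0)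
    obtain ⟨a3, ha3, hd3, hb3⟩ := Sp_form (dl y ++ VF0 y) (fun _ _ _ k w hC => hC.1) hg1
    obtain ⟨a4, ha4, hd4, hb4⟩ := Sp_form (VF0 y) (fun a ha h => absurd h (VF0_nz y a ha)) (kp_Sp W1)
    have hz : Ltr.z ∈ x :: W0 → (Ltr.z ∈ W1 ∨ y = .z) := by
      intro h; rw [hy] at h; simpa [eq_comm] using h
    refine ⟨a1 + a2 - a3 - a4, ?_, ?_⟩
    · refine Submodule.sub_mem _ (Submodule.sub_mem _ (Submodule.add_mem _ ?_ ?_) ?_) ?_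
      · refine Sp_mono ?_ ha1
        rintro k _ ⟨a, ha, w0, rfl, hC⟩
        refine ⟨by simp, ⟨fun _ => hC.1, hC.2.1⟩, by have := hC.2.2.1; simp; omega, ?_, ?_⟩
        · intro h
          rcases List.mem_cons.mp h with h | h
          · subst h
            simp [dl, FF0] at ha
            right; simp [ha]
          · rcases hC.2.2.2.1 h with h | h
            · exact Or.inl h
            · right; simp [h]
        · intro h
          simp only [List.head?_cons, ne_eq, Option.some.injEq] at h ⊢
          exact FF_p x h a ha
      · refine Sp_mono ?_ ha2
        rintro k _ ⟨a, ha, w0, rfl, hC⟩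
        obtain ⟨rfl, rfl⟩ := hC
        refine ⟨by simp, ⟨fun h => absurd h (FF0_nz x a ha), trivial⟩, by simp, ?_, ?_⟩
        · intro h
          rcases W0 with _ | ⟨u, W0⟩
          · simp at h
            subst h
            simp [FF0] at ha
          · left; simp
        · intro h
          simp only [List.head?_cons, ne_eq, Option.some.injEq] at h ⊢
          exact FF_p x h a (List.mem_append_right _ ha)
      · refine Sp_mono ?_ ha3
        rintro k _ ⟨a, ha, w0, rfl, hC⟩
        refine ⟨by simp, ⟨fun _ => hC.1, hC.2.1⟩, by have := hC.2.2.1; simp; omega, ?_, ?_⟩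
        · intro h
          rcases hz h with h | h
          · rcases hC.2.2.2.1 h with h | h
            · exact Or.inl h
            · right; simp [h]
          · subst h
            simp [dl, VF0] at ha
            right; simp [ha]
        · intro h
          simp only [List.head?_cons, ne_eq, Option.some.injEq] at h ⊢
          exact VF_p y a ha
      · refine Sp_mono ?_ ha4
        rintro k _ ⟨a, ha, w0, rfl, hC⟩
        obtain ⟨rfl, rfl⟩ := hC
        refine ⟨by simp, ⟨fun h => absurd h (VF0_nz y a ha), trivial⟩, by simp; omega, ?_, ?_⟩
        · intro h
          rcases W1 with _ | ⟨u, W1⟩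
          · rcases hz h with h | h
            · simp at h
            · subst h
              simp [VF0] at ha
          · left; simp
        · intro h
          simp only [List.head?_cons, ne_eq, Option.some.injEq] at h ⊢
          exact VF_p y a (List.mem_append_right _ ha)
    · intro ρ hρ
      refine eq_of_deriv (f := fun ρ : ℝ => JE E (x :: W0) ρ (Complex.I * ρ))
        (g := fun ρ => kp (x :: W0) + (a1 + a2 - a3 - a4) ρ)
        (F := fun s : ℝ => om x (Complex.I * s) * (Complex.I * 1) * JE E W0 s (Complex.I * s)
          - om y s * 1 * JE E W1 s (Complex.I * s)) (l := kp (x :: W0)) ?_ ?_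
        (JE_I_tendsto hE _) ?_ ρ hρ
      · intro s hs
        have hc : HasDerivAt (fun s : ℝ => (s:ℂ)) 1 s := Complex.ofRealCLM.hasDerivAt
        exact JE_deriv hE hc (hc.const_mul Complex.I) (real_mem_BB ⟨hs.1, by linarith [hs.2]⟩)
          (I_mem_BB hs) hy
      · intro s hs
        have := ((((hd1 s hs).add (hd2 s hs)).sub (hd3 s hs)).sub (hd4 s hs)).const_add (kp (x :: W0))
        convert! this using 1
        have hs0 : (s:ℂ) ≠ 0 := by exact_mod_cast hs.1.ne'
        rw [mul_one, om_I x hs, he0 s hs, he1 s hs, om]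
        simp only [fev_append, dl_ev]
        linear_combination (1 / (s:ℂ)) * kp_cancel hy
      · have := (((lim_zero_of_bound hb1).add (lim_zero_of_bound hb2)).sub
          (lim_zero_of_bound hb3)).sub (lim_zero_of_bound hb4)
        have := this.const_add (kp (x :: W0))
        simpa using this

end MU4

open Filter Topology

namespace MU4

/-- Closed quarter of the unit circle. -/
def QC : Set ℂ := {u | ‖u‖ = 1 ∧ 0 ≤ u.re ∧ 0 ≤ u.im}

lemma QC_compact : IsCompact QC := by
  apply Metric.isCompact_of_isClosed_isBounded
  · refine IsClosed.inter (isClosed_eq continuous_norm continuous_const) (IsClosed.inter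
      (isClosed_le continuous_const Complex.continuous_re)
      (isClosed_le continuous_const Complex.continuous_im))
  · refine (Metric.isBounded_closedBall (x := (0:ℂ)) (r := 1)).subset ?_
    intro u hu
    simpa using hu.1.le

lemma div_bound {w c : ℂ} {m : ℝ} (hm : 0 < m) (hw : m ≤ ‖w‖) (hc : ‖c‖ = 1) : ‖c / w‖ ≤ 1 / m := by
  rw [norm_div, hc]
  exact one_div_le_one_div_of_le hm hw

lemma om_QC (x : Ltr) {u : ℂ} (hu : u ∈ QC) {ρ : ℝ} (h0 : 1 / 2 ≤ ρ) (h1 : ρ < 1) :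
    ‖om x (ρ * u)‖ ≤ 3 / (1 - ρ) ∧ (x ≠ .p → ‖om x (ρ * u)‖ ≤ 3) := by
  obtain ⟨hn, hr, hi⟩ := hu
  have d0 : 1 / 2 ≤ ‖(ρ:ℂ) * u - Ltr.z.v‖ := by
    simp only [Ltr.v, sub_zero, norm_mul, hn, Complex.norm_real, mul_one]
    exact h0.trans (le_abs_self _)
  have db : 1 - ρ ≤ ‖(ρ:ℂ) * u - Ltr.b.v‖ := by
    have := norm_sub_norm_le Ltr.b.v ((ρ:ℂ) * u)
    rw [Ltr.norm_v (by simp), norm_mul, hn, Complex.norm_real, mul_one,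
      Real.norm_of_nonneg (by linarith), norm_sub_rev] at this
    exact this
  have dq : 1 ≤ ‖(ρ:ℂ) * u - Ltr.q.v‖ := by
    refine le_trans ?_ (Complex.re_le_norm _)
    simp [Ltr.v]; nlinarith
  have dc : 1 ≤ ‖(ρ:ℂ) * u - Ltr.c.v‖ := by
    refine le_trans ?_ (Complex.im_le_norm _)
    simp [Ltr.v]; nlinarith
  have b0 : ‖(1:ℂ) / ((ρ:ℂ) * u - Ltr.z.v)‖ ≤ 2 := (div_bound (by norm_num) d0 (by simp)).trans (by norm_num)
  have bb : ‖(1:ℂ) / ((ρ:ℂ) * u - Ltr.b.v)‖ ≤ 1 / (1 - ρ) := div_bound (by linarith) db (by simp)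
  have bc : ‖(1:ℂ) / ((ρ:ℂ) * u - Ltr.c.v)‖ ≤ 1 := (div_bound (by norm_num) dc (by simp)).trans (by norm_num)
  have bq : ‖(-1:ℂ) / ((ρ:ℂ) * u - Ltr.q.v)‖ ≤ 1 := (div_bound (by norm_num) dq (by simp)).trans (by norm_num)
  have key : x ≠ .p → ‖om x (ρ * u)‖ ≤ 3 := by
    intro hx
    cases x <;> simp only [om, fev, dl, VF0, List.map_cons, List.map_nil, List.sum_cons, List.sum_nil,
      add_zero, List.nil_append, List.cons_append] <;> push_cast
    · linarith
    · exact absurd rfl hx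
    · exact (norm_add_le _ _).trans (by linarith)
    · exact (norm_add_le _ _).trans (by linarith)
    · linarith
  have h3 : 3 ≤ 3 / (1 - ρ) := by rw [le_div_iff₀ (by linarith)]; linarith
  refine ⟨?_, key⟩
  by_cases hx : x = .p
  · subst hx
    simp only [om, fev, dl, VF0, List.map_cons, List.map_nil, List.sum_cons, List.sum_nil,
      add_zero, List.nil_append, List.cons_append]
    push_cast
    refine (norm_add_le _ _).trans ?_
    have : 3 / (1 - ρ) = 3 * (1 / (1 - ρ)) := by ring
    linarith
  · exact (key hx).trans h3

lemma sq_deriv {s : ℝ} (h : s < 1) : HasDerivAt (fun s : ℝ => √(1 - s)) (-1 / (2 * √(1 - s))) s :=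
  ((hasDerivAt_id s).const_sub 1).sqrt (by simp; linarith)

lemma sqi_deriv {s : ℝ} (h : s < 1) :
    HasDerivAt (fun s : ℝ => (√(1 - s))⁻¹) (1 / (2 * √(1 - s) * (1 - s))) s := by
  have h1 : 0 < √(1 - s) := Real.sqrt_pos.mpr (by linarith)
  have := (sq_deriv h).inv h1.ne'
  convert! this using 1
  rw [Real.sq_sqrt (by linarith)]
  have : 1 - s ≠ 0 := by linarith
  field_simp

lemma E_ray {E : List Ltr → ℂ → ℂ} (hE : IsE E) (R : List Ltr) {u : ℂ} (hu : u ∈ QC) {s : ℝ}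
    (h0 : 1 / 2 ≤ s) (h1 : s < 1) :
    HasDerivAt (fun s : ℝ => E R (s * u)) (dE E (s * u) R * u) s := by
  have hc : HasDerivAt (fun s : ℝ => (s:ℂ) * u) u s := by
    simpa using (Complex.ofRealCLM.hasDerivAt (x := s)).mul_const u
  exact hE.comp R hc (sector_mem_BB hu.1 hu.2.1 hu.2.2 (by linarith) h1)

lemma E_growth {E : List Ltr → ℂ → ℂ} (hE : IsE E) (V : List Ltr) : ∃ C : ℝ, 0 ≤ C ∧
    ∀ u ∈ QC, ∀ ρ ∈ Set.Ico (1 / 2 : ℝ) 1, ‖E V (ρ * u)‖ ≤ C * (√(1 - ρ))⁻¹ := by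
  induction V with
  | nil =>
    refine ⟨1, zero_le_one, fun u _ ρ hρ => ?_⟩
    rw [hE.nil, norm_one, one_mul]
    have h1 : 0 < √(1 - ρ) := Real.sqrt_pos.mpr (by linarith [hρ.2])
    rw [one_le_inv₀ h1]
    exact Real.sqrt_le_one.mpr (by linarith [hρ.1])
  | cons x V ih =>
    obtain ⟨C, hC0, hC⟩ := ih
    obtain ⟨M, hM⟩ := QC_compact.exists_bound_of_continuousOn
      (f := fun u => E (x :: V) (((1 / 2 : ℝ) : ℂ) * u)) (by
        refine (hE.diff (x :: V)).continuousOn.comp (by fun_prop) ?_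
        intro u hu
        exact sector_mem_BB hu.1 hu.2.1 hu.2.2 (by norm_num) (by norm_num))
    refine ⟨6 * C + |M|, by positivity, fun u hu ρ hρ => ?_⟩
    refine image_norm_le_of_norm_deriv_right_le_deriv_boundary' (f := fun s : ℝ => E (x :: V) (s * u))
      (f' := fun s : ℝ => dE E (s * u) (x :: V) * u) (a := 1 / 2) (b := ρ)
      (B := fun s => (6 * C + |M|) * (√(1 - s))⁻¹)
      (B' := fun s => (6 * C + |M|) * (1 / (2 * √(1 - s) * (1 - s)))) ?_ ?_ ?_ ?_ ?_ ?_ ⟨hρ.1, le_rfl⟩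
    · intro s hs
      exact (E_ray hE _ hu hs.1 (hs.2.trans_lt hρ.2)).continuousAt.continuousWithinAt
    · intro s hs
      exact (E_ray hE _ hu hs.1 (hs.2.trans hρ.2)).hasDerivWithinAt
    · refine (hM u hu).trans ((le_abs_self M).trans ?_)
      have h1 : 0 < √(1 - 1 / 2 : ℝ) := Real.sqrt_pos.mpr (by norm_num)
      have h2 : 1 ≤ (√(1 - 1 / 2 : ℝ))⁻¹ := by
        rw [one_le_inv₀ h1]
        exact Real.sqrt_le_one.mpr (by norm_num)
      nlinarith [abs_nonneg M]
    · intro s hs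
      exact ((sqi_deriv (hs.2.trans_lt hρ.2)).const_mul _).continuousAt.continuousWithinAt
    · intro s hs
      exact ((sqi_deriv (hs.2.trans hρ.2)).const_mul _).hasDerivWithinAt
    · intro s hs
      have hs1 : s < 1 := hs.2.trans hρ.2
      have h1 : 0 < √(1 - s) := Real.sqrt_pos.mpr (by linarith)
      rw [norm_mul, hu.1, mul_one, dE, norm_mul]
      have h2 := (om_QC x hu hs.1 hs1).1
      have h3 := hC u hu s ⟨hs.1, hs1⟩
      calc ‖om x (s * u)‖ * ‖E V (s * u)‖ ≤ 3 / (1 - s) * (C * (√(1 - s))⁻¹) := by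
            gcongr
        _ = 6 * C * (1 / (2 * √(1 - s) * (1 - s))) := by
            have : 1 - s ≠ 0 := by linarith
            field_simp; ring
        _ ≤ _ := by
            have : 0 ≤ 1 / (2 * √(1 - s) * (1 - s)) := by
              have : 0 < 1 - s := by linarith
              positivity
            nlinarith [abs_nonneg M]

lemma E_hold {E : List Ltr → ℂ → ℂ} (hE : IsE E) {x : Ltr} (hx : x ≠ .p) (V : List Ltr) :
    ∃ C : ℝ, 0 ≤ C ∧ ∀ u ∈ QC, ∀ ρ ∈ Set.Ico (1 / 2 : ℝ) 1, ∀ σ ∈ Set.Ico ρ 1,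
      ‖E (x :: V) (σ * u) - E (x :: V) (ρ * u)‖ ≤ C * √(1 - ρ) := by
  obtain ⟨C, hC0, hC⟩ := E_growth hE V
  refine ⟨6 * C, by positivity, fun u hu ρ hρ σ hσ => ?_⟩
  have := image_norm_le_of_norm_deriv_right_le_deriv_boundary'
    (f := fun s : ℝ => E (x :: V) (s * u) - E (x :: V) (ρ * u))
    (f' := fun s : ℝ => dE E (s * u) (x :: V) * u) (a := ρ) (b := σ)
    (B := fun s => 6 * C * (√(1 - ρ) - √(1 - s)))
    (B' := fun s => 6 * C * (-(-1 / (2 * √(1 - s))))) ?_ ?_ ?_ ?_ ?_ ?_ ⟨hσ.1, le_rfl⟩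
  · refine this.trans ?_
    have := Real.sqrt_nonneg (1 - σ)
    nlinarith
  · intro s hs
    exact ((E_ray hE _ hu (hρ.1.trans hs.1) (hs.2.trans_lt hσ.2)).sub_const _).continuousAt.continuousWithinAt
  · intro s hs
    exact ((E_ray hE _ hu (hρ.1.trans hs.1) (hs.2.trans hσ.2)).sub_const _).hasDerivWithinAt
  · simp
  · intro s hs
    exact (((sq_deriv (hs.2.trans_lt hσ.2)).const_sub _).const_mul _).continuousAt.continuousWithinAt
  · intro s hs
    exact (((sq_deriv (hs.2.trans hσ.2)).const_sub _).const_mul _).hasDerivWithinAt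
  · intro s hs
    have hs1 : s < 1 := hs.2.trans hσ.2
    have hs0 := hρ.1.trans hs.1
    have h1 : 0 < √(1 - s) := Real.sqrt_pos.mpr (by linarith)
    rw [norm_mul, hu.1, mul_one, dE, norm_mul]
    have h2 := (om_QC x hu hs0 hs1).2 hx
    have h3 := hC u hu s ⟨hs0, hs1⟩
    calc ‖om x (s * u)‖ * ‖E V (s * u)‖ ≤ 3 * (C * (√(1 - s))⁻¹) := by
            gcongr
      _ = 6 * C * (-(-1 / (2 * √(1 - s)))) := by
            field_simp; ring

lemma cay_QC {t : ℝ} (h0 : 0 ≤ t) (h1 : t < 1) : cay t ∈ QC :=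
  ⟨cay_norm t, (cay_re h0 h1).le, cay_im h0⟩

lemma I_QC : Complex.I ∈ QC := ⟨by simp, by simp, by simp⟩

lemma E_I_lim {E : List Ltr → ℂ → ℂ} (hE : IsE E) {x : Ltr} (hx : x ≠ .p) (V : List Ltr) {Z : ℂ}
    (hZ : Tendsto (fun t => E (x :: V) (cay t)) (𝓝[<] 1) (𝓝 Z)) :
    Tendsto (fun ρ : ℝ => E (x :: V) (Complex.I * ρ)) (𝓝[<] 1) (𝓝 Z) := by
  obtain ⟨C, hC0, hC⟩ := E_hold hE hx V
  have h1 : ∀ ρ ∈ Set.Ico (1 / 2 : ℝ) 1, ∀ t ∈ Set.Ioo (0:ℝ) 1,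
      ‖E (x :: V) (cay t) - E (x :: V) (ρ * cay t)‖ ≤ C * √(1 - ρ) := by
    intro ρ hρ t ht
    have hl : Tendsto (fun σ : ℝ => ‖E (x :: V) (σ * cay t) - E (x :: V) (ρ * cay t)‖) (𝓝[<] 1)
        (𝓝 ‖E (x :: V) (cay t) - E (x :: V) (ρ * cay t)‖) := by
      have hc : ContinuousAt (E (x :: V)) (((1:ℝ):ℂ) * cay t) := by
        simpa using (hE.hasDeriv (x :: V) (cay_mem_BB ht.1.le ht.2)).continuousAt
      have hc2 : ContinuousAt (fun σ : ℝ => E (x :: V) (σ * cay t)) 1 :=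
        ContinuousAt.comp (f := fun σ : ℝ => (σ:ℂ) * cay t) hc (by fun_prop)
      have := hc2.tendsto.mono_left (nhdsWithin_le_nhds (s := Set.Iio 1))
      simp only [Complex.ofReal_one, one_mul] at this
      exact (this.sub_const _).norm
    refine le_of_tendsto hl ?_
    filter_upwards [Ico_mem_nhdsLT hρ.2] with σ hσ
    exact hC _ (cay_QC ht.1.le ht.2) ρ hρ σ hσ
  have h2 : ∀ ρ ∈ Set.Ico (1 / 2 : ℝ) 1, ‖E (x :: V) (Complex.I * ρ) - Z‖ ≤ C * √(1 - ρ) := by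
    intro ρ hρ
    have hc1 : cay 1 = Complex.I := by
      rw [cay_eq]; norm_num; rfl
    have hc : ContinuousAt (E (x :: V)) (ρ * cay 1) := by
      rw [hc1, mul_comm]
      exact (hE.hasDeriv (x :: V) (I_mem_BB ⟨by linarith [hρ.1], hρ.2⟩)).continuousAt
    have hc2 : ContinuousAt (fun t : ℝ => E (x :: V) (ρ * cay t)) 1 :=
      ContinuousAt.comp (f := fun t : ℝ => (ρ:ℂ) * cay t) hc
        (continuousAt_const.mul (cay_deriv 1).continuousAt)
    have hl := (hZ.sub (hc2.tendsto.mono_left (nhdsWithin_le_nhds (s := Set.Iio 1)))).norm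
    rw [hc1, mul_comm] at hl
    rw [norm_sub_rev]
    refine le_of_tendsto hl ?_
    filter_upwards [Ioo_mem_nhdsLT (zero_lt_one' ℝ)] with t ht
    exact h1 ρ hρ t ht
  rw [tendsto_iff_norm_sub_tendsto_zero]
  have hl : Tendsto (fun ρ : ℝ => C * √(1 - ρ)) (𝓝[<] 1) (𝓝 0) := by
    have : ContinuousAt (fun ρ : ℝ => C * √(1 - ρ)) 1 := by fun_prop
    have := this.tendsto
    simp only [sub_self, Real.sqrt_zero, mul_zero] at this
    exact this.mono_left nhdsWithin_le_nhds
  refine tendsto_of_tendsto_of_tendsto_of_le_of_le' tendsto_const_nhds hl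
    (Eventually.of_forall fun _ => norm_nonneg _) ?_
  filter_upwards [Ico_mem_nhdsLT (by norm_num : (1 / 2 : ℝ) < 1)] with ρ hρ using h2 ρ hρ

lemma JJ_tendsto {ι : Type*} {l : Filter ι} (f : ι → List Ltr → ℂ) (hf0 : ∀ s, f s [] = 1)
    (W : List Ltr) : ∀ (g : ι → List Ltr → ℂ) (Z : ℂ),
    (∀ V1 V2, V2 ≠ [] → Tendsto (fun s => f s V2 * g s V1) l (𝓝 0)) →
    Tendsto (fun s => g s W) l (𝓝 Z) → Tendsto (fun s => JJ (f s) (g s) W) l (𝓝 Z) := by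
  induction W with
  | nil => intro g Z _ h; simpa [JJ, hf0] using h
  | cons x W ih =>
    intro g Z h hZ
    simp only [JJ]
    have h1 := h [] (x :: W) (by simp)
    have h2 := ih (fun s U => g s (x :: U)) Z (fun V1 V2 hV => h (x :: V1) V2 hV) hZ
    simpa using h1.add h2

lemma JE_I_lim {E : List Ltr → ℂ → ℂ} (hE : IsE E) {x : Ltr} (hx : x ≠ .p) (V : List Ltr) {Z : ℂ}
    (hZ : Tendsto (fun t => E (x :: V) (cay t)) (𝓝[<] 1) (𝓝 Z)) :
    Tendsto (fun ρ : ℝ => JE E (x :: V) ρ (Complex.I * ρ)) (𝓝[<] 1) (𝓝 Z) := by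
  refine JJ_tendsto (fun (ρ : ℝ) U => (-1) ^ U.length * E U.reverse ρ) (by simp [hE.nil]) (x :: V)
    (fun (ρ : ℝ) U => E U (Complex.I * ρ)) Z ?_ (E_I_lim hE hx V hZ)
  intro V1 V2 hV2
  obtain ⟨C, hC0, hC⟩ := E_growth hE V1
  obtain ⟨y, R, hR⟩ := List.exists_cons_of_ne_nil (l := V2.reverse) (by simpa using hV2)
  rw [hR]
  have hc : HasDerivAt (fun s : ℝ => (s:ℂ)) 1 1 := Complex.ofRealCLM.hasDerivAt
  have hd := hE.comp (y :: R) hc (by simpa using one_mem_BB)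
  have hO := hd.isBigO_sub
  simp only [Complex.ofReal_one, hE.base, sub_zero] at hO
  obtain ⟨A, hA⟩ := hO.bound
  rw [tendsto_zero_iff_norm_tendsto_zero]
  have hl : Tendsto (fun ρ : ℝ => A * C * √(1 - ρ)) (𝓝[<] 1) (𝓝 0) := by
    have : ContinuousAt (fun ρ : ℝ => A * C * √(1 - ρ)) 1 := by fun_prop
    have := this.tendsto
    simp only [sub_self, Real.sqrt_zero, mul_zero] at this
    exact this.mono_left nhdsWithin_le_nhds
  refine tendsto_of_tendsto_of_tendsto_of_le_of_le' tendsto_const_nhds hl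
    (Eventually.of_forall fun _ => norm_nonneg _) ?_
  filter_upwards [Ico_mem_nhdsLT (by norm_num : (1 / 2 : ℝ) < 1), hA.filter_mono nhdsWithin_le_nhds]
    with ρ hρ h1
  have h2 := hC Complex.I I_QC ρ hρ
  rw [mul_comm (ρ:ℂ)] at h2
  have hs : 0 < √(1 - ρ) := Real.sqrt_pos.mpr (by linarith [hρ.2])
  have e : ‖ρ - 1‖ = √(1 - ρ) * √(1 - ρ) := by
    rw [Real.mul_self_sqrt (by linarith [hρ.2]), Real.norm_of_nonpos (by linarith [hρ.2])]; ring
  rw [e] at h1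
  rw [norm_mul, norm_mul, norm_pow, norm_neg, norm_one, one_pow, one_mul]
  calc _ ≤ A * (√(1 - ρ) * √(1 - ρ)) * (C * (√(1 - ρ))⁻¹) := by
        gcongr
        exact (norm_nonneg _).trans h1
    _ = _ := by field_simp

end MU4

open Filter Topology

namespace MU4

lemma one_of_split (B : List Ltr) (hB : Ltr.z ∉ B) : ∀ A, Ltr.z ∉ A → One (A ++ .z :: B) := by
  have hB' : ∀ B, Ltr.z ∉ B → One B := by
    intro B
    induction B with
    | nil => intro _; trivial
    | cons x B ih =>
      intro hB
      simp only [List.mem_cons, not_or] at hB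
      exact ⟨fun _ => hB.2, ih hB.2⟩
  intro A hA
  induction A with
  | nil => exact ⟨fun _ => hB, hB' B hB⟩
  | cons x A ih =>
    simp only [List.mem_cons, not_or] at hA
    exact ⟨fun e => absurd e.symm hA.1, ih hA.2⟩

/-- The inductive statement. -/
def PP (m : ℕ) : Prop := ∀ w, Ltr.z ∉ w → w.length = m → Adm w → val w ∈ VV m

lemma dd_VV_one : dd ∈ VV 1 := by simpa using XX_dd_VV 1

lemma dd_pow_VV {n : ℕ} (h : 1 ≤ n) : dd ^ n ∈ VV n := by
  rcases Nat.eq_or_lt_of_le h with h | h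
  · rw [← h, pow_one]; exact dd_VV_one
  · exact Zw_le_VV _ (dd_pow_mem h)

lemma SV_CA_le {W : List Ltr} (hz : Ltr.z ∈ W) (hp : W.head? ≠ some .p)
    (ih : ∀ m < W.length, 1 ≤ m → PP m) : SV (CA W) ≤ VV W.length := by
  unfold SV
  rw [Submodule.span_le]
  rintro v ⟨k, w, ⟨hne, hg, hl, hzz, hhp⟩, rfl⟩
  have hw1 : 1 ≤ w.length := List.length_pos_iff.mpr hne
  have ha : Adm w := adm_iff.mpr (hhp hp)
  rcases Nat.lt_or_ge k 2 with hk | hk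
  · interval_cases k
    · have h1 : Ltr.z ∈ w := by simpa using hzz hz
      have := nz_lt h1
      refine Zw_le_VV _ ?_
      rw [pow_zero, one_mul]
      exact val_mem_Zw hg ha (by omega) (by omega)
    · by_cases h1 : Ltr.z ∈ w
      · have h2 := nz_lt h1
        have h3 := Zw_mul dd_mem (val_mem_Zw (K := w.length) (s := w.length - 1) hg ha rfl (by omega))
        refine Zw_le_VV _ ?_
        rw [pow_one]
        have e1 : 1 + (w.length - 1) = W.length - 1 := by omega
        rw [hl, e1] at h3
        exact h3
      · have := VV_mul le_rfl hw1 dd_VV_one (ih w.length (by omega) hw1 w h1 rfl ha)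
        rw [pow_one]
        rw [hl] at this
        exact this
  · refine Zw_le_VV _ ?_
    have h3 := Zw_mul (dd_pow_mem hk) (val_mem_Zw (K := w.length) (s := w.length) hg ha rfl (nz_le w))
    have e1 : k - 1 + w.length = W.length - 1 := by omega
    rw [hl, e1] at h3
    exact h3

lemma stepA (X Y : List Ltr) (hX : Ltr.z ∉ X) (hY : Ltr.z ∉ Y) (hp : (X ++ [Ltr.z]).head? ≠ some .p)
    (ih : ∀ m < X.length + Y.length + 1, 1 ≤ m → PP m) :
    val (X ++ .b :: Y) - val (X ++ .c :: Y) ∈ VV (X.length + Y.length + 1) := by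
  obtain ⟨E, h1, h2, h3⟩ := exists_E
  have hE : IsE E := ⟨h1, h2, fun y R => (h3 y R).1, fun y R => (h3 y R).2⟩
  set W := X ++ .z :: Y with hW
  have hlen : W.length = X.length + Y.length + 1 := by simp [hW]; omega
  have hhead : W.head? = (X ++ [Ltr.z]).head? := by rw [hW]; cases X <;> simp
  have hone : One W := one_of_split Y hY X hX
  have hz : Ltr.z ∈ W := by simp [hW]
  have e : ∀ y, sbz y W = X ++ y :: Y := by
    intro y
    have e1 := sbz_of_not_mem (y := y) hX
    have e2 := sbz_of_not_mem (y := y) hY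
    rw [hW]
    unfold sbz at *
    simp [e1, e2]
  have hadm : ∀ y, y ≠ Ltr.p → Adm (X ++ y :: Y) := by
    intro y hy
    rw [adm_iff]
    cases X with
    | nil => simpa using hy
    | cons a X => simpa using hp
  obtain ⟨x, V, hxV⟩ : ∃ x V, W = x :: V := List.exists_cons_of_ne_nil (by simp [hW])
  have hx : x ≠ .p := by
    rw [← hhead, hxV] at hp; simpa using hp
  have hZ : Tendsto (fun t => E W (cay t)) (𝓝[<] 1) (𝓝 (val (X ++ .b :: Y) - val (X ++ .c :: Y))) := by
    refine tendsto_congr_Ioo (f := TT .b .c W) (fun t ht => (E_cay hE W hone t ht).symm) ?_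
    have : TT .b .c W = fun t => Lf (X ++ .b :: Y) t - Lf (X ++ .c :: Y) t := by
      ext t; simp [TT, hz, e]
    rw [this]
    exact (Lf_tendsto (hadm _ (by simp))).sub (Lf_tendsto (hadm _ (by simp)))
  obtain ⟨g, hg, hgE⟩ := JE_I hE W.length W rfl
  have hCA : ∀ k w, CA W k w → Adm w := fun k w hC => adm_iff.mpr (hC.2.2.2.2 (by rw [hhead]; exact hp))
  obtain ⟨l, hl, hlt⟩ := Sp_lim hCA hg
  have hlim1 : Tendsto (fun ρ : ℝ => JE E W ρ (Complex.I * ρ)) (𝓝[<] 1)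
      (𝓝 (val (X ++ .b :: Y) - val (X ++ .c :: Y))) := by
    rw [hxV] at hZ ⊢
    exact JE_I_lim hE hx V hZ
  have hlim2 : Tendsto (fun ρ : ℝ => JE E W ρ (Complex.I * ρ)) (𝓝[<] 1) (𝓝 (kp W + l)) :=
    tendsto_congr_Ioo (fun t ht => (hgE t ht).symm) (hlt.const_add (kp W))
  rw [tendsto_nhds_unique hlim1 hlim2, ← hlen]
  refine Submodule.add_mem _ ?_ (SV_CA_le hz (by rw [hhead]; exact hp) (by rw [hlen]; exact ih) hl)
  obtain ⟨a, ha⟩ := kp_rat W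
  rw [ha, ← qsmul_eq]
  exact Submodule.smul_mem _ _ (dd_pow_VV (by omega))

end MU4

open Filter Topology

namespace MU4

/-- Representative letters. -/
def rep : Ltr → Ltr
  | .p => .q
  | .c => .b
  | x => x

lemma rep_p (x : Ltr) : rep x ≠ .p := by cases x <;> simp [rep]

lemma rep_z {x : Ltr} (h : x ≠ .z) : rep x ≠ .z := by cases x <;> simp_all [rep]

lemma step_one {r : ℕ} (ih : ∀ m < r, 1 ≤ m → PP m) (X : List Ltr) (a : Ltr) (A : List Ltr)
    (hz : Ltr.z ∉ X ++ a :: A) (hl : (X ++ a :: A).length = r) (ha : Adm (X ++ a :: A)) :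
    val (X ++ a :: A) - val (X ++ rep a :: A) ∈ VV r := by
  simp only [List.mem_append, List.mem_cons, not_or] at hz
  obtain ⟨hX, h0, hA⟩ := hz
  simp only [List.length_append, List.length_cons] at hl
  rw [adm_iff] at ha
  cases a
  · simp at h0
  · rcases X with _ | ⟨h, X⟩
    · simp at ha
    · simp only [List.mem_cons, not_or] at hX
      have := stepB' h (by simpa using ha) (Ne.symm hX.1) X A hX.2 hA
      simp only [List.length_cons] at hl
      have e1 : X.length + A.length + 2 = r := by omega
      have e2 : X.length + A.length + 1 = r - 1 := by omega
      rw [e1, e2] at this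
      exact Zw_le_VV _ this
  · simp [rep]
  · simp [rep]
  · have := stepA X A hX hA (by cases X <;> simp_all) (by rw [show X.length + A.length + 1 = r by omega]; exact ih)
    rw [show X.length + A.length + 1 = r by omega] at this
    have := Submodule.neg_mem _ this
    rw [neg_sub] at this
    exact this

lemma adm_rep {X : List Ltr} {a : Ltr} {A : List Ltr} (ha : Adm (X ++ a :: A)) :
    Adm (X ++ rep a :: A) := by
  rw [adm_iff] at *
  cases X with
  | nil => simpa using rep_p a
  | cons h X => simpa using ha

lemma rep_all {r : ℕ} (ih : ∀ m < r, 1 ≤ m → PP m) (A : List Ltr) : ∀ (X : List Ltr),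
    Ltr.z ∉ X ++ A → (X ++ A).length = r → Adm (X ++ A) →
    val (X ++ A) - val (X ++ A.map rep) ∈ VV r := by
  induction A with
  | nil => intro X _ _ _; simp
  | cons a A ihA =>
    intro X hz hl ha
    have h1 := step_one ih X a A hz hl ha
    have h2 := ihA (X ++ [rep a]) (by
      simp only [List.append_assoc, List.singleton_append, List.mem_append, List.mem_cons, not_or] at hz ⊢
      exact ⟨hz.1, (rep_z (Ne.symm hz.2.1)).symm, hz.2.2⟩) (by simpa using hl)
      (by simpa using adm_rep ha)
    simp only [List.append_assoc, List.singleton_append] at h2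
    have := Submodule.add_mem _ h1 h2
    simpa using this

lemma rep_cong {r : ℕ} (ih : ∀ m < r, 1 ≤ m → PP m) {w w' : List Ltr} (hz : Ltr.z ∉ w)
    (hz' : Ltr.z ∉ w') (hl : w.length = r) (hl' : w'.length = r) (ha : Adm w) (ha' : Adm w')
    (he : w.map rep = w'.map rep) : val w - val w' ∈ VV r := by
  have h1 := rep_all ih w [] hz hl ha
  have h2 := rep_all ih w' [] hz' hl' ha'
  have := Submodule.sub_mem _ h1 h2
  simpa [he] using this

lemma sum_cong {V : Submodule ℚ ℂ} (l : List (List Ltr)) (c : ℂ) (h : ∀ v ∈ l, val v - c ∈ V) :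
    (l.map val).sum - l.length * c ∈ V := by
  induction l with
  | nil => simp
  | cons v l ihl =>
    have h1 := h v List.mem_cons_self
    have h2 := ihl fun u hu => h u (List.mem_cons_of_mem _ hu)
    convert Submodule.add_mem _ h1 h2 using 1
    simp only [List.map_cons, List.sum_cons, List.length_cons]
    push_cast; ring

lemma sum_mem' {V : Submodule ℚ ℂ} (l : List (List Ltr)) (h : ∀ v ∈ l, val v ∈ V) :
    (l.map val).sum ∈ V := by
  simpa using sum_cong l 0 (by simpa using h)

lemma nat_cancel {V : Submodule ℚ ℂ} {n : ℕ} (hn : n ≠ 0) {v : ℂ} (h : (n:ℂ) * v ∈ V) : v ∈ V := by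
  have := V.smul_mem (n:ℚ)⁻¹ h
  rw [qsmul_eq] at this
  have hn' : (n:ℂ) ≠ 0 := by exact_mod_cast hn
  convert this using 1
  push_cast
  field_simp

lemma pow_VV {v : ℂ} (h : v ∈ VV 1) {n : ℕ} (hn : 1 ≤ n) : v ^ n ∈ VV n := by
  induction n, hn using Nat.le_induction with
  | base => simpa using h
  | succ n hn ih => rw [pow_succ]; exact VV_mul hn le_rfl ih h

lemma val_q_VV : val [.q] ∈ VV 1 := by
  rw [val_q]
  refine Submodule.sub_mem _ ?_ dd_VV_one
  have := (VV 1).smul_mem (2:ℚ) (XX_pow_VV 1)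
  rw [qsmul_eq] at this
  simpa using this

lemma val_qq {r : ℕ} (hr : 1 ≤ r) : val (List.replicate r .q) ∈ VV r := by
  apply nat_cancel (Nat.factorial_ne_zero r)
  rw [← val_pow (by simp) (by simp)]
  exact pow_VV val_q_VV hr

/-- Preimage letters for the doubling relation. -/
def til : Ltr → Ltr
  | .b => .q
  | _ => .p

lemma ex_mem (w : List Ltr) (hw : ∀ x ∈ w, x = .q ∨ x = .b) : ∀ v ∈ ex (w.map til),
    v.map rep = w ∧ Ltr.z ∉ v := by
  induction w with
  | nil => intro v hv; simp [ex] at hv; simp [hv]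
  | cons x w ihw =>
    have ih := ihw fun y hy => hw y (List.mem_cons_of_mem _ hy)
    intro v hv
    rcases hw x List.mem_cons_self with rfl | rfl
    · simp only [List.map_cons, til, ex, List.mem_append, List.mem_map] at hv
      rcases hv with ⟨u, hu, rfl⟩ | ⟨u, hu, rfl⟩ <;> simp [rep, ih u hu]
    · simp only [List.map_cons, til, ex, List.mem_append, List.mem_map] at hv
      rcases hv with ⟨u, hu, rfl⟩ | ⟨u, hu, rfl⟩ <;> simp [rep, ih u hu]

lemma ex_ne (w : List Ltr) : ex w ≠ [] := by
  induction w with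
  | nil => simp [ex]
  | cons x w ih => cases x <;> simp [ex, ih]

lemma case_b {r : ℕ} (ih : ∀ m < r, 1 ≤ m → PP m) (w1 : List Ltr) (hw : ∀ x ∈ w1, x = .q ∨ x = .b)
    (hl : w1.length + 1 = r) : val (.b :: w1) ∈ VV r := by
  have hwt : ∀ x ∈ w1.map til, x = .p ∨ x = .q := by
    intro x hx
    obtain ⟨y, hy, rfl⟩ := List.mem_map.mp hx
    rcases hw y hy with rfl | rfl <;> simp [til]
  have hzw : Ltr.z ∉ w1 := fun h => by rcases hw _ h with h | h <;> simp at h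
  have h1 := val_ex (w1.map til) hwt
  have h2 : val (.q :: w1.map til) ∈ VV r := by
    have : val (.q :: w1.map til) - val (List.replicate r .q) ∈ VV r := by
      refine rep_cong ih ?_ ?_ (by simpa using hl) (by simp) (adm_cons.mpr (by simp)) ?_ ?_
      · intro h
        rcases List.mem_cons.mp h with h | h
        · simp at h
        · rcases hwt _ h with h | h <;> simp at h
      · simp
      · rw [adm_iff]; subst hl; simp [List.replicate_succ]
      · subst hl
        rw [List.replicate_succ, List.map_cons, List.map_cons]
        congr 1
        rw [List.map_replicate, List.map_map, List.eq_replicate_iff]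
        refine ⟨by simp, ?_⟩
        intro x hx
        obtain ⟨y, hy, rfl⟩ := List.mem_map.mp hx
        rcases hw y hy with rfl | rfl <;> simp [til, rep]
    have h3 := Submodule.add_mem _ this (val_qq (r := r) (by omega))
    simpa using h3
  have h4 := ex_mem (.b :: w1) (by simpa using hw)
  have e : ex ((Ltr.b :: w1).map til) = ex (.q :: w1.map til) := rfl
  have h5 : ∀ v ∈ ex (.q :: w1.map til), val v - val (.b :: w1) ∈ VV r := by
    intro v hv
    obtain ⟨hm, hz⟩ := h4 v (e ▸ hv)
    have hlen : v.length = r := by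
      have := congrArg List.length hm
      simp at this; omega
    refine rep_cong ih hz (by simp [hzw]) hlen (by simpa using hl) ?_ (adm_cons.mpr (by simp)) ?_
    · rw [adm_iff]
      simp only [ex, List.mem_append, List.mem_map] at hv
      rcases hv with ⟨u, hu, rfl⟩ | ⟨u, hu, rfl⟩ <;> simp
    · rw [hm, List.map_cons]
      congr 1
      rw [List.map_congr_left (g := id)]
      · simp
      · intro x hx
        rcases hw x hx with rfl | rfl <;> simp [rep]
  have h6 := sum_cong _ _ h5
  rw [← h1] at h6
  have h7 := Submodule.sub_mem _ h2 h6
  rw [sub_sub_cancel] at h7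
  exact nat_cancel (by simpa using ex_ne _) h7

lemma ins_mem (x : Ltr) (w : List Ltr) : ∀ v ∈ ins x w, v.length = w.length + 1 ∧
    ∀ y ∈ v, y = x ∨ y ∈ w := by
  induction w with
  | nil => intro v hv; simp [ins] at hv; simp [hv]
  | cons a w ih =>
    intro v hv
    simp only [ins, List.mem_cons, List.mem_map] at hv
    rcases hv with rfl | ⟨u, hu, rfl⟩
    · simp
    · obtain ⟨h1, h2⟩ := ih u hu
      refine ⟨by simp [h1], ?_⟩
      intro y hy
      rcases List.mem_cons.mp hy with rfl | hy
      · simp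
      · rcases h2 y hy with h | h <;> simp [h]

lemma case_q {r : ℕ} (ih : ∀ m < r, 1 ≤ m → PP m) (k : ℕ) : ∀ (w1 : List Ltr),
    (∀ x ∈ w1, x = .q ∨ x = .b) → k + w1.length + 1 = r →
    val (List.replicate k .q ++ .b :: w1) ∈ VV r := by
  induction k with
  | zero => intro w1 hw hl; simpa using case_b ih w1 hw (by omega)
  | succ k ihk =>
    intro w1 hw hl
    have hzw : Ltr.z ∉ w1 := fun h => by rcases hw _ h with h | h <;> simp at h
    have hz : Ltr.z ∉ List.replicate k Ltr.q ++ .b :: w1 := by simp [hzw]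
    have ha : Adm (List.replicate k Ltr.q ++ .b :: w1) := by
      rw [adm_iff]; cases k <;> simp [List.replicate_succ]
    have hlen : (List.replicate k Ltr.q ++ .b :: w1).length = r - 1 := by simp; omega
    have h1 := val_ins (x := .q) (by simp) (by simp) hz ha
    rw [ins_replicate] at h1
    have h2 : val [.q] * val (List.replicate k Ltr.q ++ .b :: w1) ∈ VV r := by
      have := VV_mul le_rfl (by omega : 1 ≤ r - 1) val_q_VV
        (ih (r - 1) (by omega) (by omega) _ hz hlen ha)
      rwa [show 1 + (r - 1) = r by omega] at this
    simp only [ins, List.map_cons, List.sum_cons, List.map_map] at h1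
    have e : List.replicate k Ltr.q ++ .q :: .b :: w1 = List.replicate (k + 1) Ltr.q ++ .b :: w1 := by
      rw [List.replicate_succ']; simp
    rw [e] at h1
    have h3 : (((ins .q w1).map fun w' => List.replicate k Ltr.q ++ .b :: w').map val).sum ∈ VV r := by
      apply sum_mem'
      intro v hv
      obtain ⟨u, hu, rfl⟩ := List.mem_map.mp hv
      obtain ⟨hu1, hu2⟩ := ins_mem _ _ u hu
      refine ihk u ?_ (by omega)
      intro x hx
      rcases hu2 x hx with h | h
      · exact Or.inl h
      · exact hw x h
    apply nat_cancel (Nat.succ_ne_zero k)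
    have h4 := Submodule.sub_mem _ h2 h3
    convert h4 using 1
    rw [h1, List.map_map]
    push_cast
    have : (val ∘ (fun x => List.replicate k Ltr.q ++ x) ∘ fun x => Ltr.b :: x)
      = (val ∘ fun w' => List.replicate k Ltr.q ++ .b :: w') := rfl
    rw [this]
    ring

lemma qb_form (w : List Ltr) (hw : ∀ x ∈ w, x = .q ∨ x = .b) :
    w = List.replicate w.length .q ∨ ∃ k w1, w = List.replicate k .q ++ .b :: w1 := by
  induction w with
  | nil => simp
  | cons x w ih =>
    rcases hw x List.mem_cons_self with rfl | rfl
    · rcases ih fun y hy => hw y (List.mem_cons_of_mem _ hy) with h | ⟨k, w1, h⟩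
      · left; rw [List.length_cons, List.replicate_succ, ← h]
      · right; exact ⟨k + 1, w1, by rw [h, List.replicate_succ, List.cons_append]⟩
    · right; exact ⟨0, w, rfl⟩

lemma PP_all (r : ℕ) : 1 ≤ r → PP r := by
  induction r using Nat.strong_induction_on with
  | _ r ih0 =>
    intro hr w hz hl ha
    have ih : ∀ m < r, 1 ≤ m → PP m := fun m hm h => ih0 m hm h
    have h1 := rep_all ih w [] hz hl ha
    simp only [List.nil_append] at h1
    suffices h : val (w.map rep) ∈ VV r by
      simpa using Submodule.add_mem _ h1 h
    have hw : ∀ x ∈ w.map rep, x = .q ∨ x = .b := by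
      intro x hx
      obtain ⟨y, hy, rfl⟩ := List.mem_map.mp hx
      cases y <;> simp_all [rep]
    rcases qb_form _ hw with h | ⟨k, w1, h⟩
    · rw [h, List.length_map, hl]; exact val_qq hr
    · have hlen := congrArg List.length h
      simp at hlen
      rw [h] at hw ⊢
      exact case_q ih k w1 (fun x hx => hw x (by simp [hx])) (by omega)

end MU4

open Filter Topology

namespace MU4

lemma binom_cong {r : ℕ} (hr : 1 ≤ r) :
    (XX - dd) ^ r - XX ^ r + r * (XX ^ (r - 1) * dd) ∈ Zw r (r - 1) := by
  induction r, hr using Nat.le_induction with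
  | base => simp
  | succ r hr ih =>
    have h1 := Zw_mul ih (Submodule.sub_mem _ XX_mem dd_mem)
    have h2 := Zw_mul (pow_mem_Zw XX_mem (r - 1)) (dd_pow_mem (le_refl 2))
    rw [show r - 1 + 2 = r + 1 by omega, show r - 1 + (2 - 1) = r + 1 - 1 by omega] at h2
    rw [show r - 1 + 1 = r + 1 - 1 by omega] at h1
    have h3 := Submodule.add_mem _ h1 (Submodule.smul_mem _ (r:ℚ) h2)
    rw [qsmul_eq] at h3
    convert h3 using 1
    obtain ⟨m, rfl⟩ : ∃ m, r = m + 1 := ⟨r - 1, by omega⟩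
    simp only [Nat.add_sub_cancel]
    push_cast
    ring

end MU4

theorem unit_cmzv_depth_graded_mu4 (r : ℕ) (hr : 1 ≤ r)
    (ε : Fin r → ℂ) (hε : ∀ i, ε i ^ 4 = 1)
    (hlast : ε ⟨r - 1, by omega⟩ ≠ 1)
    (z zp zm : ℂ)
    (hz : Tendsto (cmzvPartial r (fun _ => 1) ε) atTop (𝓝 z))
    (hzp : Tendsto
      (cmzvPartial r (fun _ => 1)
        (fun i => if (i : ℕ) = r - 1 then Complex.I else 1))
      atTop (𝓝 zp))
    (hzm : Tendsto
      (cmzvPartial r (fun _ => 1)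
        (fun i => if (i : ℕ) = r - 1 then -Complex.I else 1))
      atTop (𝓝 zm)) :
    ∃ a b : ℚ, z - (a : ℂ) * zp - (b : ℂ) * zm ∈ depthFilteredCMZV 4 r (r - 1) := by
  obtain ⟨w, hw1, hw2, hw3, hw⟩ := MU4.unit_value hr hε hlast hz
  have hp := MU4.special_value .c (by simp) (by simp) hr (y := Complex.I) (by simp [MU4.Ltr.v]) hzp
  have hm := MU4.special_value .b (by simp) (by simp) hr (y := -Complex.I) (by simp [MU4.Ltr.v]) hzm
  obtain ⟨e, he, a, b, hab⟩ := MU4.mem_VV.mp (MU4.PP_all r hr w hw1 hw2 hw3)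
  have hb := MU4.binom_cong hr
  have pb := MU4.val_pow (x := .b) (by simp) (by simp) r
  have pc := MU4.val_pow (x := .c) (by simp) (by simp) r
  have hc : MU4.XX - MU4.dd = MU4.val [.c] := by rw [← MU4.val_b_sub_c, MU4.XX]; ring
  rw [hc] at hb
  have hX : MU4.XX = MU4.val [.b] := rfl
  rw [← hX] at pb
  set e' := MU4.val [.c] ^ r - MU4.XX ^ r + r * (MU4.XX ^ (r - 1) * MU4.dd) with he'
  have hr0 : (r:ℂ) ≠ 0 := by exact_mod_cast (by omega : r ≠ 0)
  have hs : ((-1:ℂ) ^ r) * ((-1:ℂ) ^ r) = 1 := by rw [← mul_pow]; simp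
  have hmem : e + ((b / r : ℚ) : ℂ) * e' ∈ MU4.Zw r (r - 1) := by
    refine Submodule.add_mem _ he ?_
    rw [← MU4.qsmul_eq]
    exact Submodule.smul_mem _ _ hb
  have hmem2 := (MU4.Zw r (r - 1)).smul_mem ((-1) ^ r : ℚ) hmem
  rw [MU4.qsmul_eq] at hmem2
  refine ⟨-(b / r) * r.factorial, (a + b / r) * r.factorial, MU4.Zw_le_depth hr ?_⟩
  convert hmem2 using 1
  rw [hw, hp, hm, hab]
  have e1 : MU4.XX ^ (r - 1) * MU4.dd = (e' - MU4.val [.c] ^ r + MU4.XX ^ r) / r := by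
    rw [he']; field_simp; ring
  rw [e1, pb, pc]
  push_cast
  field_simp
  ring
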